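/- Let n ≥ 2 be an integer, let m = ⌊(n−1)/2⌋, let k be an integer with 0 ≤ k ≤ m, and let λ be a real number with 1/n ≤ λ ≤ 2/n. Then for every interval I ⊆ ℝ, the Hausdorff dimension of S_n(I,λ) is at most (n−k+1)(1−kλ)/((n−2k)(1+λ)). -/

import Mathlib

open MeasureTheory
open scoped ENNReal

/-- Distance from a real number to the nearest integer. -/
noncomputable def distNearestInt (y : ℝ) : ℝ := |y - round y|

/-- The `n`-th simultaneous Diophantine exponent `λ_n(x) ∈ [0,∞]`: the supremum of all
`λ > 0` such that `max_{1 ≤ i ≤ n} ‖q x^i‖ ≤ q^{-λ}` holds for infinitely many positive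
integers `q`. -/
noncomputable def simExponent (n : ℕ) (x : ℝ) : ℝ≥0∞ :=
  sSup (ENNReal.ofReal '' {l : ℝ | 0 < l ∧
    {q : ℕ | 0 < q ∧
      ∀ i ∈ Finset.Icc 1 n, distNearestInt ((q : ℝ) * x ^ i) ≤ (q : ℝ) ^ (-l)}.Infinite})

/-- `S_n(I, λ) = {x ∈ I : λ_n(x) > λ}`. -/
noncomputable def SimSet (n : ℕ) (I : Set ℝ) (lam : ℝ) : Set ℝ :=
  {x ∈ I | ENNReal.ofReal lam < simExponent n x}


namespace Bern
open Polynomial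

/-- Mahler measure of an integer polynomial, used as a height. -/
noncomputable def ht (P : ℤ[X]) : ℝ := (P.map (Int.castRingHom ℂ)).mahlerMeasure

/-- The real polynomial attached to an integer polynomial. -/
noncomputable def rp (P : ℤ[X]) : ℝ[X] := P.map (Int.castRingHom ℝ)

/-- Taylor coefficients at `x`. -/
noncomputable def tc (P : ℤ[X]) (x : ℝ) (j : ℕ) : ℝ := (taylor x (rp P)).coeff j

lemma ht_mul (P Q : ℤ[X]) : ht (P * Q) = ht P * ht Q := by
  simp [ht, Polynomial.map_mul, mahlerMeasure_mul]

lemma one_le_ht {P : ℤ[X]} (hP : P ≠ 0) : 1 ≤ ht P := one_le_mahlerMeasure_of_ne_zero hP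

lemma ht_nonneg (P : ℤ[X]) : 0 ≤ ht P := mahlerMeasure_nonneg _

lemma ht_pow (P : ℤ[X]) (m : ℕ) : ht (P ^ m) = ht P ^ m := by
  induction m with
  | zero => simp [ht]
  | succ m ih => rw [pow_succ, pow_succ, ht_mul, ih]

lemma abs_coeff_le (P : ℤ[X]) (d : ℕ) (hd : P.natDegree ≤ d) (j : ℕ) :
    |(P.coeff j : ℝ)| ≤ 2 ^ d * ht P := by
  have h := norm_coeff_le_choose_mul_mahlerMeasure j (P.map (Int.castRingHom ℂ))
  rw [coeff_map] at h
  have h1 : ‖(Int.castRingHom ℂ) (P.coeff j)‖ = |(P.coeff j : ℝ)| := by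
    simp
  rw [h1] at h
  refine h.trans ?_
  have h2 : ((P.map (Int.castRingHom ℂ)).natDegree.choose j : ℝ) ≤ 2 ^ d := by
    have h3 : (P.map (Int.castRingHom ℂ)).natDegree ≤ d := (natDegree_map_le).trans hd
    calc (((P.map (Int.castRingHom ℂ)).natDegree.choose j : ℕ) : ℝ)
        ≤ ((2 ^ (P.map (Int.castRingHom ℂ)).natDegree : ℕ) : ℝ) := by
          exact_mod_cast Nat.choose_le_two_pow _ _
      _ ≤ 2 ^ d := by
          push_cast
          exact pow_le_pow_right₀ (by norm_num) h3
  exact mul_le_mul_of_nonneg_right h2 (ht_nonneg _)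

lemma ht_le_of_coeff (P : ℤ[X]) (d : ℕ) (hd : P.natDegree ≤ d) (B : ℝ)
    (hB : ∀ j, |(P.coeff j : ℝ)| ≤ B) : ht P ≤ (d + 1) * B := by
  have h := mahlerMeasure_le_sum_norm_coeff (P.map (Int.castRingHom ℂ))
  refine h.trans ?_
  rw [sum_over_range' _ (by simp) (d + 1) (by have := natDegree_map_le (p := P) (f := Int.castRingHom ℂ); omega)]
  calc _ ≤ ∑ a ∈ Finset.range (d + 1), B := by
        apply Finset.sum_le_sum
        intro i _
        have := hB i
        simpa using this
    _ = _ := by simp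

lemma rp_natDegree (P : ℤ[X]) : (rp P).natDegree = P.natDegree :=
  natDegree_map_eq_of_injective (by exact Int.cast_injective) P

lemma tc_eq_zero (P : ℤ[X]) (x : ℝ) (j : ℕ) (h : P.natDegree < j) : tc P x j = 0 := by
  apply coeff_eq_zero_of_natDegree_lt
  rw [natDegree_taylor, rp_natDegree]; exact h

lemma tc_zero (P : ℤ[X]) (x : ℝ) : tc P x 0 = (rp P).eval x := by simp [tc]

lemma tc_one (P : ℤ[X]) (x : ℝ) : tc P x 1 = (rp P).derivative.eval x := by simp [tc]

lemma tc_natDegree (P : ℤ[X]) (x : ℝ) (d : ℕ) (h : P.natDegree ≤ d) : tc P x d = P.coeff d := by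
  rcases h.lt_or_eq with h | h
  · rw [tc_eq_zero _ _ _ h, coeff_eq_zero_of_natDegree_lt h]; simp
  · subst h
    have := coeff_taylor_natDegree (r := x) (f := rp P)
    rw [leadingCoeff, rp_natDegree] at this
    rw [tc, this]
    simp [rp]

lemma tc_sub (P Q : ℤ[X]) (x : ℝ) (j : ℕ) : tc (P - Q) x j = tc P x j - tc Q x j := by
  simp [tc, rp]

lemma tc_mul_zero (P Q : ℤ[X]) (x : ℝ) : tc (P * Q) x 0 = tc P x 0 * tc Q x 0 := by
  simp [tc, rp]

lemma tc_mul_one (P Q : ℤ[X]) (x : ℝ) :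
    tc (P * Q) x 1 = tc P x 1 * tc Q x 0 + tc P x 0 * tc Q x 1 := by
  rw [tc_one, tc_one, tc_one, tc_zero, tc_zero]
  simp [rp, derivative_mul]

lemma tc_derivative (P : ℤ[X]) (x : ℝ) (j : ℕ) :
    tc (derivative P) x j = (j + 1) * tc P x (j + 1) := by
  have h : taylor x (rp (derivative P)) = derivative (taylor x (rp P)) := by
    simp [rp, taylor_apply, derivative_comp, derivative_map]
  rw [tc, h, coeff_derivative, tc]; ring

lemma abs_sum_coeff_taylor (f : ℝ[X]) (d : ℕ) (hd : f.natDegree ≤ d) (x : ℝ) (j : ℕ) (B : ℝ)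
    (hB : ∀ i, j ≤ i → |f.coeff i| * |x| ^ (i - j) ≤ B) :
    |(taylor x f).coeff j| ≤ (d + 1) * 2 ^ d * B := by
  have hB0 : 0 ≤ B := le_trans (by positivity) (hB j le_rfl)
  rw [taylor_coeff, hasseDeriv_apply, sum_over_range' _ (by simp) (d + 1) (by omega), eval_finsetSum]
  calc _ ≤ ∑ i ∈ Finset.range (d + 1), |eval x ((monomial (i - j)) ((i.choose j : ℝ) * f.coeff i))| :=
        Finset.abs_sum_le_sum_abs _ _
    _ ≤ ∑ i ∈ Finset.range (d + 1), 2 ^ d * B := by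
        apply Finset.sum_le_sum
        intro i hi
        rw [Finset.mem_range] at hi
        rw [eval_monomial]
        by_cases hij : j ≤ i
        · rw [abs_mul, abs_mul, abs_pow, mul_assoc]
          have h2 : |(i.choose j : ℝ)| ≤ 2 ^ d := by
            rw [abs_of_nonneg (by positivity)]
            calc ((i.choose j : ℕ) : ℝ) ≤ ((2 ^ i : ℕ) : ℝ) := by
                  exact_mod_cast Nat.choose_le_two_pow _ _
              _ ≤ 2 ^ d := by
                push_cast
                exact pow_le_pow_right₀ (by norm_num) (by omega)
          exact mul_le_mul h2 (hB i hij) (by positivity) (by positivity)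
        · rw [Nat.choose_eq_zero_of_lt (by omega)]
          simp; positivity
    _ = _ := by simp; ring

lemma abs_tc_le (P : ℤ[X]) (d : ℕ) (hd : P.natDegree ≤ d) (M x : ℝ) (hx : |x| ≤ M) (j : ℕ) :
    |tc P x j| ≤ (d + 1) * 2 ^ d * (2 ^ d * (max M 1) ^ d) * ht P := by
  have := abs_sum_coeff_taylor (rp P) d (by rw [rp_natDegree]; exact hd) x j
    (2 ^ d * (max M 1) ^ d * ht P) (by
      intro i hij
      have h1 := abs_coeff_le P d hd i
      by_cases hid : i ≤ d
      · have h2 : |x| ^ (i - j) ≤ (max M 1) ^ d := by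
          calc |x| ^ (i - j) ≤ (max M 1) ^ (i - j) :=
                pow_le_pow_left₀ (abs_nonneg _) (hx.trans (le_max_left _ _)) _
            _ ≤ (max M 1) ^ d := pow_le_pow_right₀ (le_max_right _ _) (by omega)
        have h3 : |(rp P).coeff i| ≤ 2 ^ d * ht P := by simpa [rp] using h1
        calc _ ≤ (2 ^ d * ht P) * (max M 1) ^ d :=
              mul_le_mul h3 h2 (by positivity) (by have := ht_nonneg P; positivity)
          _ = _ := by ring
      · have : (rp P).coeff i = 0 := by
          apply coeff_eq_zero_of_natDegree_lt
          rw [rp_natDegree]; omega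
        rw [this]
        have := ht_nonneg P
        have : (0:ℝ) ≤ max M 1 := le_trans zero_le_one (le_max_right _ _)
        simp; positivity)
  rw [tc]; linarith

lemma ht_le_of_tc (P : ℤ[X]) (d : ℕ) (hd : P.natDegree ≤ d) (M x : ℝ) (hx : |x| ≤ M) (B : ℝ)
    (hB : ∀ j, |tc P x j| ≤ B) :
    ht P ≤ (d + 1) * ((d + 1) * 2 ^ d * ((max M 1) ^ d)) * B := by
  have hB0 : 0 ≤ B := (abs_nonneg _).trans (hB 0)
  have hM0 : (0:ℝ) ≤ max M 1 := le_trans zero_le_one (le_max_right _ _)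
  have hT : taylor (-x) (taylor x (rp P)) = rp P := by
    rw [taylor_taylor]; simp
  have key : ∀ j, |(P.coeff j : ℝ)| ≤ (d + 1) * 2 ^ d * ((max M 1) ^ d * B) := by
    intro j
    have := abs_sum_coeff_taylor (taylor x (rp P)) d (by rw [natDegree_taylor, rp_natDegree]; exact hd) (-x) j
      ((max M 1) ^ d * B) (by
        intro i hij
        by_cases hid : i ≤ d
        · have h2 : |-x| ^ (i - j) ≤ (max M 1) ^ d := by
            rw [abs_neg]
            calc |x| ^ (i - j) ≤ (max M 1) ^ (i - j) :=
                  pow_le_pow_left₀ (abs_nonneg _) (hx.trans (le_max_left _ _)) _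
              _ ≤ (max M 1) ^ d := pow_le_pow_right₀ (le_max_right _ _) (by omega)
          rw [mul_comm ((max M 1) ^ d)]
          exact mul_le_mul (hB i) h2 (by positivity) hB0
        · have h0 := tc_eq_zero P x i (by omega)
          rw [tc] at h0
          rw [h0]; simp; positivity)
    rw [hT] at this
    simpa [rp] using this
  have := ht_le_of_coeff P d hd _ key
  linarith

lemma tc_shift (P : ℤ[X]) (d : ℕ) (hd : P.natDegree ≤ d) (x y : ℝ) (j : ℕ) (B δ : ℝ)
    (hxy : |x - y| ≤ δ) (hB : ∀ i, j ≤ i → |tc P x i| * δ ^ (i - j) ≤ B) :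
    |tc P y j| ≤ (d + 1) * 2 ^ d * B := by
  have hT : taylor (y - x) (taylor x (rp P)) = taylor y (rp P) := by
    rw [taylor_taylor]; simp
  rw [tc, ← hT]
  apply abs_sum_coeff_taylor _ d (by rw [natDegree_taylor, rp_natDegree]; exact hd)
  intro i hij
  refine le_trans ?_ (hB i hij)
  rw [abs_sub_comm] at hxy
  exact mul_le_mul_of_nonneg_left (pow_le_pow_left₀ (abs_nonneg _) hxy _) (abs_nonneg _)

end Bern

namespace Bern
open Polynomial

lemma coeff_prod_bound (r : ℝ) (hr : 0 ≤ r) (s : Multiset ℂ) (hs : ∀ b ∈ s, r ≤ ‖b‖) (j : ℕ) :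
    ‖((s.map (fun b => X + C b)).prod).coeff j‖ * r ^ j ≤ 2 ^ (Multiset.card s) * ((s.map (fun b => ‖b‖)).prod) := by
  induction s using Multiset.induction_on generalizing j with
  | empty =>
    simp [coeff_one]
    split_ifs with h
    · simp [h]
    · simp
  | cons b s ih =>
    have ih' := ih (fun b hb => hs b (Multiset.mem_cons_of_mem hb))
    have hb := hs b (Multiset.mem_cons_self _ _)
    simp only [Multiset.map_cons, Multiset.prod_cons, Multiset.card_cons]
    set p := (s.map (fun b => X + C b)).prod
    set π := (s.map (fun b => ‖b‖)).prod
    have hπ : 0 ≤ π := by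
      apply Multiset.prod_nonneg
      intro a ha
      obtain ⟨b, _, rfl⟩ := Multiset.mem_map.1 ha
      exact norm_nonneg _
    rw [add_mul, coeff_add, coeff_C_mul]
    have h1 : ‖(X * p).coeff j‖ * r ^ j ≤ ‖b‖ * (2 ^ (Multiset.card s) * π) := by
      cases j with
      | zero => simp; positivity
      | succ j =>
        rw [coeff_X_mul, pow_succ, ← mul_assoc, mul_comm]
        exact mul_le_mul hb (ih' j) (by positivity) (norm_nonneg _)
    have h2 : ‖b * p.coeff j‖ * r ^ j ≤ ‖b‖ * (2 ^ (Multiset.card s) * π) := by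
      rw [norm_mul, mul_assoc]
      exact mul_le_mul_of_nonneg_left (ih' j) (norm_nonneg _)
    calc _ ≤ (‖(X * p).coeff j‖ + ‖b * p.coeff j‖) * r ^ j :=
          mul_le_mul_of_nonneg_right (norm_add_le _ _) (by positivity)
      _ ≤ _ := by rw [pow_succ]; nlinarith

lemma tc_complex (P : ℤ[X]) (x : ℝ) (j : ℕ) :
    (taylor (x : ℂ) (P.map (Int.castRingHom ℂ))).coeff j = ((tc P x j : ℝ) : ℂ) := by
  have h : taylor (x : ℂ) (P.map (Int.castRingHom ℂ)) = (taylor x (rp P)).map Complex.ofRealHom := by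
    rw [map_taylor, rp, map_map]
    congr 2
  rw [h, coeff_map]; rfl

lemma root_lemma (P : ℤ[X]) (x : ℝ) (hP : 1 ≤ P.natDegree) (hx : tc P x 0 ≠ 0) :
    ∃ α ∈ (P.map (Int.castRingHom ℂ)).roots, ∃ r : ℝ, 0 < r ∧ |x - α.re| ≤ r ∧
      ∀ j, |tc P x j| * r ^ j ≤ 2 ^ P.natDegree * |tc P x 0| := by
  set f := P.map (Int.castRingHom ℂ) with hf
  have hdeg : f.natDegree = P.natDegree := natDegree_map_eq_of_injective (by exact Int.cast_injective) P
  have hs : f.Splits := IsAlgClosed.splits f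
  have hcard : Multiset.card f.roots = P.natDegree := by rw [← hdeg]; exact hs.natDegree_eq_card_roots.symm
  have hne : f.roots.toFinset.Nonempty := by
    rw [Multiset.toFinset_nonempty]
    intro h
    rw [h] at hcard; simp at hcard; omega
  obtain ⟨α, hα, hmin⟩ := Finset.exists_min_image f.roots.toFinset (fun a => ‖(x : ℂ) - a‖) hne
  rw [Multiset.mem_toFinset] at hα
  have hprod := hs.eq_prod_roots
  have hT : taylor (x : ℂ) f = C f.leadingCoeff * ((f.roots.map (fun a => (x : ℂ) - a)).map (fun b => X + C b)).prod := by
    conv_lhs => rw [hprod]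
    rw [taylor_mul, taylor_C]
    congr 1
    have hmp := map_multiset_prod (taylorAlgHom (x : ℂ)) (f.roots.map (fun a => X - C a))
    have hco : ∀ p : ℂ[X], taylorAlgHom (x : ℂ) p = taylor (x : ℂ) p := fun p => rfl
    rw [hco] at hmp
    rw [hmp, Multiset.map_map, Multiset.map_map]
    congr 1
    apply Multiset.map_congr rfl
    intro a _
    simp [hco]
    ring
  set s := f.roots.map (fun a => (x : ℂ) - a) with hsdef
  have h0 : ‖(tc P x 0 : ℂ)‖ = ‖f.leadingCoeff‖ * (s.map (fun b => ‖b‖)).prod := by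
    rw [← tc_complex, hT]
    simp only [coeff_C_mul, norm_mul]
    congr 1
    rw [coeff_zero_eq_eval_zero, eval_multiset_prod, Multiset.map_map]
    simp only [Function.comp_def, eval_add, eval_X, eval_C, zero_add]
    rw [Multiset.map_id']
    exact map_multiset_prod (normHom : ℂ →*₀ ℝ) s
  rw [Complex.norm_real, Real.norm_eq_abs] at h0
  refine ⟨α, hα, ‖(x : ℂ) - α‖, ?_, ?_, ?_⟩
  · rw [norm_pos_iff]
    intro h
    apply hx
    rw [← abs_eq_zero, h0]
    have : ((s.map (fun b => ‖b‖)).prod) = 0 := by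
      apply Multiset.prod_eq_zero
      rw [Multiset.mem_map]
      exact ⟨0, by rw [hsdef, Multiset.mem_map]; exact ⟨α, hα, h⟩, by simp⟩
    rw [this, mul_zero]
  · have := Complex.abs_re_le_norm ((x : ℂ) - α)
    simpa using this
  · intro j
    have h1 := coeff_prod_bound ‖(x : ℂ) - α‖ (norm_nonneg _) s (by
      intro b hb
      rw [hsdef, Multiset.mem_map] at hb
      obtain ⟨a, ha, rfl⟩ := hb
      exact hmin a (by rwa [Multiset.mem_toFinset])) j
    have h2 : |tc P x j| = ‖f.leadingCoeff‖ * ‖((s.map (fun b => X + C b)).prod).coeff j‖ := by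
      rw [← Real.norm_eq_abs, ← Complex.norm_real, ← tc_complex, hT, coeff_C_mul, norm_mul]
    have h3 : Multiset.card s = P.natDegree := by rw [hsdef, Multiset.card_map, hcard]
    rw [h3] at h1
    rw [h2, h0]
    have := mul_le_mul_of_nonneg_left h1 (norm_nonneg f.leadingCoeff)
    linarith

lemma res_ne_zero (P Q : ℤ[X]) (hP : P ≠ 0) (h : IsRelPrime P Q) : resultant P Q ≠ 0 := by
  intro h0
  have h1 : resultant (P.map (algebraMap ℤ ℚ)) (Q.map (algebraMap ℤ ℚ)) = 0 := by
    rw [natDegree_map_eq_of_injective (by exact Int.cast_injective),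
      natDegree_map_eq_of_injective (by exact Int.cast_injective), resultant_map_map, h0, map_zero]
  rw [resultant_eq_zero_iff] at h1
  apply h1.2
  rw [← isRelPrime_iff_isCoprime]
  intro D hD1 hD2
  have hD0 : D ≠ 0 := by
    rintro rfl
    rw [zero_dvd_iff] at hD1
    exact hP ((map_injective (algebraMap ℤ ℚ) (by exact Int.cast_injective)) (by simpa using hD1))
  apply isUnit_or_eq_zero_of_isUnit_integerNormalization_primPart (R := ℤ) hD0
  have hass : ((IsLocalization.integerNormalization (nonZeroDivisors ℤ) D).primPart).map (algebraMap ℤ ℚ) ∣ D := by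
    obtain ⟨c, c0, hc⟩ := IsLocalization.integerNormalization_spec (nonZeroDivisors ℤ) D
    have h2 := map_dvd (mapRingHom (algebraMap ℤ ℚ)) (primPart_dvd (IsLocalization.integerNormalization (nonZeroDivisors ℤ) D))
    simp only [coe_mapRingHom] at h2
    rw [hc] at h2
    have h3 : c • D = C (c : ℚ) * D := by
      rw [← smul_eq_C_mul, Int.cast_smul_eq_zsmul]
    rw [h3] at h2
    have hu : IsUnit (C (c : ℚ)) := by
      rw [isUnit_C, isUnit_iff_ne_zero]
      exact_mod_cast nonZeroDivisors.ne_zero c0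
    exact (hu.dvd_mul_left).1 h2
  apply h
  · exact (isPrimitive_primPart _).dvd_of_fraction_map_dvd_fraction_map (K := ℚ) (hass.trans hD1)
  · exact (isPrimitive_primPart _).dvd_of_fraction_map_dvd_fraction_map (K := ℚ) (hass.trans hD2)

lemma det_bound {N : ℕ} (A : Matrix (Fin N) (Fin N) ℝ) (u v : Fin N → ℝ)
    (h : ∀ i j, |A i j| ≤ u i * v j) :
    |A.det| ≤ N.factorial * ((∏ i, u i) * ∏ i, v i) := by
  rw [Matrix.det_apply]
  refine (Finset.abs_sum_le_sum_abs _ _).trans ?_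
  calc _ ≤ ∑ σ : Equiv.Perm (Fin N), ((∏ i, u i) * ∏ i, v i) := by
        apply Finset.sum_le_sum
        intro σ _
        have : |Equiv.Perm.sign σ • ∏ i, A (σ i) i| = ∏ i, |A (σ i) i| := by
          rw [← Finset.abs_prod]
          rcases Int.units_eq_one_or (Equiv.Perm.sign σ) with h | h <;> rw [h] <;> simp
        rw [this]
        calc ∏ i, |A (σ i) i| ≤ ∏ i, (u (σ i) * v i) :=
              Finset.prod_le_prod (fun _ _ => abs_nonneg _) (fun i _ => h _ _)
          _ = _ := by
              rw [Finset.prod_mul_distrib, Equiv.prod_comp σ u]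
    _ = _ := by simp [Fintype.card_perm]

lemma sum_tsub (K N : ℕ) (h : K ≤ N) : 2 * ∑ i ∈ Finset.range N, (K - i) = K * (K + 1) := by
  have h1 : ∑ i ∈ Finset.range N, (K - i) = ∑ i ∈ Finset.range K, (K - i) := by
    symm
    apply Finset.sum_subset (Finset.range_mono h)
    intro i _ hi
    simp at hi
    omega
  rw [h1]
  clear h h1
  induction K with
  | zero => simp
  | succ K ih =>
    have : ∑ i ∈ Finset.range (K + 1), (K + 1 - i) = ∑ i ∈ Finset.range K, (K - i) + (K + 1) := by
      rw [Finset.sum_range_succ']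
      simp
    rw [this, mul_add, ih]; ring

lemma prod_tsub (ε : ℝ) (K N : ℕ) : ∏ i : Fin N, ε ^ (K - (i : ℕ)) = ε ^ (∑ i ∈ Finset.range N, (K - i)) := by
  rw [Finset.prod_pow_eq_pow_sum, Finset.sum_range]

lemma cluster (P Q : ℤ[X]) (x ε H1 H2 : ℝ) (k1 k2 : ℕ) (hε : 0 < ε) (hε1 : ε ≤ 1)
    (hk1 : k1 ≤ P.natDegree) (hk2 : k2 ≤ Q.natDegree) (hP0 : P ≠ 0) (hc : IsRelPrime P Q)
    (hH1 : 0 ≤ H1) (hH2 : 0 ≤ H2)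
    (hP : ∀ j, |tc P x j| ≤ H1 * ε ^ (k1 - j)) (hQ : ∀ j, |tc Q x j| ≤ H2 * ε ^ (k2 - j)) :
    1 ≤ ((P.natDegree + Q.natDegree).factorial : ℝ) * (H1 ^ Q.natDegree * H2 ^ P.natDegree * ε ^ (k1 * k2)) := by
  set m := P.natDegree with hm
  set n := Q.natDegree with hn
  have hres : (1:ℝ) ≤ |((resultant P Q : ℤ) : ℝ)| := by
    have := Int.one_le_abs (res_ne_zero P Q hP0 hc)
    exact_mod_cast this
  have hres2 : ((resultant P Q : ℤ) : ℝ) = (sylvester (taylor x (rp P)) (taylor x (rp Q)) m n).det := by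
    have h1 := resultant_taylor (rp P) (rp Q) x
    rw [natDegree_taylor, natDegree_taylor, rp_natDegree, rp_natDegree] at h1
    have h2 : resultant (rp P) (rp Q) m n = ((resultant P Q : ℤ) : ℝ) := by
      rw [rp, rp, resultant_map_map]; rfl
    rw [← h2, ← h1]; rfl
  rw [hres2] at hres
  refine hres.trans ?_
  set u : Fin (m + n) → ℝ := fun i => ε ^ ((k1 + k2) - (i : ℕ)) with hu
  set v : Fin (m + n) → ℝ := fun j => j.addCases (fun j₁ : Fin m => H2 * (ε ^ (k1 - (j₁ : ℕ)))⁻¹)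
    (fun j₁ : Fin n => H1 * (ε ^ (k2 - (j₁ : ℕ)))⁻¹) with hv
  refine (det_bound _ u v ?_).trans ?_
  · intro i j
    have key : ∀ (a b c t : ℕ), b ≤ i.1 → a + c = k1 + k2 → ε ^ (c - (i.1 - b)) ≤ ε ^ ((k1 + k2) - i.1) * (ε ^ (a - b))⁻¹ := by
      intro a b c t hb hac
      rw [le_mul_inv_iff₀ (by positivity), ← pow_add]
      exact pow_le_pow_of_le_one hε.le hε1 (by omega)
    induction j using Fin.addCases with
    | left j =>
      simp only [sylvester, Matrix.of_apply, Fin.addCases_left, hu, hv]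
      split_ifs with hij
      · have h1 := hQ (i.1 - j.1)
        rw [tc] at h1
        refine h1.trans ?_
        have := mul_le_mul_of_nonneg_left (key k1 j.1 k2 0 hij.1 rfl) hH2
        linarith
      · simp; positivity
    | right j =>
      simp only [sylvester, Matrix.of_apply, Fin.addCases_right, hu, hv]
      split_ifs with hij
      · have h1 := hP (i.1 - j.1)
        rw [tc] at h1
        refine h1.trans ?_
        have := mul_le_mul_of_nonneg_left (key k2 j.1 k1 0 hij.1 (by ring)) hH1
        linarith
      · simp; positivity
  · apply mul_le_mul_of_nonneg_left _ (by positivity)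
    rw [Fin.prod_univ_add v]
    simp only [hv, Fin.addCases_left, Fin.addCases_right, hu]
    rw [Finset.prod_mul_distrib, Finset.prod_mul_distrib, Finset.prod_inv_distrib, Finset.prod_inv_distrib,
      prod_tsub, prod_tsub, prod_tsub]
    simp only [Finset.prod_const, Finset.card_univ, Fintype.card_fin]
    have e1 := sum_tsub (k1 + k2) (m + n) (by omega)
    have e2 := sum_tsub k1 m hk1
    have e3 := sum_tsub k2 n hk2
    have e4 : ∑ i ∈ Finset.range (m + n), (k1 + k2 - i) = ∑ i ∈ Finset.range m, (k1 - i) + ∑ i ∈ Finset.range n, (k2 - i) + k1 * k2 := by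
      have : 2 * ∑ i ∈ Finset.range (m + n), (k1 + k2 - i) = 2 * (∑ i ∈ Finset.range m, (k1 - i) + ∑ i ∈ Finset.range n, (k2 - i) + k1 * k2) := by
        rw [mul_add, mul_add, e1, e2, e3]; ring
      omega
    rw [e4, pow_add, pow_add]
    apply le_of_eq
    have : ε ≠ 0 := hε.ne'
    field_simp

end Bern

namespace Bern
open Polynomial Filter

/-- generic points -/
def Gen (d : ℕ) (σ c M : ℝ) (x : ℝ) : Prop :=
  |x| ≤ M ∧ (∀ R : ℤ[X], R ≠ 0 → tc R x 0 ≠ 0) ∧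
    ∀ R : ℤ[X], R ≠ 0 → R.natDegree < d → c * (ht R) ^ (1 - ((R.natDegree : ℝ) + 1) / σ) ≤ |tc R x 0|

lemma ev_const (C ε : ℝ) (hε : 0 < ε) : ∀ᶠ H : ℝ in atTop, 1 < H ∧ C ≤ H ^ ε := by
  filter_upwards [eventually_gt_atTop 1, (tendsto_rpow_atTop hε).eventually_ge_atTop C] with H h1 h2
  exact ⟨h1, h2⟩

lemma ev_tc (d : ℕ) (M ε : ℝ) (hε : 0 < ε) : ∀ᶠ H : ℝ in atTop, ∀ (P : ℤ[X]) (x τ : ℝ),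
    P.natDegree ≤ d → |x| ≤ M → ht P ≤ H ^ τ → ∀ j, |tc P x j| ≤ H ^ (τ + ε) := by
  filter_upwards [ev_const ((d + 1) * 2 ^ d * (2 ^ d * (max M 1) ^ d)) ε hε] with H ⟨h1, h2⟩ P x τ hd hx hP j
  have h0 : 0 < H := by linarith
  refine (abs_tc_le P d hd M x hx j).trans ?_
  rw [Real.rpow_add h0, mul_comm (H ^ τ)]
  exact mul_le_mul h2 hP (ht_nonneg _) (by positivity)

lemma ev_ht (d : ℕ) (M ε : ℝ) (hε : 0 < ε) : ∀ᶠ H : ℝ in atTop, ∀ (P : ℤ[X]) (x τ : ℝ),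
    P.natDegree ≤ d → |x| ≤ M → (∀ j, |tc P x j| ≤ H ^ τ) → ht P ≤ H ^ (τ + ε) := by
  filter_upwards [ev_const ((d + 1) * ((d + 1) * 2 ^ d * ((max M 1) ^ d))) ε hε] with H ⟨h1, h2⟩ P x τ hd hx hP
  have h0 : 0 < H := by linarith
  refine (ht_le_of_tc P d hd M x hx _ hP).trans ?_
  rw [Real.rpow_add h0, mul_comm (H ^ τ)]
  exact mul_le_mul_of_nonneg_right h2 (by positivity)

lemma ev_shift (d : ℕ) (ε : ℝ) (hε : 0 < ε) : ∀ᶠ H : ℝ in atTop, ∀ (P : ℤ[X]) (x y q τ : ℝ) (j : ℕ),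
    P.natDegree ≤ d → |x - y| ≤ H ^ (-q) →
    (∀ i : ℕ, j ≤ i → |tc P x i| ≤ H ^ (τ + ((i : ℝ) - j) * q)) → |tc P y j| ≤ H ^ (τ + ε) := by
  filter_upwards [ev_const ((d + 1) * 2 ^ d) ε hε] with H ⟨h1, h2⟩ P x y q τ j hd hxy hP
  have h0 : 0 < H := by linarith
  refine (tc_shift P d hd x y j (H ^ τ) (H ^ (-q)) hxy ?_).trans ?_
  · intro i hij
    calc |tc P x i| * (H ^ (-q)) ^ (i - j) ≤ H ^ (τ + ((i : ℝ) - j) * q) * (H ^ (-q)) ^ (i - j) :=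
          mul_le_mul_of_nonneg_right (hP i hij) (by positivity)
      _ = H ^ τ := by
          rw [← Real.rpow_mul_natCast h0.le, ← Real.rpow_add h0, Nat.cast_sub hij]
          congr 1; ring
  · rw [Real.rpow_add h0, mul_comm (H ^ τ)]
    exact mul_le_mul_of_nonneg_right h2 (by positivity)

lemma ev_cluster (d : ℕ) (ε : ℝ) (hε : 0 < ε) : ∀ᶠ H : ℝ in atTop,
    ∀ (P Q : ℤ[X]) (x a b e : ℝ) (k1 k2 : ℕ), P.natDegree ≤ d → Q.natDegree ≤ d →
    P ≠ 0 → IsRelPrime P Q → 0 ≤ e → k1 ≤ P.natDegree → k2 ≤ Q.natDegree →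
    (∀ j : ℕ, |tc P x j| ≤ H ^ (a - e * ((k1 - j : ℕ) : ℝ))) →
    (∀ j : ℕ, |tc Q x j| ≤ H ^ (b - e * ((k2 - j : ℕ) : ℝ))) →
    e * (k1 * k2) ≤ a * Q.natDegree + b * P.natDegree + ε := by
  filter_upwards [ev_const (((d + d).factorial : ℕ) : ℝ) ε hε] with H ⟨h1, h2⟩ P Q x a b e k1 k2 hPd hQd hP0 hPQ he hk1 hk2 hP hQ
  have h0 : 0 < H := by linarith
  have conv : ∀ (a : ℝ) (m : ℕ), H ^ (a - e * (m : ℝ)) = H ^ a * (H ^ (-e)) ^ m := by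
    intro a m
    rw [← Real.rpow_mul_natCast h0.le, ← Real.rpow_add h0]
    congr 1; ring
  have := cluster P Q x (H ^ (-e)) (H ^ a) (H ^ b) k1 k2 (by positivity)
    (Real.rpow_le_one_of_one_le_of_nonpos h1.le (by linarith)) hk1 hk2 hP0 hPQ (by positivity) (by positivity)
    (fun j => by rw [← conv]; exact hP j) (fun j => by rw [← conv]; exact hQ j)
  have h3 : (((P.natDegree + Q.natDegree).factorial : ℕ) : ℝ) ≤ H ^ ε := by
    refine le_trans ?_ h2
    exact_mod_cast Nat.factorial_le (by omega)
  have h4 : (1:ℝ) ≤ H ^ (ε + (a * Q.natDegree + b * P.natDegree + (-e) * ((k1 * k2 : ℕ) : ℝ))) := by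
    rw [Real.rpow_add h0, Real.rpow_add h0, Real.rpow_add h0, Real.rpow_mul_natCast h0.le,
      Real.rpow_mul_natCast h0.le, Real.rpow_mul_natCast h0.le]
    refine this.trans ?_
    exact mul_le_mul_of_nonneg_right h3 (by positivity)
  have h5 : 0 ≤ ε + (a * Q.natDegree + b * P.natDegree + (-e) * ((k1 * k2 : ℕ) : ℝ)) := by
    by_contra hneg
    push Not at hneg
    have := Real.rpow_lt_one_of_one_lt_of_neg h1 hneg
    linarith
  push_cast at h5
  linarith

lemma rel_deriv {G : ℤ[X]} (hG : Irreducible G) (hg : 1 ≤ G.natDegree) : IsRelPrime G (derivative G) := by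
  rw [hG.isRelPrime_iff_not_dvd]
  intro h
  have h0 : derivative G ≠ 0 := by
    intro h0
    have := derivative_eq_zero.1 h0
    omega
  have := natDegree_le_of_dvd h h0
  have := natDegree_derivative_lt (p := G) (by omega)
  omega

lemma ev_cluster_deriv (d : ℕ) (ε : ℝ) (hε : 0 < ε) : ∀ᶠ H : ℝ in atTop,
    ∀ (G : ℤ[X]) (x a e : ℝ) (k : ℕ), G.natDegree ≤ d → Irreducible G → 0 ≤ e → k + 1 ≤ G.natDegree →
    (∀ j : ℕ, |tc G x j| ≤ H ^ (a - e * ((k + 1 - j : ℕ) : ℝ))) →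
    e * ((k + 1) * k) ≤ a * (2 * G.natDegree - 1) + ε := by
  have hε' : 0 < ε / (d + 1) := by positivity
  filter_upwards [ev_cluster d (ε / (d + 1)) hε', ev_const (d + 1) (ε / (d + 1)) hε'] with H hcl ⟨h1, h2⟩ G x a e k hd hG he hk hj
  have h0 : 0 < H := by linarith
  have hdeg : (derivative G).natDegree = G.natDegree - 1 := natDegree_derivative G
  have := hcl G (derivative G) x a (a + ε / (d + 1)) e (k + 1) k hd (by omega) hG.ne_zero
    (rel_deriv hG (by omega)) he hk (by omega) hj (by
      intro j
      rw [tc_derivative, abs_mul]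
      have h3 : a + ε / (d + 1) - e * ((k - j : ℕ) : ℝ) = ε / (d + 1) + (a - e * ((k + 1 - (j + 1) : ℕ) : ℝ)) := by
        rw [Nat.add_sub_add_right]; ring
      rw [h3, Real.rpow_add h0]
      by_cases hjd : j + 1 ≤ d
      · apply mul_le_mul _ (hj (j + 1)) (abs_nonneg _) (by positivity)
        rw [abs_of_nonneg (by positivity)]
        refine le_trans ?_ h2
        have : ((j + 1 : ℕ) : ℝ) ≤ d := by exact_mod_cast hjd
        push_cast at this; linarith
      · rw [tc_eq_zero _ _ _ (by omega)]
        simp; positivity)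
  rw [hdeg, Nat.cast_sub (by omega)] at this
  push_cast at this
  have h4 : ε / (d + 1) * G.natDegree + ε / (d + 1) ≤ ε := by
    have h5 : (G.natDegree : ℝ) ≤ d := by exact_mod_cast hd
    have : ε / (d + 1) * G.natDegree + ε / (d + 1) = ε * ((G.natDegree + 1) / (d + 1)) := by ring
    rw [this]
    apply mul_le_of_le_one_right hε.le
    rw [div_le_one (by positivity)]
    linarith
  linarith

lemma irr_rel {P Q : ℤ[X]} (hP : Irreducible P) (hQ : Irreducible Q) (h : ¬ IsRelPrime P Q) :
    Q = P ∨ Q = -P := by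
  rw [hP.isRelPrime_iff_not_dvd, not_not] at h
  obtain ⟨u, hu⟩ := (hP.associated_of_dvd hQ h)
  have hu1 := u.isUnit
  rw [Polynomial.isUnit_iff] at hu1
  obtain ⟨r, hr, hru⟩ := hu1
  rw [← hru] at hu
  rcases Int.isUnit_iff.1 hr with h | h
  · left; rw [← hu, h]; simp
  · right; rw [← hu, h]; simp

lemma ev_gen (d : ℕ) (σ c M ε : ℝ) (hσ : 0 < σ) (hσ1 : σ < 1) (hc : 0 < c) (hε : 0 < ε) :
    ∀ᶠ H : ℝ in atTop, ∀ (x : ℝ) (R : ℤ[X]) (τ β : ℝ), Gen d σ c M x → R ≠ 0 → R.natDegree < d →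
    ht R ≤ H ^ τ → |tc R x 0| ≤ H ^ (τ - β) → β * σ ≤ τ * (R.natDegree + 1) + ε := by
  filter_upwards [ev_const c⁻¹ ε hε] with H ⟨h1, h2⟩ x R τ β hx hR hd hht hv
  have h0 : 0 < H := by linarith
  have h3 := hx.2.2 R hR hd
  have hexp : 1 - ((R.natDegree : ℝ) + 1) / σ ≤ 0 := by
    rw [sub_nonpos, le_div_iff₀ hσ]
    have : (0:ℝ) ≤ R.natDegree := by positivity
    linarith
  have h4 : H ^ (τ * (1 - ((R.natDegree : ℝ) + 1) / σ)) ≤ (ht R) ^ (1 - ((R.natDegree : ℝ) + 1) / σ) := by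
    rw [Real.rpow_mul h0.le]
    exact Real.rpow_le_rpow_of_nonpos (by linarith [one_le_ht hR]) hht hexp
  have h5 : H ^ (-ε) ≤ c := by
    rw [Real.rpow_neg h0.le]
    exact inv_le_of_inv_le₀ hc h2
  have h6 : H ^ (-ε + τ * (1 - ((R.natDegree : ℝ) + 1) / σ)) ≤ H ^ (τ - β) := by
    rw [Real.rpow_add h0]
    exact ((mul_le_mul h5 h4 (by positivity) hc.le).trans h3).trans hv
  rw [Real.rpow_le_rpow_left_iff h1] at h6
  have h7 : β ≤ τ * (((R.natDegree : ℝ) + 1) / σ) + ε := by linarith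
  have h8 := mul_le_mul_of_nonneg_right h7 hσ.le
  have h9 : (τ * (((R.natDegree : ℝ) + 1) / σ) + ε) * σ = τ * (R.natDegree + 1) + ε * σ := by
    field_simp
  rw [h9] at h8
  nlinarith

end Bern

namespace Bern
open Polynomial Filter

/-- Polynomials with small value and derivative. -/
def Z (H x τ v : ℝ) (R : ℤ[X]) : Prop :=
  ht R ≤ H ^ τ ∧ |tc R x 0| ≤ H ^ (τ - 2 * v) ∧ |tc R x 1| ≤ H ^ (τ - v)

/-- The conclusion of the descent lemma. -/
def Desc (H x σ E : ℝ) (R : ℤ[X]) : Prop :=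
  ∀ τ v : ℝ, 0 ≤ v → Z H x τ v R →
    v * (1 + σ) ≤ τ * (R.natDegree + 1) + E * R.natDegree ∨
    ∃ (G : ℤ[X]) (γ V : ℝ), Irreducible G ∧ 1 ≤ G.natDegree ∧ G.natDegree ≤ R.natDegree ∧ 0 ≤ V ∧ V ≤ v ∧
      Z H x γ V G ∧
      γ * (G.natDegree + 1) - V * σ + (v - V) ≤ τ * (R.natDegree + 1) - v * σ + E * R.natDegree

lemma desc_const {H x σ E : ℝ} (h1 : 1 < H) (hσ1 : σ < 1) {R : ℤ[X]} (hR : R ≠ 0)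
    (hd : R.natDegree = 0) : Desc H x σ E R := by
  intro τ v hv hZ
  left
  rw [eq_C_of_natDegree_eq_zero hd] at hR hZ ⊢
  have hne : R.coeff 0 ≠ 0 := by simpa using hR
  have h2 := hZ.2.1
  have h3 : tc (C (R.coeff 0)) x 0 = R.coeff 0 := by simp [tc, rp]
  rw [h3] at h2
  have h4 : (1:ℝ) ≤ |(R.coeff 0 : ℝ)| := by exact_mod_cast Int.one_le_abs hne
  have h5 : 0 ≤ τ - 2 * v := by
    by_contra h
    push Not at h
    have := Real.rpow_lt_one_of_one_lt_of_neg h1 h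
    linarith
  simp
  nlinarith

lemma tc_C_mul (a : ℤ) (R : ℤ[X]) (x : ℝ) (j : ℕ) : tc (C a * R) x j = a * tc R x j := by
  simp only [tc, rp, Polynomial.map_mul, map_C, taylor_mul, taylor_C, coeff_C_mul]
  rfl

lemma desc_C_mul {H x σ E : ℝ} {a : ℤ} (ha : a ≠ 0) {R : ℤ[X]} (h : Desc H x σ E R) : Desc H x σ E (C a * R) := by
  intro τ v hv hZ
  have h4 : (1:ℝ) ≤ |(a : ℝ)| := by exact_mod_cast Int.one_le_abs ha
  have hdeg : (C a * R).natDegree = R.natDegree := natDegree_C_mul ha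
  rw [hdeg]
  apply h τ v hv
  refine ⟨?_, ?_, ?_⟩
  · refine le_trans ?_ hZ.1
    rw [ht_mul]
    have : 1 ≤ ht (C a) := one_le_ht (by simpa using ha)
    nlinarith [ht_nonneg R]
  · refine le_trans ?_ hZ.2.1
    rw [tc_C_mul, abs_mul]
    nlinarith [abs_nonneg (tc R x 0)]
  · refine le_trans ?_ hZ.2.2
    rw [tc_C_mul, abs_mul]
    nlinarith [abs_nonneg (tc R x 1)]

lemma nonneg_of_one_le {H a : ℝ} (h1 : 1 < H) (h : 1 ≤ H ^ a) : 0 ≤ a := by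
  by_contra hn
  push Not at hn
  have := Real.rpow_lt_one_of_one_lt_of_neg h1 hn
  linarith

lemma exp_rep {H a : ℝ} (h1 : 1 < H) (ha : 0 < a) : ∃ t : ℝ, a = H ^ t :=
  ⟨Real.logb H a, (Real.rpow_logb (by linarith) h1.ne' ha).symm⟩

lemma desc_pow {d : ℕ} {H x σ κ : ℝ} (h1 : 1 < H) (hσ : 1 / 2 < σ) (hσ1 : σ < 1) (hκ : 0 < κ)
    (hgen : ∀ (R : ℤ[X]) (τ β : ℝ), R ≠ 0 → R.natDegree < d →
      ht R ≤ H ^ τ → |tc R x 0| ≤ H ^ (τ - β) → β * σ ≤ τ * (R.natDegree + 1) + κ)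
    (hne : ∀ R : ℤ[X], R ≠ 0 → tc R x 0 ≠ 0)
    {p : ℤ[X]} (hp : Irreducible p) (hpd : 1 ≤ p.natDegree) (i : ℕ) (hd : (p ^ i).natDegree < d) :
    Desc H x σ ((4 * d + 6) * κ) (p ^ i) := by
  rcases Nat.lt_or_ge i 2 with hi | hi
  · interval_cases i
    · exact desc_const h1 hσ1 (by simp) (by simp)
    · rw [pow_one] at hd ⊢
      intro τ v hv hZ
      right
      refine ⟨p, τ, v, hp, hpd, le_rfl, hv, le_rfl, hZ, ?_⟩
      have : 0 ≤ (4 * d + 6) * κ * (p.natDegree : ℝ) := by positivity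
      linarith
  · intro τ v hv hZ
    left
    have h0 : 0 < H := by linarith
    set g := p.natDegree with hg
    have hdeg : (p ^ i).natDegree = i * g := natDegree_pow p i
    obtain ⟨t, htt⟩ := exp_rep h1 (lt_of_lt_of_le one_pos (one_le_ht hp.ne_zero))
    obtain ⟨b, hb⟩ := exp_rep h1 (abs_pos.2 (hne p hp.ne_zero))
    have ht0 : 0 ≤ t := nonneg_of_one_le h1 (by rw [← htt]; exact one_le_ht hp.ne_zero)
    have hid : i < d := by
      rw [hdeg] at hd
      nlinarith
    have e1 : t * i ≤ τ := by
      have := hZ.1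
      rw [ht_pow, htt, ← Real.rpow_mul_natCast h0.le, Real.rpow_le_rpow_left_iff h1] at this
      exact this
    have e2 : b * i ≤ τ - 2 * v := by
      have := hZ.2.1
      have e : tc (p ^ i) x 0 = (tc p x 0) ^ i := by simp [tc_zero, rp]
      rw [e, abs_pow, hb, ← Real.rpow_mul_natCast h0.le, Real.rpow_le_rpow_left_iff h1] at this
      exact this
    have hgd : p.natDegree < d := by
      rw [hdeg] at hd
      nlinarith
    have e3 := hgen p t (t - b) hp.ne_zero hgd htt.le (by rw [hb]; apply le_of_eq; congr 1; ring)
    rw [hdeg]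
    push_cast
    have hi' : (2:ℝ) ≤ i := by exact_mod_cast hi
    have hg' : (1:ℝ) ≤ g := by exact_mod_cast hpd
    have hid' : (i:ℝ) ≤ d := by exact_mod_cast hid.le
    have hT : 0 ≤ τ := le_trans (by positivity) e1
    -- (t-b) * σ * i ≤ t * i * (g+1) + κ i
    have e4 : (t - b) * σ * i ≤ t * i * (g + 1) + κ * i := by nlinarith
    have e5 : (t * i - (τ - 2 * v)) * σ ≤ t * i * (g + 1) + κ * i := by nlinarith
    have e6 : 2 * v * σ ≤ τ * (g + 1) + κ * i := by
      have : (τ - t * i) * σ ≤ (τ - t * i) * (g + 1) := by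
        apply mul_le_mul_of_nonneg_left _ (by linarith)
        linarith
      nlinarith
    have e7 : τ * (2 * g + 1) ≤ τ * (i * g + 1) := by
      apply mul_le_mul_of_nonneg_left _ hT
      nlinarith
    -- v(1+σ)(g+1) ≤ 2vσ(2g+1) ≤ (2g+1) (τ (g+1) + κ i)
    have e8 : (1 + σ) * (g + 1) ≤ 2 * σ * (2 * g + 1) := by nlinarith
    have e9 : v * ((1 + σ) * (g + 1)) ≤ v * (2 * σ * (2 * g + 1)) := mul_le_mul_of_nonneg_left e8 hv
    have e10 : v * (1 + σ) * (g + 1) ≤ (τ * (2 * g + 1) + 2 * (κ * i)) * (g + 1) := by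
      have := mul_le_mul_of_nonneg_right e6 (by positivity : (0:ℝ) ≤ 2 * g + 1)
      have : 0 ≤ κ * i := by positivity
      nlinarith
    have e11 : v * (1 + σ) ≤ τ * (2 * g + 1) + 2 * (κ * i) := le_of_mul_le_mul_right e10 (by positivity)
    have e12 : 2 * (κ * i) ≤ (4 * d + 6) * κ * (i * g) := by
      have : 0 ≤ κ * i := by positivity
      have : (1:ℝ) ≤ (4 * d + 6) * g := by nlinarith [(Nat.cast_nonneg d : (0:ℝ) ≤ d)]
      have h2 : (2:ℝ) ≤ (4 * d + 6) * g := by nlinarith [(Nat.cast_nonneg d : (0:ℝ) ≤ d)]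
      nlinarith
    linarith

set_option maxHeartbeats 1000000 in
lemma desc_step {d : ℕ} {H x σ κ : ℝ} (h1 : 1 < H) (hσ : 1 / 2 < σ) (hσ1 : σ < 1) (hκ : 0 < κ)
    (h2 : 2 ≤ H ^ κ)
    (hgen : ∀ (R : ℤ[X]) (τ β : ℝ), R ≠ 0 → R.natDegree < d →
      ht R ≤ H ^ τ → |tc R x 0| ≤ H ^ (τ - β) → β * σ ≤ τ * (R.natDegree + 1) + κ)
    (hne : ∀ R : ℤ[X], R ≠ 0 → tc R x 0 ≠ 0)
    (htc : ∀ (P : ℤ[X]) (τ : ℝ), P.natDegree ≤ d → ht P ≤ H ^ τ → ∀ j, |tc P x j| ≤ H ^ (τ + κ))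
    (hcl : ∀ (P Q : ℤ[X]) (a b e : ℝ) (k1 k2 : ℕ), P.natDegree ≤ d → Q.natDegree ≤ d →
      P ≠ 0 → IsRelPrime P Q → 0 ≤ e → k1 ≤ P.natDegree → k2 ≤ Q.natDegree →
      (∀ j : ℕ, |tc P x j| ≤ H ^ (a - e * ((k1 - j : ℕ) : ℝ))) →
      (∀ j : ℕ, |tc Q x j| ≤ H ^ (b - e * ((k2 - j : ℕ) : ℝ))) →
      e * (k1 * k2) ≤ a * Q.natDegree + b * P.natDegree + κ)
    {R1 R2 : ℤ[X]} (hR1 : R1 ≠ 0) (hR2 : R2 ≠ 0) (hd1 : 1 ≤ R1.natDegree) (hd2 : 1 ≤ R2.natDegree)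
    (hd : (R1 * R2).natDegree < d) (hrel : IsRelPrime R1 R2)
    (hord : |tc R1 x 0| * ht R2 ≤ |tc R2 x 0| * ht R1)
    (ih : Desc H x σ ((4 * d + 6) * κ) R1) : Desc H x σ ((4 * d + 6) * κ) (R1 * R2) := by
  intro τ v hv hZ
  have h0 : 0 < H := by linarith
  have hdeg : (R1 * R2).natDegree = R1.natDegree + R2.natDegree := natDegree_mul hR1 hR2
  obtain ⟨t1, ht1⟩ := exp_rep h1 (lt_of_lt_of_le one_pos (one_le_ht hR1))
  obtain ⟨t2, ht2⟩ := exp_rep h1 (lt_of_lt_of_le one_pos (one_le_ht hR2))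
  obtain ⟨b1, hb1⟩ := exp_rep h1 (abs_pos.2 (hne R1 hR1))
  obtain ⟨b2, hb2⟩ := exp_rep h1 (abs_pos.2 (hne R2 hR2))
  have ht10 : 0 ≤ t1 := nonneg_of_one_le h1 (by rw [← ht1]; exact one_le_ht hR1)
  have ht20 : 0 ≤ t2 := nonneg_of_one_le h1 (by rw [← ht2]; exact one_le_ht hR2)
  rw [hb1, hb2, ht1, ht2, ← Real.rpow_add h0, ← Real.rpow_add h0, Real.rpow_le_rpow_left_iff h1] at hord
  have e1 : t1 + t2 ≤ τ := by
    have := hZ.1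
    rw [ht_mul, ht1, ht2, ← Real.rpow_add h0, Real.rpow_le_rpow_left_iff h1] at this
    exact this
  have e2 : b1 + b2 ≤ τ - 2 * v := by
    have := hZ.2.1
    rw [tc_mul_zero, abs_mul, hb1, hb2, ← Real.rpow_add h0, Real.rpow_le_rpow_left_iff h1] at this
    exact this
  set r1 := R1.natDegree with hr1
  set r2 := R2.natDegree with hr2
  have hr1' : (1:ℝ) ≤ r1 := by exact_mod_cast hd1
  have hr2' : (1:ℝ) ≤ r2 := by exact_mod_cast hd2
  have hrd : (r1:ℝ) + r2 + 1 ≤ d := by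
    rw [hdeg] at hd
    exact_mod_cast hd
  set β := max (t2 - b2) 0 with hβ
  have hβ0 : 0 ≤ β := le_max_right _ _
  have hβ2 : t2 - b2 ≤ β := le_max_left _ _
  have hmono : ∀ {a b : ℝ}, a ≤ b → H ^ a ≤ H ^ b := fun h => Real.rpow_le_rpow_of_exponent_le h1.le h
  -- resultant
  have hres : β ≤ (t1 + κ) * r2 + (t2 + κ) * r1 + κ := by
    have := hcl R1 R2 (t1 + κ) (t2 + κ) β 1 1 (by omega) (by omega) hR1 hrel hβ0 hd1 hd2
      (by
        intro j
        cases j with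
        | zero =>
          rcases le_total (t2 - b2) 0 with h | h
          · have hb0 : β = 0 := max_eq_right h
            rw [hb0]
            simpa using htc R1 t1 (by omega) ht1.le 0
          · have hb0 : β = t2 - b2 := max_eq_left h
            rw [hb1]
            apply hmono
            push_cast
            rw [hb0]; simp; linarith
        | succ j =>
          have := htc R1 t1 (by omega) ht1.le (j + 1)
          simpa using this)
      (by
        intro j
        cases j with
        | zero =>
          rcases le_total (t2 - b2) 0 with h | h
          · have hb0 : β = 0 := max_eq_right h
            rw [hb0]
            simpa using htc R2 t2 (by omega) ht2.le 0
          · have hb0 : β = t2 - b2 := max_eq_left h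
            rw [hb2]
            apply hmono
            push_cast
            rw [hb0]; simp; linarith
        | succ j =>
          have := htc R2 t2 (by omega) ht2.le (j + 1)
          simpa using this)
    simpa using this
  have hg2 : β * σ ≤ t2 * (r2 + 1) + κ := by
    rcases le_total (t2 - b2) 0 with h | h
    · have hb0 : β = 0 := max_eq_right h
      rw [hb0]; simp; positivity
    · have hb0 : β = t2 - b2 := max_eq_left h
      exact hgen R2 t2 β hR2 (by omega) ht2.le (by rw [hb2, hb0]; apply hmono; linarith)
  set τ1 := τ - t2 with hτ1
  have hτ1t : t1 ≤ τ1 := by linarith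
  have hm1 : t1 * r2 ≤ τ1 * r2 := mul_le_mul_of_nonneg_right hτ1t (by linarith)
  have hm2 : t1 * (r1 + 1) ≤ τ1 * (r1 + 1) := mul_le_mul_of_nonneg_right hτ1t (by linarith)
  have hk1 : κ * r1 + κ * r2 + κ ≤ κ * d := by nlinarith
  have hd0 : (0:ℝ) ≤ d := by positivity
  have hkd : 0 ≤ κ * d := by positivity
  have hEr : (4 * d + 6) * κ ≤ (4 * d + 6) * κ * r2 := by
    have : 0 ≤ (4 * d + 6) * κ := by positivity
    nlinarith
  have hEr1 : 0 ≤ (4 * d + 6) * κ * r1 := by positivity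
  rw [hdeg]
  push_cast
  rcases le_or_gt β v with hβv | hβv
  · -- β ≤ v
    have hZ1 : Z H x (τ1 + 2 * κ) (v - β) R1 := by
      refine ⟨?_, ?_, ?_⟩
      · rw [ht1]; apply hmono; linarith
      · rw [hb1]; apply hmono; linarith
      · have hR2pos : 0 < |tc R2 x 0| := abs_pos.2 (hne R2 hR2)
        have hA : |tc R1 x 1| * |tc R2 x 0| ≤ |tc (R1 * R2) x 1| + |tc R1 x 0| * |tc R2 x 1| := by
          rw [tc_mul_one, ← abs_mul, ← abs_mul]
          have := abs_add_le (tc R1 x 1 * tc R2 x 0 + tc R1 x 0 * tc R2 x 1) (-(tc R1 x 0 * tc R2 x 1))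
          rw [abs_neg] at this
          simpa using this
        have hB : |tc R1 x 0| * |tc R2 x 1| ≤ H ^ (τ - v + κ) := by
          calc _ ≤ H ^ b1 * H ^ (t2 + κ) := by
                rw [hb1]
                exact mul_le_mul_of_nonneg_left (htc R2 t2 (by omega) ht2.le 1) (by positivity)
            _ = H ^ (b1 + (t2 + κ)) := by rw [Real.rpow_add h0 b1 (t2 + κ)]
            _ ≤ _ := by apply hmono; linarith
        have hC : |tc (R1 * R2) x 1| ≤ H ^ (τ - v + κ) := hZ.2.2.trans (hmono (by linarith))
        have hD : |tc R1 x 1| * |tc R2 x 0| ≤ H ^ (τ - v + 2 * κ) := by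
          calc _ ≤ 2 * H ^ (τ - v + κ) := by linarith
            _ ≤ H ^ κ * H ^ (τ - v + κ) := mul_le_mul_of_nonneg_right h2 (by positivity)
            _ = _ := by rw [← Real.rpow_add h0]; congr 1; ring
        have hE : |tc R1 x 1| * |tc R2 x 0| ≤ H ^ (τ1 + 2 * κ - (v - β)) * |tc R2 x 0| := by
          refine hD.trans ?_
          rw [hb2, ← Real.rpow_add h0]
          apply hmono; linarith
        exact le_of_mul_le_mul_right hE hR2pos
    have hsum : β * (1 + σ) ≤ τ1 * r2 + t2 * (r1 + r2 + 1) + (κ * r1 + κ * r2 + 2 * κ) := by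
      linarith
    rcases ih (τ1 + 2 * κ) (v - β) (by linarith) hZ1 with h | ⟨G, γ, V, hG, hG1, hG2, hV0, hV, hZG, hin⟩
    · left
      have : τ = τ1 + t2 := by rw [hτ1]; ring
      rw [this]
      linarith [mul_nonneg hκ.le (by linarith : (0:ℝ) ≤ r1), mul_nonneg hκ.le (by linarith : (0:ℝ) ≤ r2)]
    · right
      refine ⟨G, γ, V, hG, hG1, by omega, hV0, by linarith, hZG, ?_⟩
      have : τ = τ1 + t2 := by rw [hτ1]; ring
      rw [this]
      linarith [mul_nonneg hκ.le (by linarith : (0:ℝ) ≤ r1), mul_nonneg hκ.le (by linarith : (0:ℝ) ≤ r2)]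
  · left
    have hb0 : β = t2 - b2 := by
      rcases le_total (t2 - b2) 0 with h | h
      · have hb0 : β = 0 := max_eq_right h
        linarith
      · exact max_eq_left h
    have hg1 : β * σ ≤ t1 * (r1 + 1) + κ := by
      exact hgen R1 t1 β hR1 (by omega) ht1.le (by rw [hb1, hb0]; apply hmono; linarith)
    have hvs : v * σ ≤ β * σ := mul_le_mul_of_nonneg_right hβv.le (by linarith)
    have hvs2 : v * 1 ≤ v * (2 * σ) := mul_le_mul_of_nonneg_left (by linarith) hv
    have : τ = τ1 + t2 := by rw [hτ1]; ring
    rw [this]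
    linarith [mul_nonneg hκ.le (by linarith : (0:ℝ) ≤ r1), mul_nonneg hκ.le (by linarith : (0:ℝ) ≤ r2), mul_nonneg ht20 (by linarith : (0:ℝ) ≤ r2 + 1)]

set_option maxHeartbeats 1000000 in
lemma desc_all {d : ℕ} {H x σ κ : ℝ} (h1 : 1 < H) (hσ : 1 / 2 < σ) (hσ1 : σ < 1) (hκ : 0 < κ)
    (h2 : 2 ≤ H ^ κ)
    (hgen : ∀ (R : ℤ[X]) (τ β : ℝ), R ≠ 0 → R.natDegree < d →
      ht R ≤ H ^ τ → |tc R x 0| ≤ H ^ (τ - β) → β * σ ≤ τ * (R.natDegree + 1) + κ)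
    (hne : ∀ R : ℤ[X], R ≠ 0 → tc R x 0 ≠ 0)
    (htc : ∀ (P : ℤ[X]) (τ : ℝ), P.natDegree ≤ d → ht P ≤ H ^ τ → ∀ j, |tc P x j| ≤ H ^ (τ + κ))
    (hcl : ∀ (P Q : ℤ[X]) (a b e : ℝ) (k1 k2 : ℕ), P.natDegree ≤ d → Q.natDegree ≤ d →
      P ≠ 0 → IsRelPrime P Q → 0 ≤ e → k1 ≤ P.natDegree → k2 ≤ Q.natDegree →
      (∀ j : ℕ, |tc P x j| ≤ H ^ (a - e * ((k1 - j : ℕ) : ℝ))) →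
      (∀ j : ℕ, |tc Q x j| ≤ H ^ (b - e * ((k2 - j : ℕ) : ℝ))) →
      e * (k1 * k2) ≤ a * Q.natDegree + b * P.natDegree + κ) (R : ℤ[X]) :
    R ≠ 0 → R.natDegree < d → Desc H x σ ((4 * d + 6) * κ) R := by
  refine UniqueFactorizationMonoid.induction_on_coprime (P := fun R => R ≠ 0 → R.natDegree < d → Desc H x σ ((4 * d + 6) * κ) R) R ?_ ?_ ?_ ?_
  · intro h; exact absurd rfl h
  · intro R hu hR _
    apply desc_const h1 hσ1 hR
    exact natDegree_eq_zero_of_isUnit hu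
  · intro p i hp hR hd
    by_cases hpd : p.natDegree = 0
    · exact desc_const h1 hσ1 hR (by rw [natDegree_pow, hpd]; simp)
    · exact desc_pow h1 hσ hσ1 hκ hgen hne hp.irreducible (by omega) i hd
  · intro R1 R2 hrel ih1 ih2 hR hd
    have hR1 : R1 ≠ 0 := left_ne_zero_of_mul hR
    have hR2 : R2 ≠ 0 := right_ne_zero_of_mul hR
    have hdeg : (R1 * R2).natDegree = R1.natDegree + R2.natDegree := natDegree_mul hR1 hR2
    have i1 := ih1 hR1 (by omega)
    have i2 := ih2 hR2 (by omega)
    by_cases hd1 : R1.natDegree = 0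
    · have hc := eq_C_of_natDegree_eq_zero hd1
      have hc0 : R1.coeff 0 ≠ 0 := by
        intro h
        rw [h] at hc
        exact hR1 (by rw [hc]; simp)
      have := desc_C_mul hc0 i2
      rw [hc]
      exact this
    by_cases hd2 : R2.natDegree = 0
    · have hc := eq_C_of_natDegree_eq_zero hd2
      have hc0 : R2.coeff 0 ≠ 0 := by
        intro h
        rw [h] at hc
        exact hR2 (by rw [hc]; simp)
      have := desc_C_mul hc0 i1
      rw [mul_comm R1 R2, hc]
      exact this
    rcases le_total (|tc R1 x 0| * ht R2) (|tc R2 x 0| * ht R1) with h | h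
    · exact desc_step h1 hσ hσ1 hκ h2 hgen hne htc hcl hR1 hR2
          (by omega) (by omega) hd hrel h i1
    · have hd' : (R2 * R1).natDegree < d := by rw [mul_comm]; exact hd
      have := desc_step h1 hσ hσ1 hκ h2 hgen hne htc hcl hR2 hR1
          (by omega) (by omega) hd' hrel.symm h i2
      rw [mul_comm R1 R2]
      exact this

lemma ev_descent (d : ℕ) (σ c M ε : ℝ) (hσ : 1 / 2 < σ) (hσ1 : σ < 1) (hc : 0 < c) (hε : 0 < ε) :
    ∀ᶠ H : ℝ in atTop, ∀ (x : ℝ) (R : ℤ[X]) (τ v : ℝ), Gen d σ c M x → R ≠ 0 → R.natDegree < d →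
    0 ≤ v → Z H x τ v R →
    v * (1 + σ) ≤ τ * (R.natDegree + 1) + ε ∨
    ∃ (G : ℤ[X]) (γ V : ℝ), Irreducible G ∧ 1 ≤ G.natDegree ∧ G.natDegree ≤ R.natDegree ∧ 0 ≤ V ∧ V ≤ v ∧
      Z H x γ V G ∧
      γ * (G.natDegree + 1) - V * σ + (v - V) ≤ τ * (R.natDegree + 1) - v * σ + ε := by
  set κ := ε / ((4 * d + 6) * (d + 1)) with hκdef
  have hκ : 0 < κ := by positivity
  have hκε : (4 * d + 6) * κ * (d + 1) = ε := by rw [hκdef]; field_simp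
  filter_upwards [ev_gen d σ c M κ (by linarith) hσ1 hc hκ, ev_cluster d κ hκ, ev_tc d M κ hκ, ev_const 2 κ hκ]
    with H hgen hcl htc ⟨h1, h2⟩ x R τ v hx hR hd hv hZ
  have main : Desc H x σ ((4 * d + 6) * κ) R :=
    desc_all h1 hσ hσ1 hκ h2 (fun R τ β => hgen x R τ β hx) hx.2.1
          (fun P τ hP => htc P x τ hP hx.1) (fun P Q a b e k1 k2 => hcl P Q x a b e k1 k2) R hR hd
  have hE : (4 * d + 6) * κ * R.natDegree ≤ ε := by
    rw [← hκε]
    apply mul_le_mul_of_nonneg_left _ (by positivity)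
    have : (R.natDegree : ℝ) ≤ d := by exact_mod_cast hd.le
    linarith
  rcases main τ v hv hZ with h | ⟨G, γ, V, hG, hG1, hG2, hV0, hV, hZG, hin⟩
  · left; linarith
  · right; exact ⟨G, γ, V, hG, hG1, hG2, hV0, hV, hZG, by linarith⟩

end Bern

namespace Bern
open Polynomial Filter

lemma card_fib {ι τ : Type*} [DecidableEq τ] (Y : Finset ι) (T : Finset τ) (f : ι → τ)
    (hf : ∀ x ∈ Y, f x ∈ T) (A : ℝ) (h : ∀ t ∈ T, ((Y.filter (fun x => f x = t)).card : ℝ) ≤ A) :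
    (Y.card : ℝ) ≤ T.card * A := by
  rw [Finset.card_eq_sum_card_fiberwise hf]
  push_cast
  calc _ ≤ ∑ t ∈ T, A := Finset.sum_le_sum h
    _ = _ := by simp

lemma cell_sel {ι : Type*} (T : Finset ι) (p : ι → ℤ) (A : ℝ)
    (h : ∀ m : ℤ, ((T.filter (fun x => p x = m)).card : ℝ) ≤ A) :
    ∃ T' ⊆ T, Set.InjOn p T' ∧ (T.card : ℝ) ≤ T'.card * A := by
  classical
  obtain ⟨u, hu, hu2, hu3⟩ := Finset.exists_subset_injOn_image_eq_of_surjOn (f := p) (T : Set ι) (T.image p)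
    (by intro y hy; simpa using hy)
  refine ⟨u, hu, hu2, ?_⟩
  have := card_fib T (T.image p) p (fun x hx => Finset.mem_image_of_mem _ hx) A (fun t _ => h t)
  rwa [← hu3, Finset.card_image_of_injOn hu2] at this

lemma card_Icc_floor (a b : ℝ) (hab : a ≤ b) : ((Finset.Icc ⌊a⌋ ⌊b⌋).card : ℝ) ≤ b - a + 2 := by
  rw [Int.card_Icc]
  have h1 : ⌊a⌋ ≤ ⌊b⌋ := Int.floor_le_floor hab
  have h2 : ((⌊b⌋ + 1 - ⌊a⌋).toNat : ℤ) = ⌊b⌋ + 1 - ⌊a⌋ := Int.toNat_of_nonneg (by omega)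
  have h3 : ((⌊b⌋ + 1 - ⌊a⌋).toNat : ℝ) = ⌊b⌋ + 1 - ⌊a⌋ := by exact_mod_cast h2
  rw [h3]
  have := Int.floor_le b
  have := Int.lt_floor_add_one a
  linarith

lemma count_cells {ι : Type*} (Y : Finset ι) (p : ι → ℝ) (a b L A : ℝ) (hab : a ≤ b) (hL : 0 ≤ L)
    (hA : 0 ≤ A) (hY : ∀ x ∈ Y, a ≤ p x ∧ p x ≤ b)
    (h : ∀ m : ℤ, ((Y.filter (fun x => ⌊p x * L⌋ = m)).card : ℝ) ≤ A) :
    (Y.card : ℝ) ≤ ((b - a) * L + 2) * A := by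
  refine (card_fib Y (Finset.Icc ⌊a * L⌋ ⌊b * L⌋) (fun x => ⌊p x * L⌋) ?_ A (fun t _ => h t)).trans ?_
  · intro x hx
    rw [Finset.mem_Icc]
    exact ⟨Int.floor_le_floor (mul_le_mul_of_nonneg_right (hY x hx).1 hL),
      Int.floor_le_floor (mul_le_mul_of_nonneg_right (hY x hx).2 hL)⟩
  · apply mul_le_mul_of_nonneg_right _ hA
    have := card_Icc_floor (a * L) (b * L) (mul_le_mul_of_nonneg_right hab hL)
    linarith

lemma fib_one {ι : Type*} {Y : Finset ι} {f : ι → ℤ} (h : Set.InjOn f Y) (m : ℤ) :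
    ((Y.filter (fun x => f x = m)).card : ℝ) ≤ 1 := by
  have : (Y.filter (fun x => f x = m)).card ≤ 1 := by
    rw [Finset.card_le_one]
    intro a ha b hb
    rw [Finset.mem_filter] at ha hb
    exact h ha.1 hb.1 (ha.2.trans hb.2.symm)
  exact_mod_cast this

/-- points in distinct cells inside an interval -/
lemma cell1 {Y : Finset ℝ} {L a b : ℝ} (hL : 0 ≤ L) (hab : a ≤ b) (hc : Set.InjOn (fun x : ℝ => ⌊x * L⌋) Y)
    (hY : ∀ x ∈ Y, a ≤ x ∧ x ≤ b) : (Y.card : ℝ) ≤ (b - a) * L + 2 := by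
  have := count_cells Y (fun x => x) a b L 1 hab hL zero_le_one hY (fib_one hc)
  simpa using this

lemma count_near_roots {G : ℤ[X]} {g : ℕ} (hg : G.natDegree ≤ g) {Y : Finset ℝ} {L δ : ℝ} (hL : 0 ≤ L)
    (hδ : 0 ≤ δ) (hc : Set.InjOn (fun x : ℝ => ⌊x * L⌋) Y)
    (hY : ∀ x ∈ Y, ∃ α ∈ (G.map (Int.castRingHom ℂ)).roots, |x - α.re| ≤ δ) :
    (Y.card : ℝ) ≤ g * (2 * δ * L + 2) := by
  classical
  choose! f hf1 hf2 using hY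
  have h1 := card_fib Y (G.map (Int.castRingHom ℂ)).roots.toFinset f
    (fun x hx => Multiset.mem_toFinset.2 (hf1 x hx)) (2 * δ * L + 2) (by
      intro t _
      have := cell1 (Y := Y.filter (fun x => f x = t)) (L := L) (a := t.re - δ) (b := t.re + δ) hL (by linarith)
        (hc.mono (by
          intro x hx
          exact (Finset.mem_filter.1 hx).1)) (by
          intro x hx
          obtain ⟨hx1, hx2⟩ := Finset.mem_filter.1 hx
          have := hf2 x hx1
          rw [hx2, abs_le] at this
          constructor <;> linarith)
      refine this.trans (le_of_eq ?_)
      ring)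
  refine h1.trans ?_
  apply mul_le_mul_of_nonneg_right _ (by positivity)
  have : (G.map (Int.castRingHom ℂ)).roots.toFinset.card ≤ g :=
    (Multiset.toFinset_card_le _).trans ((card_roots' _).trans ((natDegree_map_le).trans hg))
  exact_mod_cast this

lemma floor_eq_abs {x y L : ℝ} (hL : 0 < L) (h : ⌊x * L⌋ = ⌊y * L⌋) : |x - y| ≤ L⁻¹ := by
  have := Int.abs_sub_lt_one_of_floor_eq_floor h
  rw [← sub_mul, abs_mul, abs_of_pos hL] at this
  rw [← one_div, le_div_iff₀ hL]
  exact this.le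

/-- trivial count -/
lemma ev_triv (M ε : ℝ) (hM : 0 ≤ M) (hε : 0 < ε) : ∀ᶠ H : ℝ in atTop, ∀ (Y : Finset ℝ) (V : ℝ), 0 ≤ V → (∀ x ∈ Y, |x| ≤ M) →
    Set.InjOn (fun x : ℝ => ⌊x * H ^ V⌋) Y → (Y.card : ℝ) ≤ H ^ (V + ε) := by
  filter_upwards [ev_const (2 * M + 2) ε hε] with H ⟨h1, h2⟩ Y V hV hY hc
  have h0 : 0 < H := by linarith
  have := cell1 (a := -M) (b := M) (by positivity) (by linarith) hc (fun x hx => abs_le.1 (hY x hx))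
  refine this.trans ?_
  have h3 : 1 ≤ H ^ V := Real.one_le_rpow h1.le hV
  rw [Real.rpow_add h0]
  nlinarith

end Bern

namespace Bern
open Polynomial Filter

set_option maxHeartbeats 1000000 in
/-- two irreducible polynomials with the same shape at close points agree up to sign -/
lemma irr_pair {d g : ℕ} {H κ T D γ V ξ q x y : ℝ} {P Q : ℤ[X]} (h1 : 1 < H) (hκ : 0 < κ)
    (hg3 : 3 ≤ g) (hgd : g < d) (hγ : 0 ≤ γ) (hξV : ξ ≤ V) (hT : 4 * κ ≤ T) (hD : 0 ≤ D)
    (hDT : D * (2 * g - 1) ≤ 2 * T) (hDT2 : g * (D + 2 * κ) ≤ T)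
    (hV : γ * (g + 1) + 8 * T ≤ 2 * V)
    (hq : q = γ * g / 2 - (V - ξ) + T)
    (hxy : |x - y| ≤ H ^ (-q))
    (hsh : ∀ (P : ℤ[X]) (x y q τ : ℝ) (j : ℕ),
      P.natDegree ≤ d → |x - y| ≤ H ^ (-q) →
      (∀ i : ℕ, j ≤ i → |tc P x i| ≤ H ^ (τ + ((i : ℝ) - j) * q)) → |tc P y j| ≤ H ^ (τ + κ))
    (hcl : ∀ (P Q : ℤ[X]) (x a b e : ℝ) (k1 k2 : ℕ), P.natDegree ≤ d → Q.natDegree ≤ d →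
      P ≠ 0 → IsRelPrime P Q → 0 ≤ e → k1 ≤ P.natDegree → k2 ≤ Q.natDegree →
      (∀ j : ℕ, |tc P x j| ≤ H ^ (a - e * ((k1 - j : ℕ) : ℝ))) →
      (∀ j : ℕ, |tc Q x j| ≤ H ^ (b - e * ((k2 - j : ℕ) : ℝ))) →
      e * (k1 * k2) ≤ a * Q.natDegree + b * P.natDegree + κ)
    (h12 : 12 * (V - ξ) ≤ (γ + D) * (2 * g - 1) + κ)
    (hP : Irreducible P) (hQ : Irreducible Q) (hPg : P.natDegree = g) (hQg : Q.natDegree = g)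
    (hP1 : ∀ j : ℕ, |tc P x j| ≤ H ^ (γ + D - 2 * V + j * ξ))
    (hQ1 : ∀ j : ℕ, |tc Q y j| ≤ H ^ (γ + D - 2 * V + j * ξ))
    (hP2 : ∀ j : ℕ, |tc P x j| ≤ H ^ (γ + D))
    (hQ2 : ∀ j : ℕ, |tc Q y j| ≤ H ^ (γ + D)) 
    (hP3 : ∀ j : ℕ, |tc P y j| ≤ H ^ (γ + D)) : Q = P ∨ Q = -P := by
  apply irr_rel hP hQ
  intro hrel
  have hmono : ∀ {a b : ℝ}, a ≤ b → H ^ a ≤ H ^ b := fun h => Real.rpow_le_rpow_of_exponent_le h1.le h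
  have hg' : (3:ℝ) ≤ g := by exact_mod_cast hg3
  have hγg : 0 ≤ γ * g := by positivity
  have hq2 : q ≥ γ * g / 3 + T / 2 := by
    rw [hq]
    linarith
  have hq0 : 0 ≤ q := by linarith
  set e := γ * g / 2 + T with he
  have he0 : 0 ≤ e := by linarith
  have hVe : e ≤ V := by linarith
  have res := hcl P Q y (γ + D + κ) (γ + D + κ) e 2 2 (by omega) (by omega) hP.ne_zero hrel he0 (by omega) (by omega)
    (by
      intro j
      rcases Nat.lt_or_ge j 2 with hj | hj
      · interval_cases j
        · have := hsh P x y q (γ + D - 2 * e) 0 (by omega) hxy (by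
            intro i _
            rcases Nat.lt_or_ge i 3 with hi | hi
            · refine (hP1 i).trans (hmono ?_)
              interval_cases i <;> simp <;> linarith
            · refine (hP2 i).trans (hmono ?_)
              have hi' : (3:ℝ) ≤ i := by exact_mod_cast hi
              have : 3 * q ≤ i * q := mul_le_mul_of_nonneg_right hi' hq0
              push_cast
              linarith)
          refine this.trans (hmono ?_)
          norm_num
          linarith
        · have := hsh P x y q (γ + D - e) 1 (by omega) hxy (by
            intro i hi1
            rcases Nat.lt_or_ge i 3 with hi | hi
            · refine (hP1 i).trans (hmono ?_)
              interval_cases i <;> norm_num <;> linarith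
            · refine (hP2 i).trans (hmono ?_)
              have hi' : (3:ℝ) ≤ i := by exact_mod_cast hi
              have : 3 * q ≤ i * q := mul_le_mul_of_nonneg_right hi' hq0
              push_cast
              linarith)
          refine this.trans (hmono ?_)
          norm_num
          linarith
      · rw [Nat.sub_eq_zero_of_le hj]
        refine (hP3 j).trans (hmono ?_)
        simp; linarith)
    (by
      intro j
      rcases Nat.lt_or_ge j 2 with hj | hj
      · refine (hQ1 j).trans (hmono ?_)
        interval_cases j <;> norm_num <;> linarith
      · rw [Nat.sub_eq_zero_of_le hj]
        refine (hQ2 j).trans (hmono ?_)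
        simp; linarith)
  rw [hPg, hQg] at res
  norm_num at res
  nlinarith

set_option maxHeartbeats 1000000 in
lemma ev_irr_class (d : ℕ) (M κ : ℝ) (hM : 0 ≤ M) (hκ : 0 < κ) :
    ∀ᶠ H : ℝ in atTop, ∀ (Y : Finset ℝ) (γ V ξ : ℝ) (g : ℕ), 3 ≤ g → g < d → 0 ≤ γ → 0 ≤ ξ → ξ ≤ V →
    γ * (g + 1) + 8 * ((d + 2) ^ 2 * κ) ≤ 2 * V → (∀ x ∈ Y, |x| ≤ M) →
    Set.InjOn (fun x : ℝ => ⌊x * H ^ V⌋) Y →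
    (∀ x ∈ Y, ∃ G : ℤ[X], Irreducible G ∧ G.natDegree = g ∧ ht G ≤ H ^ γ ∧
      (∀ j : ℕ, |tc G x j| ≤ H ^ (γ + (d + 1) * κ - 2 * V + j * ξ)) ∧
      ∃ α ∈ (G.map (Int.castRingHom ℂ)).roots, |x - α.re| ≤ H ^ (-ξ)) →
    (Y.card : ℝ) ≤ H ^ (γ * g / 2 + ((d + 2) ^ 2 + 2) * κ) := by
  filter_upwards [ev_cluster d κ hκ, ev_cluster_deriv d κ hκ, ev_tc d M κ hκ, ev_shift d κ hκ,
    ev_const (2 * M + 2) κ hκ, ev_const (4 * d) κ hκ]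
    with H hcl hcld htc hsh ⟨h1, h2⟩ ⟨_, h3⟩ Y γ V ξ g hg3 hgd hγ hξ hξV hV hY hc hG
  have h0 : 0 < H := by linarith
  have hmono : ∀ {a b : ℝ}, a ≤ b → H ^ a ≤ H ^ b := fun h => Real.rpow_le_rpow_of_exponent_le h1.le h
  have hg' : (3:ℝ) ≤ g := by exact_mod_cast hg3
  have hgd' : (g:ℝ) + 1 ≤ d := by exact_mod_cast hgd
  have hT4 : 4 * κ ≤ ((d:ℝ) + 2) ^ 2 * κ := by
    apply mul_le_mul_of_nonneg_right _ hκ.le; nlinarith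
  have hDT : ((d:ℝ) + 1) * κ * (2 * g - 1) ≤ 2 * (((d:ℝ) + 2) ^ 2 * κ) := by
    have : ((d:ℝ) + 1) * (2 * g - 1) ≤ 2 * (((d:ℝ) + 2) ^ 2) := by nlinarith
    nlinarith
  have hDT2 : g * (((d:ℝ) + 1) * κ + 2 * κ) ≤ ((d:ℝ) + 2) ^ 2 * κ := by
    have : g * (((d:ℝ) + 1) + 2) ≤ ((d:ℝ) + 2) ^ 2 := by nlinarith
    nlinarith
  have hD0 : κ ≤ ((d:ℝ) + 1) * κ := by nlinarith
  have hd2 : ((d:ℝ) + 2) ^ 2 * κ + 2 * κ = ((d + 2) ^ 2 + 2) * κ := by ring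
  rw [← hd2]
  generalize ((d:ℝ) + 2) ^ 2 * κ = T at *
  generalize ((d:ℝ) + 1) * κ = D at *
  rcases Y.eq_empty_or_nonempty with rfl | ⟨x0, hx0⟩
  · simp; positivity
  have hγg : 0 ≤ γ * g := by positivity
  have h12 : 12 * (V - ξ) ≤ (γ + D) * (2 * g - 1) + κ := by
    obtain ⟨G, hGi, hGg, hGh, hGs, -⟩ := hG x0 hx0
    have hGt := htc G x0 γ (by omega) (hY x0 hx0) hGh
    set u := min (2 * V / 3) (2 * V - 2 * ξ) with hu
    have hu1 : u ≤ 2 * V / 3 := min_le_left _ _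
    have hu2 : u ≤ 2 * V - 2 * ξ := min_le_right _ _
    have hu0 : 0 ≤ u := le_min (by linarith) (by linarith)
    have := hcld G x0 (γ + D) u 2 (by omega) hGi hu0 (by omega) (by
      intro j
      rcases Nat.lt_or_ge j 3 with hj | hj
      · refine (hGs j).trans (hmono ?_)
        interval_cases j <;> norm_num <;> linarith
      · rw [Nat.sub_eq_zero_of_le hj]
        refine (hGt j).trans (hmono ?_)
        simp; linarith)
    rw [hGg] at this
    norm_num at this
    rcases min_choice (2 * V / 3) (2 * V - 2 * ξ) with h | h
    · rw [← hu] at h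
      exfalso
      rw [h] at this
      nlinarith
    · rw [← hu] at h
      rw [h] at this
      linarith
  obtain ⟨q, hq⟩ : ∃ q, q = γ * g / 2 - (V - ξ) + T := ⟨_, rfl⟩
  have hq0 : 0 ≤ q := by linarith
  choose! G hGi hGg hGh hGs α hα hαx using hG
  have key := count_cells Y (fun x => x) (-M) M (H ^ q) (g * (2 * H ^ (-ξ) * H ^ V + 2)) (by linarith) (by positivity)
    (by positivity) (fun x hx => abs_le.1 (hY x hx)) (by
      intro m
      rcases (Y.filter (fun x => ⌊x * H ^ q⌋ = m)).eq_empty_or_nonempty with he | ⟨x1, hx1⟩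
      · rw [he]; simp; positivity
      obtain ⟨hx1Y, hx1m⟩ := Finset.mem_filter.1 hx1
      apply count_near_roots (G := G x1) (hGg x1 hx1Y).le (by positivity) (by positivity)
      · exact hc.mono (fun x hx => (Finset.mem_filter.1 hx).1)
      · intro x hx
        obtain ⟨hxY, hxm⟩ := Finset.mem_filter.1 hx
        have hdist : |x1 - x| ≤ H ^ (-q) := by
          rw [Real.rpow_neg h0.le]
          exact floor_eq_abs (by positivity) (hx1m.trans hxm.symm)
        have htw : ∀ z ∈ Y, ∀ w ∈ Y, ∀ j, |tc (G z) w j| ≤ H ^ (γ + D) := fun z hz w hw j =>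
          (htc (G z) w γ (by rw [hGg z hz]; omega) (hY w hw) (hGh z hz) j).trans (hmono (by linarith))
        have := irr_pair h1 hκ hg3 hgd hγ hξV hT4 (by linarith) hDT hDT2 hV hq hdist hsh hcl h12
          (hGi x1 hx1Y) (hGi x hxY) (hGg x1 hx1Y) (hGg x hxY) (hGs x1 hx1Y) (hGs x hxY)
          (htw x1 hx1Y x1 hx1Y) (htw x hxY x hxY) (htw x1 hx1Y x hxY)
        refine ⟨α x, ?_, hαx x hxY⟩
        have hh := hα x hxY
        rcases this with h | h
        · rwa [h] at hh
        · rw [h, Polynomial.map_neg, roots_neg] at hh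
          exact hh)
  refine key.trans ?_
  have hA : (M - -M) * H ^ q + 2 ≤ H ^ (q + κ) := by
    have : 1 ≤ H ^ q := Real.one_le_rpow h1.le hq0
    rw [Real.rpow_add h0]
    nlinarith
  have hB : g * (2 * H ^ (-ξ) * H ^ V + 2) ≤ H ^ (V - ξ + κ) := by
    have e1 : H ^ (-ξ) * H ^ V = H ^ (V - ξ) := by rw [← Real.rpow_add h0]; congr 1; ring
    have : 1 ≤ H ^ (V - ξ) := Real.one_le_rpow h1.le (by linarith)
    rw [Real.rpow_add h0, mul_assoc 2, e1]
    nlinarith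
  calc _ ≤ H ^ (q + κ) * H ^ (V - ξ + κ) := mul_le_mul hA hB (by positivity) (by positivity)
    _ = _ := by rw [← Real.rpow_add h0]; congr 1; rw [hq]; ring

end Bern

namespace Bern
open Polynomial Filter

lemma ev_shape (d : ℕ) (κ : ℝ) (hκ : 0 < κ) : ∀ᶠ H : ℝ in atTop, ∀ (P : ℤ[X]) (x a : ℝ),
    P.natDegree ≤ d → 1 ≤ P.natDegree → tc P x 0 ≠ 0 → |tc P x 0| ≤ H ^ a →
    ∃ ρ : ℝ, (∃ α ∈ (P.map (Int.castRingHom ℂ)).roots, |x - α.re| ≤ H ^ (-ρ)) ∧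
      ∀ j : ℕ, |tc P x j| ≤ H ^ (a + κ + j * ρ) := by
  filter_upwards [ev_const (2 ^ d) κ hκ] with H ⟨h1, h2⟩ P x a hd hd1 hne ha
  have h0 : 0 < H := by linarith
  obtain ⟨α, hα, r, hr, hxr, hj⟩ := root_lemma P x hd1 hne
  obtain ⟨ρ', hρ⟩ := exp_rep h1 hr
  refine ⟨-ρ', ⟨α, hα, by rw [neg_neg, ← hρ]; exact hxr⟩, ?_⟩
  intro j
  have h3 := hj j
  have h4 : |tc P x j| * r ^ j ≤ H ^ κ * H ^ a := by
    refine h3.trans (mul_le_mul ?_ ha (abs_nonneg _) (by positivity))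
    refine le_trans ?_ h2
    exact pow_le_pow_right₀ (by norm_num) hd
  have h5 : H ^ (a + κ + j * -ρ') = H ^ κ * H ^ a * (r ^ j)⁻¹ := by
    rw [hρ, ← Real.rpow_mul_natCast h0.le, ← Real.rpow_neg h0.le, ← Real.rpow_add h0, ← Real.rpow_add h0]
    congr 1; ring
  rw [h5]
  exact (le_mul_inv_iff₀ (by positivity)).2 h4

lemma grid {κ B m : ℝ} (hκ : 0 < κ) (hm : 0 ≤ m) (hmB : m ≤ B) :
    ∃ i : ℕ, i < ⌊B / κ⌋₊ + 1 ∧ i * κ ≤ m ∧ m ≤ (i + 1) * κ := by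
  refine ⟨⌊m / κ⌋₊, ?_, ?_, ?_⟩
  · exact Nat.lt_succ_of_le (Nat.floor_le_floor (div_le_div_of_nonneg_right hmB hκ.le))
  · exact (le_div_iff₀ hκ).1 (Nat.floor_le (by positivity))
  · exact ((div_lt_iff₀ hκ).1 (Nat.lt_floor_add_one (m / κ))).le

/-- The shape of a polynomial with small value at `x`, capped at `U`. -/
lemma cap_shape {H x A U D : ℝ} {P : ℤ[X]} {ρ κ : ℝ} (h1 : 1 < H) (hκ : 0 < κ) (d i : ℕ) (hPd : P.natDegree ≤ d)
    (hρ : ∀ j : ℕ, |tc P x j| ≤ H ^ (A + j * ρ))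
    (hU : ∀ j : ℕ, |tc P x j| ≤ H ^ (A + j * U))
    (hi1 : min ρ U ≤ (i + 1) * κ) (hD : A + d * κ ≤ D) :
    ∀ j : ℕ, |tc P x j| ≤ H ^ (D + j * (i * κ)) := by
  intro j
  by_cases hj : j ≤ d
  · have hm : |tc P x j| ≤ H ^ (A + j * min ρ U) := by
      rcases min_choice ρ U with h | h <;> rw [h]
      · exact hρ j
      · exact hU j
    refine hm.trans (Real.rpow_le_rpow_of_exponent_le h1.le ?_)
    have h3 : (j:ℝ) * min ρ U ≤ j * ((i + 1) * κ) := mul_le_mul_of_nonneg_left hi1 (by positivity)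
    have h4 : (j:ℝ) * κ ≤ d * κ := mul_le_mul_of_nonneg_right (by exact_mod_cast hj) hκ.le
    linarith
  · rw [tc_eq_zero _ _ _ (by omega)]
    simp
    have : 0 < H := by linarith
    positivity

set_option maxHeartbeats 1000000 in
lemma ev_irr (d : ℕ) (σ c M B ε : ℝ) (hσ : 1 / 2 < σ) (hσ1 : σ < 1) (hc : 0 < c) (hM : 0 ≤ M) (hε : 0 < ε) :
    ∀ᶠ H : ℝ in atTop, ∀ (Y : Finset ℝ) (γ V : ℝ) (g : ℕ), 1 ≤ g → g < d → 0 ≤ V → V ≤ B →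
    (∀ x ∈ Y, Gen d σ c M x) → Set.InjOn (fun x : ℝ => ⌊x * H ^ V⌋) Y →
    (∀ x ∈ Y, ∃ G : ℤ[X], Irreducible G ∧ G.natDegree = g ∧ Z H x γ V G) →
    (Y.card : ℝ) ≤ H ^ (γ * (g + 1) - V * σ + ε) := by
  set κ := ε / (20 * ((d:ℝ) + 2) ^ 2) with hκd
  have hκ : 0 < κ := by positivity
  have hκε : 20 * (((d:ℝ) + 2) ^ 2 * κ) = ε := by rw [hκd]; field_simp
  filter_upwards [ev_cluster_deriv d κ hκ, ev_tc d M κ hκ, ev_triv M κ hM hκ, ev_gen d σ c M κ (by linarith) hσ1 hc hκ,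
    ev_ht d M κ hκ, ev_shape d κ hκ, ev_irr_class d M κ hM hκ, ev_const ((⌊B / κ⌋₊ + 1 : ℕ) : ℝ) κ hκ]
    with H hcld htc htriv hgen hht hshape hclass ⟨h1, h2⟩ Y γ V g hg1 hgd hV0 hVB hY hcell hG
  have h0 : 0 < H := by linarith
  have hmono : ∀ {a b : ℝ}, a ≤ b → H ^ a ≤ H ^ b := fun h => Real.rpow_le_rpow_of_exponent_le h1.le h
  rcases Y.eq_empty_or_nonempty with rfl | ⟨x0, hx0⟩
  · simp; positivity
  have hT4 : 4 * κ ≤ ((d:ℝ) + 2) ^ 2 * κ := by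
    apply mul_le_mul_of_nonneg_right _ hκ.le; nlinarith [(Nat.cast_nonneg d : (0:ℝ) ≤ d)]
  have hYM : ∀ x ∈ Y, |x| ≤ M := fun x hx => (hY x hx).1
  by_cases htr : V * (1 + σ) ≤ γ * (g + 1) + ε - κ
  · exact (htriv Y V hV0 hYM hcell).trans (hmono (by linarith))
  push Not at htr
  have hg' : (1:ℝ) ≤ g := by exact_mod_cast hg1
  have hγ : 0 ≤ γ := by
    obtain ⟨G, hGi, hGg, hZ⟩ := hG x0 hx0
    exact nonneg_of_one_le h1 ((one_le_ht hGi.ne_zero).trans hZ.1)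
  have hγg : 0 ≤ γ * g := by positivity
  have hgenV : 2 * V * σ ≤ γ * (g + 1) + κ := by
    obtain ⟨G, hGi, hGg, hZ⟩ := hG x0 hx0
    have := hgen x0 G γ (2 * V) (hY x0 hx0) hGi.ne_zero (by omega) hZ.1 hZ.2.1
    rwa [hGg] at this
  have hVs : V * (1 + σ) ≤ V * 2 := mul_le_mul_of_nonneg_left (by linarith) hV0
  rcases Nat.lt_or_ge g 3 with hg3 | hg3
  · exfalso
    obtain ⟨G, hGi, hGg, hZ⟩ := hG x0 hx0
    have hg12 : g = 1 ∨ g = 2 := by omega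
    rcases hg12 with rfl | rfl
    · have h3 := hZ.2.2
      rw [tc_natDegree G x0 1 hGg.le] at h3
      have h4 : G.coeff 1 ≠ 0 := by
        have := leadingCoeff_ne_zero.2 hGi.ne_zero
        rwa [leadingCoeff, hGg] at this
      have h5 : (1:ℝ) ≤ |(G.coeff 1 : ℝ)| := by exact_mod_cast Int.one_le_abs h4
      have := nonneg_of_one_le h1 (h5.trans h3)
      norm_num at htr
      linarith
    · have := hcld G x0 (γ + κ) V 1 (by omega) hGi hV0 (by omega) (by
        intro j
        rcases Nat.lt_or_ge j 2 with hj | hj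
        · interval_cases j
          · refine hZ.2.1.trans (hmono ?_)
            norm_num; linarith
          · refine hZ.2.2.trans (hmono ?_)
            norm_num; linarith
        · have := htc G x0 γ (by omega) (hYM x0 hx0) hZ.1 j
          refine this.trans (hmono ?_)
          rw [Nat.sub_eq_zero_of_le (by omega)]
          simp)
      rw [hGg] at this
      norm_num at this htr
      linarith
  -- main case
  have hdκ : ((d:ℝ) + 1) * κ = κ + d * κ := by ring
  have hcls : ∀ x ∈ Y, ∃ i : ℕ, i < ⌊B / κ⌋₊ + 1 ∧ i * κ ≤ V ∧ ∃ G : ℤ[X], Irreducible G ∧ G.natDegree = g ∧ ht G ≤ H ^ γ ∧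
      (∀ j : ℕ, |tc G x j| ≤ H ^ (γ + (d + 1) * κ - 2 * V + j * (i * κ))) ∧
      ∃ α ∈ (G.map (Int.castRingHom ℂ)).roots, |x - α.re| ≤ H ^ (-(i * κ)) := by
    intro x hx
    obtain ⟨G, hGi, hGg, hZ⟩ := hG x hx
    obtain ⟨ρ, ⟨α, hα, hαx⟩, hρ⟩ := hshape G x (γ - 2 * V) (by omega) (by omega) ((hY x hx).2.1 G hGi.ne_zero) hZ.2.1
    have hGU : ∀ j : ℕ, |tc G x j| ≤ H ^ (γ - 2 * V + κ + j * V) := by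
      intro j
      rcases Nat.lt_or_ge j 2 with hj | hj
      · interval_cases j
        · refine hZ.2.1.trans (hmono ?_)
          norm_num; linarith
        · refine hZ.2.2.trans (hmono ?_)
          norm_num; linarith
      · have := htc G x γ (by omega) (hYM x hx) hZ.1 j
        refine this.trans (hmono ?_)
        have : (2:ℝ) * V ≤ j * V := mul_le_mul_of_nonneg_right (by exact_mod_cast hj) hV0
        linarith
    have hm0 : 0 ≤ min ρ V := by
      by_contra hneg
      push Not at hneg
      have hρn : ρ ≤ 0 := by
        rcases min_lt_iff.1 hneg with h | h
        · exact h.le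
        · linarith
      have := hht G x (γ - 2 * V + κ) (by omega) (hYM x hx) (by
        intro j
        refine (hρ j).trans (hmono ?_)
        have : (j:ℝ) * ρ ≤ 0 := mul_nonpos_of_nonneg_of_nonpos (by positivity) hρn
        linarith)
      have := nonneg_of_one_le h1 ((one_le_ht hGi.ne_zero).trans this)
      linarith
    obtain ⟨i, hi1, hi2, hi3⟩ := grid hκ hm0 ((min_le_right ρ V).trans hVB)
    refine ⟨i, hi1, hi2.trans (min_le_right _ _), G, hGi, hGg, hZ.1, ?_, α, hα, hαx.trans (hmono ?_)⟩
    · intro j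
      have := cap_shape (D := γ - 2 * V + κ + d * κ) h1 hκ d i (by omega) hρ hGU hi3 le_rfl j
      refine this.trans (hmono ?_)
      linarith
    · have := hi2.trans (min_le_left _ _)
      linarith
  choose! I hI hIV hIG using hcls
  have := card_fib Y (Finset.range (⌊B / κ⌋₊ + 1)) I (fun x hx => Finset.mem_range.2 (hI x hx))
    (H ^ (γ * g / 2 + ((d + 2) ^ 2 + 2) * κ)) (by
      intro i _
      rcases (Y.filter (fun x => I x = i)).eq_empty_or_nonempty with he | ⟨x1, hx1⟩
      · rw [he]; simp; positivity
      obtain ⟨hx1Y, hx1i⟩ := Finset.mem_filter.1 hx1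
      apply hclass _ γ V (i * κ) g hg3 hgd hγ (by positivity) (by rw [← hx1i]; exact hIV x1 hx1Y) (by linarith)
      · intro x hx
        exact hYM x (Finset.mem_filter.1 hx).1
      · exact hcell.mono (fun x hx => (Finset.mem_filter.1 hx).1)
      · intro x hx
        obtain ⟨hxY, hxi⟩ := Finset.mem_filter.1 hx
        rw [← hxi]
        exact hIG x hxY)
  refine this.trans ?_
  rw [Finset.card_range]
  calc _ ≤ H ^ κ * H ^ (γ * g / 2 + ((d + 2) ^ 2 + 2) * κ) := mul_le_mul_of_nonneg_right h2 (by positivity)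
    _ = H ^ (κ + (γ * g / 2 + ((d + 2) ^ 2 + 2) * κ)) := by rw [Real.rpow_add h0 κ]
    _ ≤ _ := by
      apply hmono
      linarith

end Bern

namespace Bern
open Polynomial Filter

lemma Z_mono {H x τ v τ' v' : ℝ} {R : ℤ[X]} (h1 : 1 < H) (hτ : τ ≤ τ') (hv : v' ≤ v) (h : Z H x τ v R) :
    Z H x τ' v' R := by
  have hmono : ∀ {a b : ℝ}, a ≤ b → H ^ a ≤ H ^ b := fun h => Real.rpow_le_rpow_of_exponent_le h1.le h
  exact ⟨h.1.trans (hmono hτ), h.2.1.trans (hmono (by linarith)), h.2.2.trans (hmono (by linarith))⟩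

lemma scale_fib {Y : Finset ℝ} {L L' : ℝ} (hL : 0 < L) (hL' : 0 < L')
    (hc : Set.InjOn (fun x : ℝ => ⌊x * L⌋) Y) (m : ℤ) :
    ((Y.filter (fun x => ⌊x * L'⌋ = m)).card : ℝ) ≤ L / L' + 2 := by
  have := cell1 (Y := Y.filter (fun x => ⌊x * L'⌋ = m)) (L := L) (a := m / L') (b := (m + 1) / L') hL.le
    (by apply div_le_div_of_nonneg_right _ hL'.le; linarith)
    (hc.mono (fun x hx => (Finset.mem_filter.1 hx).1)) (by
      intro x hx
      have h := (Finset.mem_filter.1 hx).2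
      rw [Int.floor_eq_iff] at h
      rw [div_le_iff₀ hL', le_div_iff₀ hL']
      exact ⟨h.1, h.2.le⟩)
  refine this.trans (le_of_eq ?_)
  field_simp
  ring

set_option maxHeartbeats 1000000 in
lemma ev_K (d : ℕ) (σ c M B ε : ℝ) (hσ : 1 / 2 < σ) (hσ1 : σ < 1) (hc : 0 < c) (hM : 0 ≤ M) (hε : 0 < ε) :
    ∀ᶠ H : ℝ in atTop, ∀ (Y : Finset ℝ) (τ v : ℝ), 0 ≤ v → v ≤ B → τ ≤ B →
    (∀ x ∈ Y, Gen d σ c M x) → Set.InjOn (fun x : ℝ => ⌊x * H ^ v⌋) Y →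
    (∀ x ∈ Y, ∃ R : ℤ[X], R ≠ 0 ∧ R.natDegree < d ∧ Z H x τ v R) →
    (Y.card : ℝ) ≤ H ^ (τ * d - v * σ + ε) := by
  set κ := ε / ((d:ℝ) + 10) with hκd
  have hκ : 0 < κ := by positivity
  have hκε : ((d:ℝ) + 10) * κ = ε := by rw [hκd]; field_simp
  filter_upwards [ev_triv M κ hM hκ, ev_descent d σ c M κ hσ hσ1 hc hκ, ev_irr d σ c M B κ hσ hσ1 hc hM hκ,
    ev_const (((⌊(B * d + κ) / κ⌋₊ + 1) * (⌊B / κ⌋₊ + 1) * d : ℕ) : ℝ) κ hκ, ev_const 3 κ hκ]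
    with H htriv hdesc hirr ⟨h1, h2⟩ ⟨_, h3⟩ Y τ v hv0 hvB hτB hY hcell hR
  have h0 : 0 < H := by linarith
  have hmono : ∀ {a b : ℝ}, a ≤ b → H ^ a ≤ H ^ b := fun h => Real.rpow_le_rpow_of_exponent_le h1.le h
  rcases Y.eq_empty_or_nonempty with rfl | ⟨x0, hx0⟩
  · simp; positivity
  have hτ0 : 0 ≤ τ := by
    obtain ⟨R, hR0, hRd, hZ⟩ := hR x0 hx0
    exact nonneg_of_one_le h1 ((one_le_ht hR0).trans hZ.1)
  have hdκ : 0 ≤ d * κ := by positivity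
  by_cases htr : v * (1 + σ) ≤ τ * d + κ
  · exact (htriv Y v hv0 (fun x hx => (hY x hx).1) hcell).trans (hmono (by linarith))
  push Not at htr
  have hcls : ∀ x ∈ Y, ∃ a b g : ℕ, a < ⌊(B * d + κ) / κ⌋₊ + 1 ∧ b < ⌊B / κ⌋₊ + 1 ∧ g < d ∧ 1 ≤ g ∧ b * κ ≤ v ∧
      ((a + 1) * κ) * (g + 1) - b * κ * σ + (v - b * κ) ≤ τ * d - v * σ + (d + 3) * κ ∧
      ∃ G : ℤ[X], Irreducible G ∧ G.natDegree = g ∧ Z H x ((a + 1) * κ) (b * κ) G := by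
    intro x hx
    obtain ⟨R, hR0, hRd, hZ⟩ := hR x hx
    have hRd' : (R.natDegree : ℝ) + 1 ≤ d := by exact_mod_cast hRd
    have hτd : τ * (R.natDegree + 1) ≤ τ * d := mul_le_mul_of_nonneg_left hRd' hτ0
    rcases hdesc x R τ v (hY x hx) hR0 hRd hv0 hZ with h | ⟨G, γ, V, hGi, hG1, hGR, hV0, hVv, hZG, hin⟩
    · linarith
    have hγ : 0 ≤ γ := nonneg_of_one_le h1 ((one_le_ht hGi.ne_zero).trans hZG.1)
    have hgd : ((G.natDegree : ℕ) : ℝ) + 1 ≤ d := by exact_mod_cast (show G.natDegree + 1 ≤ d by omega)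
    have hg1 : (1:ℝ) ≤ G.natDegree := by exact_mod_cast hG1
    have hγB : γ ≤ B * d + κ := by
      have e1 : τ * d ≤ B * d := mul_le_mul_of_nonneg_right hτB (by positivity)
      have e2 : 0 ≤ γ * G.natDegree := by positivity
      have e3 : V * σ ≤ v * σ := mul_le_mul_of_nonneg_right hVv (by linarith)
      linarith
    obtain ⟨a, ha1, ha2, ha3⟩ := grid hκ hγ hγB
    obtain ⟨b, hb1, hb2, hb3⟩ := grid hκ hV0 (hVv.trans hvB)
    refine ⟨a, b, G.natDegree, ha1, hb1, by omega, hG1, hb2.trans hVv, ?_, G, hGi, rfl, Z_mono h1 ha3 hb2 hZG⟩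
    have e1 : ((a + 1) * κ) * (G.natDegree + 1) ≤ (γ + κ) * (G.natDegree + 1) :=
      mul_le_mul_of_nonneg_right (by linarith) (by linarith)
    have e2 : κ * (G.natDegree + 1) ≤ κ * d := mul_le_mul_of_nonneg_left hgd hκ.le
    have e3 : (V - κ) * σ ≤ b * κ * σ := mul_le_mul_of_nonneg_right (by linarith) (by linarith)
    have e4 : κ * σ ≤ κ * 1 := mul_le_mul_of_nonneg_left hσ1.le hκ.le
    linarith
  choose! a b g ha hb hg hg1 hbv hin hG using hcls
  have := card_fib Y (Finset.range (⌊(B * d + κ) / κ⌋₊ + 1) ×ˢ (Finset.range (⌊B / κ⌋₊ + 1) ×ˢ Finset.range d))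
    (fun x => (a x, b x, g x)) (fun x hx => by simp only [Finset.mem_product, Finset.mem_range]; exact ⟨ha x hx, hb x hx, hg x hx⟩)
    (H ^ (τ * d - v * σ + (d + 5) * κ)) (by
      rintro ⟨a', b', g'⟩ _
      set Y' := Y.filter (fun x => (a x, b x, g x) = (a', b', g')) with hY'
      rcases Y'.eq_empty_or_nonempty with he | ⟨x1, hx1⟩
      · rw [he]; simp; positivity
      have hmem : ∀ x ∈ Y', x ∈ Y ∧ a x = a' ∧ b x = b' ∧ g x = g' := by
        intro x hx
        simpa [hY'] using hx
      obtain ⟨hx1Y, hx1a, hx1b, hx1g⟩ := hmem x1 hx1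
      have hin1 := hin x1 hx1Y
      rw [hx1a, hx1b, hx1g] at hin1
      have hbv1 := hbv x1 hx1Y
      rw [hx1b] at hbv1
      obtain ⟨T, hT, hTc, hTcard⟩ := cell_sel Y' (fun x => ⌊x * H ^ (b' * κ)⌋) (H ^ (v - b' * κ + κ)) (by
        intro m
        refine (scale_fib (Y := Y') (L := H ^ v) (L' := H ^ (b' * κ)) (by positivity) (by positivity)
          (hcell.mono (fun x hx => (hmem x hx).1)) m).trans ?_
        rw [← Real.rpow_sub h0, Real.rpow_add h0 _ κ]
        have : 1 ≤ H ^ (v - b' * κ) := Real.one_le_rpow h1.le (by linarith)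
        nlinarith)
      have hT2 := hirr T ((a' + 1) * κ) (b' * κ) g' (by rw [← hx1g]; exact hg1 x1 hx1Y)
        (by rw [← hx1g]; exact hg x1 hx1Y) (by positivity) (hbv1.trans hvB)
        (fun x hx => hY x (hmem x (hT hx)).1) hTc (by
          intro x hx
          obtain ⟨hxY, hxa, hxb, hxg⟩ := hmem x (hT hx)
          have := hG x hxY
          rwa [hxa, hxb, hxg] at this)
      refine hTcard.trans ?_
      calc _ ≤ H ^ ((a' + 1) * κ * (g' + 1) - b' * κ * σ + κ) * H ^ (v - b' * κ + κ) :=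
            mul_le_mul_of_nonneg_right hT2 (by positivity)
        _ = H ^ ((a' + 1) * κ * (g' + 1) - b' * κ * σ + κ + (v - b' * κ + κ)) := by
            rw [Real.rpow_add h0 _ (v - b' * κ + κ)]
        _ ≤ _ := hmono (by linarith))
  refine this.trans ?_
  have hcard : ((Finset.range (⌊(B * d + κ) / κ⌋₊ + 1) ×ˢ (Finset.range (⌊B / κ⌋₊ + 1) ×ˢ Finset.range d)).card : ℝ) ≤ H ^ κ := by
    refine le_trans (le_of_eq ?_) h2
    simp only [Finset.card_product, Finset.card_range]
    push_cast; ring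
  calc _ ≤ H ^ κ * H ^ (τ * d - v * σ + (d + 5) * κ) := mul_le_mul_of_nonneg_right hcard (by positivity)
    _ = H ^ (κ + (τ * d - v * σ + (d + 5) * κ)) := by rw [Real.rpow_add h0 κ]
    _ ≤ _ := hmono (by linarith)

end Bern

namespace Bern
open Polynomial Filter

lemma count_pm {Y : Finset ℤ[X]} {p : ℤ[X] → ℝ} {M L : ℝ} (hM : 0 ≤ M) (hL : 0 < L) (hY : ∀ P ∈ Y, |p P| ≤ M)
    (h : ∀ P ∈ Y, ∀ Q ∈ Y, |p P - p Q| ≤ L⁻¹ → Q = P ∨ Q = -P) : (Y.card : ℝ) ≤ (2 * M * L + 2) * 2 := by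
  classical
  have := count_cells Y p (-M) M L 2 (by linarith) hL.le (by norm_num) (fun x hx => abs_le.1 (hY x hx)) (by
    intro m
    rcases (Y.filter (fun x => ⌊p x * L⌋ = m)).eq_empty_or_nonempty with he | ⟨P, hP⟩
    · rw [he]; simp
    have hsub : (Y.filter (fun x => ⌊p x * L⌋ = m)) ⊆ {P, -P} := by
      intro Q hQ
      obtain ⟨hPY, hPm⟩ := Finset.mem_filter.1 hP
      obtain ⟨hQY, hQm⟩ := Finset.mem_filter.1 hQ
      have := h P hPY Q hQY (floor_eq_abs hL (hPm.trans hQm.symm))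
      simpa using this
    have h2 := (Finset.card_le_card hsub).trans (Finset.card_le_two)
    exact_mod_cast h2)
  refine this.trans (le_of_eq ?_)
  ring

/-- A polynomial of height about `H` with a certain shape near `x`. -/
def Sh (d : ℕ) (H κ W y x : ℝ) (P : ℤ[X]) : Prop :=
  Irreducible P ∧ P.natDegree = d ∧ H ≤ ht P ∧ ht P ≤ H ^ (1 + κ) ∧
    ∀ j : ℕ, |tc P x j| ≤ H ^ (1 - W + (d + 1) * κ + j * y)

lemma ev_y (d : ℕ) (M κ : ℝ) (hκ : 0 < κ) : ∀ᶠ H : ℝ in atTop, ∀ (P : ℤ[X]) (x W y : ℝ), |x| ≤ M → 0 ≤ y →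
    Sh d H κ W y x P → W ≤ d * y + (d + 2) * κ := by
  filter_upwards [ev_ht d M κ hκ, eventually_gt_atTop 1] with H hht h1 P x W y hx hy hP
  have := hht P x (1 - W + (d + 1) * κ + d * y) hP.2.1.le hx (by
    intro j
    by_cases hj : j ≤ d
    · refine (hP.2.2.2.2 j).trans (Real.rpow_le_rpow_of_exponent_le h1.le ?_)
      have : (j:ℝ) * y ≤ d * y := mul_le_mul_of_nonneg_right (by exact_mod_cast hj) hy
      linarith
    · rw [tc_eq_zero _ _ _ (by rw [hP.2.1]; omega)]
      simp
      have : 0 < H := by linarith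
      positivity)
  have h3 := hP.2.2.1.trans this
  nth_rewrite 1 [← Real.rpow_one H] at h3
  rw [Real.rpow_le_rpow_left_iff h1] at h3
  linarith

set_option maxHeartbeats 1000000 in
/-- Case (i). -/
lemma ev_case1 (d : ℕ) (σ M W κ : ℝ) (hσ : 1 / 2 < σ) (hσ1 : σ < 1) (hM : 0 ≤ M) (hd : 1 ≤ d)
    (hW : d + 1 ≤ W * σ) (hκ : 0 < κ) (hκ1 : 8 * ((d:ℝ) + 2) ^ 2 * κ ≤ 1) :
    ∀ᶠ H : ℝ in atTop, ∀ (Y : Finset ℤ[X]) (p : ℤ[X] → ℝ) (y : ℝ), 0 ≤ y → 2 * y ≤ W → (∀ P ∈ Y, |p P| ≤ M) →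
    (∀ P ∈ Y, Sh d H κ W y (p P) P) → (Y.card : ℝ) ≤ H ^ (σ * y + κ) := by
  filter_upwards [ev_y d M κ hκ, ev_shift d κ hκ, ev_cluster d κ hκ, ev_tc d M κ hκ, ev_const (4 * M + 4) κ hκ]
    with H hy hsh hcl htc ⟨h1, h2⟩ Y p y hy0 hyW hYM hY
  have h0 : 0 < H := by linarith
  have hmono : ∀ {a b : ℝ}, a ≤ b → H ^ a ≤ H ^ b := fun h => Real.rpow_le_rpow_of_exponent_le h1.le h
  have hd' : (1:ℝ) ≤ d := by exact_mod_cast hd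
  have hdκ : ((d:ℝ) + 2) * κ ≤ 1 / 4 := by nlinarith
  have hddκ : (d:ℝ) * (((d:ℝ) + 2) * κ) ≤ 1 / 4 := by nlinarith
  have hW0 : 2 < W := by nlinarith
  have hκ0 : κ ≤ d * κ := by nlinarith
  have key := count_pm (Y := Y) (p := p) (M := M) (L := H ^ (σ * y)) hM (by positivity) hYM (by
    intro P hP Q hQ hPQ
    have sP := hY P hP
    have sQ := hY Q hQ
    have hd2 : 2 ≤ d := by
      by_contra hlt
      have : d = 1 := by omega
      have h3 := hy P (p P) W y (hYM P hP) hy0 sP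
      rw [this] at h3 hdκ
      norm_num at h3 hdκ
      linarith
    apply irr_rel sP.1 sQ.1
    intro hrel
    rw [← Real.rpow_neg h0.le] at hPQ
    have hgood : ∀ R ∈ Y, ∀ i : ℕ, |tc R (p R) i| ≤ H ^ (1 + (d + 1) * κ - W * σ + i * (σ * y)) := by
      intro R hR i
      rcases le_total 0 (W - i * y) with h | h
      · refine ((hY R hR).2.2.2.2 i).trans (hmono ?_)
        have : (W - i * y) * σ ≤ (W - i * y) * 1 := mul_le_mul_of_nonneg_left hσ1.le h
        linarith
      · refine (htc R (p R) (1 + κ) (hY R hR).2.1.le (hYM R hR) (hY R hR).2.2.2.1 i).trans (hmono ?_)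
        have : (W - i * y) * σ ≤ 0 := mul_nonpos_of_nonpos_of_nonneg h (by linarith)
        linarith
    have hht : ∀ R ∈ Y, ∀ x, |x| ≤ M → ∀ i : ℕ, |tc R x i| ≤ H ^ (1 + (d + 1) * κ) := by
      intro R hR x hx i
      refine (htc R x (1 + κ) (hY R hR).2.1.le hx (hY R hR).2.2.2.1 i).trans (hmono ?_)
      linarith
    have hσy : σ * y ≤ W * σ / 2 := by nlinarith
    have res := hcl P Q (p Q) (1 + (d + 1) * κ + κ) (1 + (d + 1) * κ + κ) (W * σ / 2) 2 2 sP.2.1.le sQ.2.1.le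
      sP.1.ne_zero hrel (by nlinarith) (by rw [sP.2.1]; omega) (by rw [sQ.2.1]; omega)
      (by
        intro j
        rcases Nat.lt_or_ge j 2 with hj | hj
        · have := hsh P (p P) (p Q) (σ * y) (1 + (d + 1) * κ - W * σ + j * (σ * y)) j sP.2.1.le hPQ (by
            intro i _
            refine (hgood P hP i).trans (hmono (le_of_eq ?_))
            ring)
          refine this.trans (hmono ?_)
          interval_cases j <;> norm_num <;> linarith
        · rw [Nat.sub_eq_zero_of_le hj]
          refine (hht P hP (p Q) (hYM Q hQ) j).trans (hmono ?_)
          simp; linarith)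
      (by
        intro j
        rcases Nat.lt_or_ge j 2 with hj | hj
        · refine (hgood Q hQ j).trans (hmono ?_)
          interval_cases j <;> norm_num <;> linarith
        · rw [Nat.sub_eq_zero_of_le hj]
          refine (hht Q hQ (p Q) (hYM Q hQ) j).trans (hmono ?_)
          simp; linarith)
    rw [sP.2.1, sQ.2.1] at res
    norm_num at res
    nlinarith)
  refine key.trans ?_
  have : 1 ≤ H ^ (σ * y) := Real.one_le_rpow h1.le (by positivity)
  rw [Real.rpow_add h0]
  nlinarith

set_option maxHeartbeats 1000000 in
/-- Case (ii). -/
lemma ev_case2 (d : ℕ) (σ M W κ : ℝ) (hσ : 1 / 2 < σ) (hσ1 : σ < 1) (hM : 0 ≤ M) (hd : 1 ≤ d)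
    (hκ : 0 < κ) (hκ1 : 8 * ((d:ℝ) + 2) ^ 2 * κ ≤ 1)
    (hκ2 : d / 2 + ((d:ℝ) + 2) ^ 2 * κ ≤ d / (1 + σ)) :
    ∀ᶠ H : ℝ in atTop, ∀ (Y : Finset ℤ[X]) (p : ℤ[X] → ℝ) (y : ℝ), 0 ≤ y → W ≤ 2 * y → y ≤ W → d / (1 + σ) ≤ W - y → (∀ P ∈ Y, |p P| ≤ M) →
    (∀ P ∈ Y, Sh d H κ W y (p P) P) → (Y.card : ℝ) ≤ H ^ (d / 2 + ((d:ℝ) + 2) ^ 2 * κ + κ) := by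
  filter_upwards [ev_y d M κ hκ, ev_shift d κ hκ, ev_cluster d κ hκ, ev_tc d M κ hκ, ev_const (4 * M + 4) κ hκ]
    with H hy hsh hcl htc ⟨h1, h2⟩ Y p y hy0 hyW hyW2 hv hYM hY
  have h0 : 0 < H := by linarith
  have hmono : ∀ {a b : ℝ}, a ≤ b → H ^ a ≤ H ^ b := fun h => Real.rpow_le_rpow_of_exponent_le h1.le h
  have hd' : (1:ℝ) ≤ d := by exact_mod_cast hd
  have hdκ : ((d:ℝ) + 2) * κ ≤ 1 / 4 := by nlinarith
  have hκ0 : κ ≤ d * κ := by nlinarith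
  have hTd : (d:ℝ) * (((d:ℝ) + 2) * κ) + κ ≤ ((d:ℝ) + 2) ^ 2 * κ := by nlinarith
  generalize ((d:ℝ) + 2) ^ 2 * κ = T at *
  have hT : 0 ≤ T := by linarith [mul_nonneg hκ.le (by linarith : (0:ℝ) ≤ d), mul_nonneg (by linarith : (0:ℝ) ≤ d) (by nlinarith : 0 ≤ ((d:ℝ) + 2) * κ)]
  obtain ⟨q, hq⟩ : ∃ q, q = d / 2 + T := ⟨_, rfl⟩
  rw [← hq] at hκ2 ⊢
  have hq0 : 0 ≤ q := by linarith
  have hqv : q ≤ W - y := hκ2.trans hv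
  have key := count_pm (Y := Y) (p := p) (M := M) (L := H ^ q) hM (by positivity) hYM (by
    intro P hP Q hQ hPQ
    have sP := hY P hP
    have sQ := hY Q hQ
    have hd2 : 2 ≤ d := by
      by_contra hlt
      have : d = 1 := by omega
      have h3 := hy P (p P) W y (hYM P hP) hy0 sP
      rw [this] at h3 hdκ hq
      norm_num at h3 hdκ hq
      linarith
    apply irr_rel sP.1 sQ.1
    intro hrel
    rw [← Real.rpow_neg h0.le] at hPQ
    have hht : ∀ R ∈ Y, ∀ x, |x| ≤ M → ∀ i : ℕ, |tc R x i| ≤ H ^ (1 + (d + 1) * κ) := by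
      intro R hR x hx i
      refine (htc R x (1 + κ) (hY R hR).2.1.le hx (hY R hR).2.2.2.1 i).trans (hmono ?_)
      linarith
    have res := hcl P Q (p Q) (1 + (d + 1) * κ + κ) (1 + (d + 1) * κ + κ) q 2 2 sP.2.1.le sQ.2.1.le
      sP.1.ne_zero hrel hq0 (by rw [sP.2.1]; omega) (by rw [sQ.2.1]; omega)
      (by
        intro j
        rcases Nat.lt_or_ge j 2 with hj | hj
        · have := hsh P (p P) (p Q) q (1 + (d + 1) * κ - (2 - j) * q) j sP.2.1.le hPQ (by
            intro i hji
            rcases Nat.lt_or_ge i 2 with hi | hi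
            · refine (sP.2.2.2.2 i).trans (hmono ?_)
              interval_cases i
              · have : j = 0 := by omega
                rw [this]; norm_num; linarith
              · norm_num; linarith
            · refine (hht P hP (p P) (hYM P hP) i).trans (hmono ?_)
              have : (2:ℝ) * q ≤ i * q := mul_le_mul_of_nonneg_right (by exact_mod_cast hi) hq0
              linarith)
          refine this.trans (hmono ?_)
          interval_cases j <;> norm_num <;> linarith
        · rw [Nat.sub_eq_zero_of_le hj]
          refine (hht P hP (p Q) (hYM Q hQ) j).trans (hmono ?_)
          simp; linarith)
      (by
        intro j
        rcases Nat.lt_or_ge j 2 with hj | hj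
        · refine (sQ.2.2.2.2 j).trans (hmono ?_)
          interval_cases j <;> norm_num <;> linarith
        · rw [Nat.sub_eq_zero_of_le hj]
          refine (hht Q hQ (p Q) (hYM Q hQ) j).trans (hmono ?_)
          simp; linarith)
    rw [sP.2.1, sQ.2.1] at res
    norm_num at res
    nlinarith)
  refine key.trans ?_
  have : 1 ≤ H ^ q := Real.one_le_rpow h1.le hq0
  rw [Real.rpow_add h0]
  nlinarith

end Bern

namespace Bern
open Polynomial Filter

set_option maxHeartbeats 1000000 in
lemma ev_box (d : ℕ) (M κ : ℝ) (hd : 1 ≤ d) (hκ : 0 < κ) :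
    ∀ᶠ H : ℝ in atTop, ∀ (Y : Finset ℤ[X]) (x a τ v : ℝ), |x| ≤ M → 0 ≤ v → τ - κ ≤ a → 0 ≤ a →
    (∀ P ∈ Y, P.natDegree ≤ d) → (∀ P ∈ Y, ∀ j : ℕ, |tc P x j| ≤ H ^ (a - ((2 - j : ℕ) : ℝ) * v)) →
    (∀ R : ℤ[X], R ≠ 0 → R.natDegree < d → ¬ Z H x τ v R) →
    (Y.card : ℝ) ≤ H ^ (a + κ + d * (a - τ + 2 * κ)) := by
  filter_upwards [ev_ht d M κ hκ, ev_const 4 κ hκ]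
    with H hht ⟨h1, h4⟩ Y x a τ v hx hv hτa ha hYd hY hZ
  classical
  have h0 : 0 < H := by linarith
  have hmono : ∀ {a b : ℝ}, a ≤ b → H ^ a ≤ H ^ b := fun h => Real.rpow_le_rpow_of_exponent_le h1.le h
  -- width exponents
  set θ : ℕ → ℝ := fun j => if j = d then 0 else τ - κ - ((2 - j : ℕ) : ℝ) * v with hθ
  set β : ℕ → ℝ := fun j => if j = d then a else a - ((2 - j : ℕ) : ℝ) * v with hβ
  have hβY : ∀ P ∈ Y, ∀ j, |tc P x j| ≤ H ^ (β j) := by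
    intro P hP j
    simp only [hβ]
    split_ifs
    · refine (hY P hP j).trans (hmono ?_)
      have : 0 ≤ ((2 - j : ℕ) : ℝ) * v := by positivity
      linarith
    · exact hY P hP j
  set f : ℤ[X] → (Fin (d + 1) → ℤ) := fun P j => ⌊tc P x j / H ^ (θ j)⌋ with hf
  have hinj : Set.InjOn f Y := by
    intro P hP Q hQ hPQ
    by_contra hne
    have hR0 : P - Q ≠ 0 := sub_ne_zero.2 hne
    have hRd : (P - Q).natDegree ≤ d := (natDegree_sub_le _ _).trans (max_le (hYd P hP) (hYd Q hQ))
    have hdiff : ∀ j, j ≤ d → |tc (P - Q) x j| < H ^ (θ j) := by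
      intro j hj
      have h5 : ⌊tc P x j / H ^ (θ j)⌋ = ⌊tc Q x j / H ^ (θ j)⌋ := congrFun hPQ ⟨j, by omega⟩
      have h6 := Int.abs_sub_lt_one_of_floor_eq_floor h5
      rw [← sub_div, abs_div, abs_of_pos (show (0:ℝ) < H ^ (θ j) by positivity), div_lt_one (by positivity)] at h6
      rw [tc_sub]
      exact h6
    have hcd : (P - Q).coeff d = 0 := by
      have := hdiff d le_rfl
      rw [tc_natDegree _ x d hRd] at this
      simp only [hθ, if_true, Real.rpow_zero] at this
      have h7 : |(P - Q).coeff d| < 1 := by exact_mod_cast this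
      exact Int.abs_lt_one_iff.1 h7
    have hRd' : (P - Q).natDegree < d := by
      rcases lt_or_eq_of_le hRd with h | h
      · exact h
      · exfalso
        rw [← h] at hcd
        exact hR0 (leadingCoeff_eq_zero.1 hcd)
    have hs : ∀ j : ℕ, |tc (P - Q) x j| ≤ H ^ (τ - κ - ((2 - j : ℕ) : ℝ) * v) := by
      intro j
      by_cases hj : j < d
      · have := hdiff j hj.le
        simp only [hθ, if_neg hj.ne] at this
        exact this.le
      · rw [tc_eq_zero _ _ _ (by omega)]
        simp; positivity
    apply hZ (P - Q) hR0 hRd'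
    refine ⟨?_, ?_, ?_⟩
    · have := hht (P - Q) x (τ - κ) hRd hx (fun j => (hs j).trans (hmono (by
        have : 0 ≤ ((2 - j : ℕ) : ℝ) * v := by positivity
        linarith)))
      simpa using this
    · refine (hs 0).trans (hmono ?_)
      norm_num; linarith
    · refine (hs 1).trans (hmono ?_)
      norm_num; linarith
  set F : Fin (d + 1) → Finset ℤ := fun j => Finset.Icc ⌊-(H ^ (β j - θ j))⌋ ⌊H ^ (β j - θ j)⌋ with hF
  have hmap : ∀ P ∈ Y, f P ∈ Fintype.piFinset F := by
    intro P hP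
    rw [Fintype.mem_piFinset]
    intro j
    simp only [hF, Finset.mem_Icc, hf]
    have h5 := abs_le.1 (hβY P hP j)
    have h6 : (0:ℝ) < H ^ (θ j) := by positivity
    rw [Real.rpow_sub h0]
    constructor
    · apply Int.floor_le_floor
      rw [← neg_div]
      exact div_le_div_of_nonneg_right h5.1 h6.le
    · apply Int.floor_le_floor
      exact div_le_div_of_nonneg_right h5.2 h6.le
  have hcard : Y.card ≤ (Fintype.piFinset F).card := Finset.card_le_card_of_injOn f hmap hinj
  rw [Fintype.card_piFinset] at hcard
  have hcF : ∀ j : Fin (d + 1), ((F j).card : ℝ) ≤ if (j : ℕ) = d then H ^ (a + κ) else H ^ (a - τ + 2 * κ) := by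
    intro j
    have h5 := card_Icc_floor (-(H ^ (β j - θ j))) (H ^ (β j - θ j))
      (by have : (0:ℝ) < H ^ (β j - θ j) := by positivity
          linarith)
    refine h5.trans ?_
    have h6 : ∀ u : ℝ, 0 ≤ u → H ^ u - -H ^ u + 2 ≤ H ^ (u + κ) := by
      intro u hu
      have : 1 ≤ H ^ u := Real.one_le_rpow h1.le hu
      rw [Real.rpow_add h0]
      nlinarith
    split_ifs with hj
    · simp only [hβ, hθ, if_pos hj, sub_zero]
      exact h6 a ha
    · have e : β j - θ j = a - τ + κ := by
        simp only [hβ, hθ, if_neg hj]; ring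
      rw [e]
      refine (h6 _ (by linarith)).trans (le_of_eq ?_)
      congr 1; ring
  have hc2 : (Y.card : ℝ) ≤ ∏ j : Fin (d + 1), ((F j).card : ℝ) := by
    exact_mod_cast hcard
  refine hc2.trans ((Finset.prod_le_prod (fun _ _ => by positivity) (fun j _ => hcF j)).trans (le_of_eq ?_))
  rw [Fin.prod_univ_castSucc]
  have e1 : ∀ i : Fin d, (if ((Fin.castSucc i : Fin (d + 1)) : ℕ) = d then H ^ (a + κ) else H ^ (a - τ + 2 * κ)) = H ^ (a - τ + 2 * κ) := by
    intro i
    rw [if_neg]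
    simp only [Fin.val_castSucc]
    exact i.2.ne
  rw [Finset.prod_congr rfl (fun i _ => e1 i)]
  simp only [Finset.prod_const, Finset.card_univ, Fintype.card_fin, Fin.val_last, if_true]
  rw [← Real.rpow_mul_natCast h0.le, ← Real.rpow_add h0]
  congr 1; ring

set_option maxHeartbeats 2000000 in
/-- Case (iii). -/
lemma ev_case3 (d : ℕ) (σ c M W κ : ℝ) (hσ : 1 / 2 < σ) (hσ1 : σ < 1) (hc : 0 < c) (hM : 0 ≤ M) (hd : 1 ≤ d)
    (hκ : 0 < κ) :
    ∀ᶠ H : ℝ in atTop, ∀ (Y : Finset ℤ[X]) (p : ℤ[X] → ℝ) (y : ℝ), 0 ≤ y → W ≤ 2 * y → y ≤ W → W - y ≤ d / (1 + σ) →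
    (∀ P ∈ Y, Gen d σ c M (p P)) →
    (∀ P ∈ Y, Sh d H κ W y (p P) P) → (Y.card : ℝ) ≤ H ^ (d + 1 - (W - y) * σ + ((d:ℝ) + 4) ^ 2 * κ) := by
  filter_upwards [ev_shift d κ hκ, ev_tc d M κ hκ, ev_triv M κ hM hκ,
    ev_K d σ c M (max W 1) κ hσ hσ1 hc hM hκ, ev_box d M κ hd hκ,
    ev_const ((⌊1 / κ⌋₊ + 2 : ℕ) : ℝ) κ hκ]
    with H hsh htc htriv hK hbox ⟨h1, h2⟩ Y p y hy0 hyW hyW2 hvd hYG hY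
  classical
  have h0 : 0 < H := by linarith
  have hmono : ∀ {a b : ℝ}, a ≤ b → H ^ a ≤ H ^ b := fun h => Real.rpow_le_rpow_of_exponent_le h1.le h
  have hd' : (1:ℝ) ≤ d := by exact_mod_cast hd
  obtain ⟨v, hv⟩ : ∃ v, v = W - y := ⟨_, rfl⟩
  rw [← hv] at hvd ⊢
  have hv0 : 0 ≤ v := by linarith
  have hvW : v ≤ max W 1 := le_trans (by linarith) (le_max_left _ _)
  have hκ0 : κ ≤ d * κ := by nlinarith
  -- the index
  have hvd2 : v * (1 + σ) ≤ d := by rwa [le_div_iff₀ (by linarith)] at hvd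
  have hex : ∀ x : ℝ, ∃ i : ℕ, (∃ R : ℤ[X], R ≠ 0 ∧ R.natDegree < d ∧ Z H x (i * κ) v R) ∨ v * (1 + σ) ≤ i * κ * d := by
    intro x
    refine ⟨⌊1 / κ⌋₊ + 1, Or.inr ?_⟩
    have h3 : 1 ≤ ((⌊1 / κ⌋₊ + 1 : ℕ) : ℝ) * κ := by
      have := Nat.lt_floor_add_one (1 / κ)
      rw [div_lt_iff₀ hκ] at this
      push_cast; linarith
    nlinarith
  have hix : ∀ x : ℝ, ∃ i : ℕ, i < ⌊1 / κ⌋₊ + 2 ∧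
      ((∃ R : ℤ[X], R ≠ 0 ∧ R.natDegree < d ∧ Z H x (i * κ) v R) ∨ v * (1 + σ) ≤ i * κ * d) ∧
      (∀ R : ℤ[X], R ≠ 0 → R.natDegree < d → ¬ Z H x ((i - 1) * κ) v R) := by
    intro x
    refine ⟨Nat.find (hex x), ?_, Nat.find_spec (hex x), ?_⟩
    · refine Nat.lt_succ_of_le (Nat.find_le ?_)
      right
      have h3 : 1 ≤ ((⌊1 / κ⌋₊ + 1 : ℕ) : ℝ) * κ := by
        have := Nat.lt_floor_add_one (1 / κ)
        rw [div_lt_iff₀ hκ] at this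
        push_cast; linarith
      nlinarith
    · intro R hR hRd hZ
      rcases Nat.eq_zero_or_pos (Nat.find (hex x)) with h | h
      · rw [h] at hZ
        have := nonneg_of_one_le h1 ((one_le_ht hR).trans hZ.1)
        push_cast at this
        linarith
      · refine Nat.find_min (hex x) (m := Nat.find (hex x) - 1) (by omega) (Or.inl ⟨R, hR, hRd, ?_⟩)
        rw [Nat.cast_sub h]
        simpa using hZ
  choose ι hι1 hι2 hι3 using hix
  -- cells
  set cell : ℤ[X] → ℤ := fun P => ⌊p P * H ^ v⌋ with hcell
  -- representatives
  have hrep : ∀ m ∈ Y.image cell, ∃ P ∈ Y, cell P = m := by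
    intro m hm
    simpa using hm
  choose! rep hrepY hrepc using hrep
  have hiκ : ∀ i : ℕ, i < ⌊1 / κ⌋₊ + 2 → i * κ ≤ 1 + κ := by
    intro i hi
    have h3 : (i:ℝ) ≤ ⌊1 / κ⌋₊ + 1 := by exact_mod_cast Nat.lt_succ_iff.1 hi
    have h5 : (⌊1 / κ⌋₊ : ℝ) ≤ 1 / κ := Nat.floor_le (by positivity)
    have h6 : (i:ℝ) * κ ≤ (1 / κ + 1) * κ := mul_le_mul_of_nonneg_right (by linarith) hκ.le
    have h7 : (1 / κ + 1) * κ = 1 + κ := by field_simp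
    linarith
  have key := card_fib Y (Finset.range (⌊1 / κ⌋₊ + 2)) (fun P => ι (p (rep (cell P)))) (fun P _ => Finset.mem_range.2 (hι1 _))
    (H ^ (d + 1 - v * σ + ((d:ℝ) + 4) ^ 2 * κ - κ)) (by
      intro i hi
      rw [Finset.mem_range] at hi
      set Yi := Y.filter (fun P => ι (p (rep (cell P))) = i) with hYi
      have hYimem : ∀ P ∈ Yi, P ∈ Y ∧ ι (p (rep (cell P))) = i := fun P hP => Finset.mem_filter.1 hP
      -- count within a cell
      have hfib := card_fib Yi (Yi.image cell) cell (fun P hP => Finset.mem_image_of_mem _ hP)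
        (H ^ ((1 + (d + 2) * κ) + κ + d * ((1 + (d + 2) * κ) - (i - 1) * κ + 2 * κ))) (by
          intro m hm
          obtain ⟨P0, hP0, hP0m⟩ := Finset.mem_image.1 hm
          obtain ⟨hP0Y, hP0i⟩ := hYimem P0 hP0
          rw [hP0m] at hP0i
          have hmY : m ∈ Y.image cell := Finset.mem_image.2 ⟨P0, hP0Y, hP0m⟩
          have hx := hYG _ (hrepY m hmY)
          have hik := hiκ i hi
          refine hbox _ (p (rep m)) (1 + (d + 2) * κ) ((i - 1) * κ) v hx.1 hv0 ?_ (by positivity) ?_ ?_ ?_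
          · nlinarith
          · intro P hP
            exact (hY P (hYimem P (Finset.mem_filter.1 hP).1).1).2.1.le
          · intro P hP j
            have hPY := (hYimem P (Finset.mem_filter.1 hP).1).1
            have hPm := (Finset.mem_filter.1 hP).2
            have sP := hY P hPY
            have hdist : |p P - p (rep m)| ≤ H ^ (-v) := by
              rw [Real.rpow_neg h0.le]
              exact floor_eq_abs (by positivity) (hPm.trans (hrepc m hmY).symm)
            rcases Nat.lt_or_ge j 2 with hj | hj
            · have := hsh P (p P) (p (rep m)) v (1 + (d + 1) * κ - (2 - j) * v) j sP.2.1.le hdist (by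
                intro i hji
                rcases Nat.lt_or_ge i 2 with hi | hi
                · refine (sP.2.2.2.2 i).trans (hmono ?_)
                  interval_cases i
                  · have : j = 0 := by omega
                    rw [this]; norm_num; linarith
                  · norm_num; linarith
                · refine (htc P (p P) (1 + κ) sP.2.1.le (hYG P hPY).1 sP.2.2.2.1 i).trans (hmono ?_)
                  have : (2:ℝ) * v ≤ i * v := mul_le_mul_of_nonneg_right (by exact_mod_cast hi) hv0
                  linarith)
              refine this.trans (hmono ?_)
              interval_cases j <;> norm_num <;> linarith
            · rw [Nat.sub_eq_zero_of_le hj]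
              refine (htc P (p (rep m)) (1 + κ) sP.2.1.le hx.1 sP.2.2.2.1 j).trans (hmono ?_)
              simp; linarith
          · have := hι3 (p (rep m))
            rwa [hP0i] at this)
      -- number of cells
      have hnum : ((Yi.image cell).card : ℝ) ≤ H ^ (i * κ * d - v * σ + κ) := by
        set X := (Yi.image cell).image (fun m => p (rep m)) with hX
        have hmY : ∀ m ∈ Yi.image cell, m ∈ Y.image cell ∧ ι (p (rep m)) = i := by
          intro m hm
          obtain ⟨P0, hP0, hP0m⟩ := Finset.mem_image.1 hm
          obtain ⟨hP0Y, hP0i⟩ := hYimem P0 hP0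
          rw [hP0m] at hP0i
          exact ⟨Finset.mem_image.2 ⟨P0, hP0Y, hP0m⟩, hP0i⟩
        have hfl : ∀ m ∈ Yi.image cell, ⌊p (rep m) * H ^ v⌋ = m := fun m hm => hrepc m (hmY m hm).1
        have hXcard : X.card = (Yi.image cell).card := by
          apply Finset.card_image_of_injOn
          intro m hm m' hm' h
          have h' : p (rep m) = p (rep m') := h
          rw [← hfl m hm, ← hfl m' hm', h']
        rw [← hXcard]
        have hXinj : Set.InjOn (fun x : ℝ => ⌊x * H ^ v⌋) X := by
          intro x hx x' hx' h
          obtain ⟨m, hm, rfl⟩ := Finset.mem_image.1 hx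
          obtain ⟨m', hm', rfl⟩ := Finset.mem_image.1 hx'
          have h' : ⌊p (rep m) * H ^ v⌋ = ⌊p (rep m') * H ^ v⌋ := h
          rw [hfl m hm, hfl m' hm'] at h'
          rw [h']
        have hXG : ∀ x ∈ X, Gen d σ c M x := by
          intro x hx
          obtain ⟨m, hm, rfl⟩ := Finset.mem_image.1 hx
          exact hYG _ (hrepY m (hmY m hm).1)
        by_cases hbig : v * (1 + σ) ≤ i * κ * d
        · refine (htriv X v hv0 (fun x hx => (hXG x hx).1) hXinj).trans (hmono ?_)
          linarith
        · have hi1 : i * κ ≤ max W 1 := by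
            refine le_trans ?_ (le_max_right _ _)
            have : i * κ * d ≤ 1 * d := by linarith
            exact le_of_mul_le_mul_right this (by linarith)
          apply hK X (i * κ) v hv0 hvW hi1 hXG hXinj
          intro x hx
          obtain ⟨m, hm, rfl⟩ := Finset.mem_image.1 hx
          have := hι2 (p (rep m))
          rw [(hmY m hm).2] at this
          rcases this with h | h
          · exact h
          · exact absurd h hbig
      refine hfib.trans ?_
      calc _ ≤ H ^ (i * κ * d - v * σ + κ) * H ^ ((1 + (d + 2) * κ) + κ + d * ((1 + (d + 2) * κ) - (i - 1) * κ + 2 * κ)) :=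
            mul_le_mul_of_nonneg_right hnum (by positivity)
        _ = H ^ ((i * κ * d - v * σ + κ) + ((1 + (d + 2) * κ) + κ + d * ((1 + (d + 2) * κ) - (i - 1) * κ + 2 * κ))) := by
            rw [← Real.rpow_add h0]
        _ ≤ _ := by
            apply hmono
            nlinarith)
  refine key.trans ?_
  rw [Finset.card_range]
  calc _ ≤ H ^ κ * H ^ (d + 1 - v * σ + ((d:ℝ) + 4) ^ 2 * κ - κ) := mul_le_mul_of_nonneg_right h2 (by positivity)
    _ = _ := by rw [← Real.rpow_add h0]; congr 1; ring

end Bern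

namespace Bern
open Polynomial Filter

set_option maxHeartbeats 1000000 in
lemma ev_count (d : ℕ) (σ s W : ℝ) (hσ : 1 / 2 < σ) (hσ1 : σ < 1) (hs : σ < s) (hd : 1 ≤ d) (hW : d + 1 < W * σ) :
    ∃ κ : ℝ, 0 < κ ∧ 4 * κ ≤ 1 ∧ ∀ c M : ℝ, 0 < c → 0 ≤ M → 
    ∀ᶠ H : ℝ in atTop, ∀ (Y : Finset ℤ[X]) (p : ℤ[X] → ℝ) (y : ℝ), 0 ≤ y → y ≤ W → 
      (∀ P ∈ Y, Gen d σ c M (p P)) → (∀ P ∈ Y, Sh d H κ W y (p P) P) →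
      (Y.card : ℝ) ≤ H ^ (s * y - κ) ∧ (Y.Nonempty → 1 ≤ y) := by
  have hd' : (1:ℝ) ≤ d := by exact_mod_cast hd
  obtain ⟨η, hη⟩ : ∃ η : ℝ, η = min (min 1 (d / (1 + σ) - d / 2)) (min (s - σ) (W * σ - d - 1)) := ⟨_, rfl⟩
  have e1 : 0 < (d:ℝ) / (1 + σ) - d / 2 := by
    rw [sub_pos]
    apply div_lt_div_of_pos_left <;> linarith
  have h0 : 0 < η := by
    rw [hη]; apply lt_min <;> apply lt_min <;> linarith
  have a1 : η ≤ 1 := by rw [hη]; exact (min_le_left _ _).trans (min_le_left _ _)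
  have a2 : η ≤ d / (1 + σ) - d / 2 := by rw [hη]; exact (min_le_left _ _).trans (min_le_right _ _)
  have a3 : η ≤ s - σ := by rw [hη]; exact (min_le_right _ _).trans (min_le_left _ _)
  have a4 : η ≤ W * σ - d - 1 := by rw [hη]; exact (min_le_right _ _).trans (min_le_right _ _)
  obtain ⟨κ, hκd⟩ : ∃ κ : ℝ, κ = η / (8 * ((d:ℝ) + 4) ^ 2) := ⟨_, rfl⟩
  have hκ : 0 < κ := by rw [hκd]; positivity
  have hκe : 8 * ((d:ℝ) + 4) ^ 2 * κ = η := by rw [hκd]; field_simp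
  have b1 : ((d:ℝ) + 2) ^ 2 * κ ≤ ((d:ℝ) + 4) ^ 2 * κ := by
    apply mul_le_mul_of_nonneg_right _ hκ.le; nlinarith
  have b2 : κ * 9 ≤ ((d:ℝ) + 2) ^ 2 * κ := by nlinarith
  have b3 : ((d:ℝ) + 2) * κ ≤ ((d:ℝ) + 2) ^ 2 * κ := by
    apply mul_le_mul_of_nonneg_right _ hκ.le; nlinarith
  have c1 : 8 * ((d:ℝ) + 2) ^ 2 * κ ≤ 1 := by linarith
  have c2 : d/2+((d:ℝ)+2)^2*κ ≤ d/(1+σ) := by linarith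
  have hW0 : (d:ℝ) + 1 < W := by nlinarith
  refine ⟨κ, hκ, by linarith, fun c M hc hM => ?_⟩
  filter_upwards [ev_y d M κ hκ, ev_case1 d σ M W κ hσ hσ1 hM hd hW.le hκ c1,
    ev_case2 d σ M W κ hσ hσ1 hM hd hκ c1 c2, ev_case3 d σ c M W κ hσ hσ1 hc hM hd hκ, eventually_gt_atTop 1]
    with H hy h1 h2 h3 H1 Y p y hy0 hyW hG hS
  have hmono : ∀ {a b : ℝ}, a ≤ b → H ^ a ≤ H ^ b := fun h => Real.rpow_le_rpow_of_exponent_le H1.le h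
  rcases Y.eq_empty_or_nonempty with rfl | ⟨P0, hP0⟩
  · simp; positivity
  have hyge : 1 ≤ y := by
    have := hy P0 (p P0) W y (hG P0 hP0).1 hy0 (hS P0 hP0)
    by_contra hlt
    push Not at hlt
    have : (d:ℝ) * y ≤ d * 1 := mul_le_mul_of_nonneg_left hlt.le (by positivity)
    linarith
  refine ⟨?_, fun _ => hyge⟩
  have hsy : s - σ ≤ (s - σ) * y := by nlinarith
  have hYM : ∀ P ∈ Y, |p P| ≤ M := fun P hP => (hG P hP).1
  by_cases q1 : 2 * y ≤ W
  · refine (h1 Y p y hy0 q1 hYM hS).trans (hmono ?_)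
    linarith
  push Not at q1
  by_cases q2 : d / (1 + σ) ≤ W - y
  · refine (h2 Y p y hy0 q1.le hyW q2 hYM hS).trans (hmono ?_)
    have : W * σ ≤ 2 * y * σ := mul_le_mul_of_nonneg_right q1.le (by linarith)
    linarith
  push Not at q2
  · refine (h3 Y p y hy0 q1.le hyW q2.le hG hS).trans (hmono ?_)
    linarith

/-- limsup covering lemma -/
lemma dimH_limsup {τ : Type*} (E : Set ℝ) (s : NNReal) (B : ℕ → Finset τ) (ctr rad : ℕ → τ → ℝ) (T : ℕ) (r : ℕ → ℝ)
    (hr : Tendsto r atTop (nhds 0))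
    (hBr : ∀ t ≥ T, ∀ n ≤ t, ∀ b ∈ B t, 2 * rad t b ≤ r n) (u : ℕ → ℝ≥0∞) (hu : ∑' t, u t ≠ ⊤)
    (hBu : ∀ t ≥ T, ∑ b ∈ B t, ENNReal.ofReal (2 * rad t b) ^ (s : ℝ) ≤ u t)
    (hE : ∀ x ∈ E, ∀ n, ∃ t ≥ n, ∃ b ∈ B t, |x - ctr t b| ≤ rad t b) : dimH E ≤ s := by
  apply dimH_le_of_hausdorffMeasure_ne_top
  have hdiam : ∀ (t : ℕ) (b : τ), Metric.ediam (Metric.closedBall (ctr t b) (rad t b)) = ENNReal.ofReal (2 * rad t b) := by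
    intro t b
    rw [Real.closedBall_eq_Icc, Real.ediam_Icc]; congr 1; ring
  have key := Measure.hausdorffMeasure_le_liminf_tsum (s : ℝ) E (l := atTop) (β := ℕ) (ι := fun n => Σ t : ℕ, {b // b ∈ B (t + n)})
    (fun n => ENNReal.ofReal (r n)) (by
      have := ENNReal.tendsto_ofReal hr
      simpa using this) (fun n i => Metric.closedBall (ctr (i.1 + n) i.2.1) (rad (i.1 + n) i.2.1))
      (by
        filter_upwards [eventually_ge_atTop T] with n hn i
        rw [hdiam]
        exact ENNReal.ofReal_le_ofReal (hBr (i.1 + n) (by omega) n (by omega) _ i.2.2))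
      (by
        filter_upwards with n x hx
        obtain ⟨t, ht, b, hb, hxb⟩ := hE x hx n
        obtain ⟨k, rfl⟩ := Nat.exists_eq_add_of_le' ht
        exact Set.mem_iUnion.2 ⟨⟨k, b, hb⟩, by simpa [Real.dist_eq] using hxb⟩)
  have h2 : Tendsto (fun n => ∑' t, u (t + n)) atTop (nhds 0) := ENNReal.tendsto_sum_nat_add u hu
  have h3 : Measure.hausdorffMeasure (s : ℝ) E ≤ 0 := by
    refine key.trans ?_
    rw [← h2.liminf_eq]
    refine liminf_le_liminf ?_
    · filter_upwards [eventually_ge_atTop T] with n hn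
      rw [ENNReal.tsum_sigma']
      apply ENNReal.tsum_le_tsum
      intro t
      refine le_trans ?_ (hBu (t + n) (by omega))
      simp only [hdiam]
      rw [Finset.tsum_subtype (B (t + n)) (fun b => ENNReal.ofReal (2 * rad (t + n) b) ^ (s : ℝ))]
  exact ne_top_of_le_ne_top ENNReal.zero_ne_top h3

lemma ev_Sh (d : ℕ) (M W κ : ℝ) (hd : 1 ≤ d) (hκ : 0 < κ) (hW : 2 * κ < W) : ∀ᶠ H : ℝ in atTop, ∀ (P : ℤ[X]) (x : ℝ),
    |x| ≤ M → tc P x 0 ≠ 0 → Irreducible P → P.natDegree = d → H ≤ ht P → ht P ≤ 2 * H →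
    |tc P x 0| ≤ ht P ^ (1 - W) → W ≥ 1 → ∃ i : ℕ, i < ⌊W / κ⌋₊ + 1 ∧ i * κ ≤ W ∧ Sh d H κ W (i * κ) x P ∧
      ∃ α ∈ (P.map (Int.castRingHom ℂ)).roots, |x - α.re| ≤ H ^ (-(i * κ)) := by
  filter_upwards [ev_shape d κ hκ, ev_tc d M (κ / 2) (by linarith), ev_ht d M κ hκ, ev_const 2 (κ / 2) (by linarith)]
    with H hshape htc hht ⟨h1, h2⟩ P x hx hne hirr hPd hH hH2 hv hW1
  have h0 : 0 < H := by linarith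
  have hmono : ∀ {a b : ℝ}, a ≤ b → H ^ a ≤ H ^ b := fun h => Real.rpow_le_rpow_of_exponent_le h1.le h
  have hv' : |tc P x 0| ≤ H ^ (1 - W) :=
    hv.trans (Real.rpow_le_rpow_of_nonpos h0 hH (by linarith))
  have hH3 : ht P ≤ H ^ (1 + κ / 2) := by
    rw [Real.rpow_add h0, Real.rpow_one, mul_comm]
    exact hH2.trans (mul_le_mul_of_nonneg_right h2 h0.le)
  obtain ⟨ρ, ⟨α, hα, hxα⟩, hρ⟩ := hshape P x (1 - W) hPd.le (by omega) hne hv'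
  have hmin : 0 ≤ min ρ W := by
    apply le_min _ (by linarith)
    by_contra hneg
    push Not at hneg
    have := hht P x (1 - W + κ) hPd.le hx (fun j => (hρ j).trans (hmono (by
      have : (j:ℝ) * ρ ≤ 0 := mul_nonpos_of_nonneg_of_nonpos (by positivity) hneg.le
      linarith)))
    have h3 := hH.trans this
    nth_rewrite 1 [← Real.rpow_one H] at h3
    rw [Real.rpow_le_rpow_left_iff h1] at h3
    linarith
  obtain ⟨i, hi1, hi2, hi3⟩ := grid hκ hmin (min_le_right ρ W)
  refine ⟨i, hi1, hi2.trans (min_le_right _ _), ⟨hirr, hPd, hH, hH3.trans (hmono (by linarith)), ?_⟩, α, hα,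
    hxα.trans (hmono (by linarith [hi2.trans (min_le_left _ _)]))⟩
  have hU : ∀ j : ℕ, |tc P x j| ≤ H ^ (1 - W + κ + j * W) := by
    intro j
    rcases Nat.eq_zero_or_pos j with rfl | hj
    · refine hv'.trans (hmono ?_); simp; linarith
    · refine (htc P x _ hPd.le hx hH3 j).trans (hmono ?_)
      have : (1:ℝ) * W ≤ j * W := mul_le_mul_of_nonneg_right (by exact_mod_cast hj) (by linarith)
      linarith
  exact cap_shape h1 hκ d i hPd.le hρ hU hi3 (by linarith)

lemma finite_ht (d : ℕ) (B : ℝ) : {P : ℤ[X] | P.natDegree ≤ d ∧ ht P ≤ B}.Finite := by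
  refine (Polynomial.finite_mahlerMeasure_le d (Real.toNNReal B)).subset ?_
  intro P hP
  exact ⟨hP.1, hP.2.trans (Real.le_coe_toNNReal B)⟩

set_option maxHeartbeats 1000000 in
lemma dimH_E (d : ℕ) (σ c M W : ℝ) (s : NNReal) (hσ : 1 / 2 < σ) (hσ1 : σ < 1) (hs : σ < s) (hd : 1 ≤ d) (hW : d + 1 < W * σ)
    (hc : 0 < c) (hM : 0 ≤ M) :
    dimH {x : ℝ | Gen d σ c M x ∧ {P : ℤ[X] | Irreducible P ∧ P.natDegree = d ∧ |tc P x 0| ≤ ht P ^ (1 - W)}.Infinite} ≤ s := by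
  classical
  have hd' : (1:ℝ) ≤ d := by exact_mod_cast hd
  have hW1 : 2 < W := by nlinarith
  obtain ⟨κ, hκ, hκ4, hcount⟩ := ev_count d σ s W hσ hσ1 hs hd hW
  have htend : Tendsto (fun t : ℕ => (2:ℝ) ^ t) atTop atTop := tendsto_pow_atTop_atTop_of_one_lt (by norm_num)
  obtain ⟨T, hT⟩ := eventually_atTop.1 ((htend.eventually (hcount c M hc hM)).and
    ((htend.eventually (ev_Sh d M W κ hd hκ (by linarith))).and (htend.eventually (eventually_gt_atTop 1))))
  set N := ⌊W / κ⌋₊ + 1 with hN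
  have hfin : ∀ (t i : ℕ), {P : ℤ[X] | ∃ x, Gen d σ c M x ∧ Sh d (2 ^ t) κ W (i * κ) x P}.Finite := by
    intro t i
    refine (finite_ht d (((2:ℝ) ^ t) ^ (1 + κ))).subset ?_
    rintro P ⟨x, _, hx⟩
    exact ⟨hx.2.1.le, hx.2.2.2.1⟩
  set Y : ℕ → ℕ → Finset ℤ[X] := fun t i => if i * κ ≤ W then (hfin t i).toFinset else ∅ with hY
  have hYmem : ∀ t i P, P ∈ Y t i ↔ i * κ ≤ W ∧ ∃ x, Gen d σ c M x ∧ Sh d (2 ^ t) κ W (i * κ) x P := by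
    intro t i P
    simp only [hY]
    split_ifs with h <;> simp [h]
  have hYc : ∀ t ≥ T, ∀ i, ((Y t i).card : ℝ) ≤ ((2:ℝ) ^ t) ^ (s * (i * κ) - κ) ∧ ((Y t i).Nonempty → 1 ≤ i * κ) := by
    intro t ht i
    by_cases hi : i * κ ≤ W
    · have hex : ∀ P, ∃ x, P ∈ Y t i → Gen d σ c M x ∧ Sh d (2 ^ t) κ W (i * κ) x P := by
        intro P
        by_cases hP : P ∈ Y t i
        · obtain ⟨_, x, hx⟩ := (hYmem t i P).1 hP
          exact ⟨x, fun _ => hx⟩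
        · exact ⟨0, fun h => absurd h hP⟩
      choose p hp using hex
      exact (hT t ht).1 (Y t i) p (i * κ) (by positivity) hi (fun P hP => (hp P hP).1) (fun P hP => (hp P hP).2)
    · have : Y t i = ∅ := by simp [hY, hi]
      rw [this]; simp; positivity
  set rts : ℤ[X] → Finset ℂ := fun P => (P.map (Int.castRingHom ℂ)).roots.toFinset with hrts
  set B : ℕ → Finset (Σ _ : ℕ, Σ _ : ℤ[X], ℂ) := fun t => (Finset.range N).sigma fun i => (Y t i).sigma fun P => rts P with hB
  have hBmem : ∀ t b, b ∈ B t ↔ b.1 < N ∧ b.2.1 ∈ Y t b.1 ∧ b.2.2 ∈ rts b.2.1 := by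
    intro t b
    simp [hB]
  refine dimH_limsup _ s B (fun _ b => b.2.2.re) (fun t b => ((2:ℝ) ^ t) ^ (-(b.1 * κ))) T (fun t => 2 * (1 / 2) ^ t) ?_ ?_
    (fun t => ENNReal.ofReal (N * (d * 2 ^ (s:ℝ)) * ((2:ℝ) ^ (-κ)) ^ t)) ?_ ?_ ?_
  · have := (tendsto_pow_atTop_nhds_zero_of_lt_one (r := (1/2 : ℝ)) (by norm_num) (by norm_num)).const_mul 2
    simpa using this
  · intro t ht n hn b hb
    obtain ⟨_, hb2, _⟩ := (hBmem t b).1 hb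
    have h1 := (hYc t ht b.1).2 ⟨_, hb2⟩
    have h2 : ((2:ℝ) ^ t) ^ (-(b.1 * κ)) ≤ ((2:ℝ) ^ t) ^ (-1 : ℝ) :=
      Real.rpow_le_rpow_of_exponent_le (one_le_pow₀ (by norm_num)) (by linarith)
    rw [Real.rpow_neg_one, ← inv_pow] at h2
    have h3 : ((2:ℝ)⁻¹) ^ t ≤ (1 / 2) ^ n := by
      rw [one_div]; exact pow_le_pow_of_le_one (by norm_num) (by norm_num) hn
    show 2 * ((2:ℝ) ^ t) ^ (-(b.1 * κ)) ≤ 2 * (1 / 2) ^ n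
    linarith
  · apply Summable.tsum_ofReal_ne_top
    apply Summable.mul_left
    apply summable_geometric_of_lt_one (by positivity)
    exact Real.rpow_lt_one_of_one_lt_of_neg (by norm_num) (by linarith)
  · intro t ht
    have hH1 := (hT t ht).2.2
    obtain ⟨H, hH⟩ : ∃ H : ℝ, H = 2 ^ t := ⟨_, rfl⟩
    have h0 : 0 < H := by rw [hH]; positivity
    have hterm : ∀ b : Σ _ : ℕ, Σ _ : ℤ[X], ℂ, ENNReal.ofReal (2 * ((2:ℝ) ^ t) ^ (-(b.1 * κ))) ^ (s:ℝ)
        = ENNReal.ofReal (2 ^ (s:ℝ) * H ^ (-(s * (b.1 * κ)))) := by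
      intro b
      rw [ENNReal.ofReal_rpow_of_nonneg (by positivity) (by positivity), ← hH, Real.mul_rpow (by norm_num) (by positivity),
        ← Real.rpow_mul h0.le]
      congr 3; ring
    rw [Finset.sum_congr rfl (fun b _ => hterm b), ← ENNReal.ofReal_sum_of_nonneg (fun _ _ => by positivity)]
    apply ENNReal.ofReal_le_ofReal
    rw [hB, Finset.sum_sigma]
    have hi : ∀ i ∈ Finset.range N, ∑ b ∈ (Y t i).sigma (fun P => rts P), 2 ^ (s:ℝ) * H ^ (-(s * (((⟨i, b⟩ : Σ _ : ℕ, Σ _ : ℤ[X], ℂ).1 : ℕ) * κ)))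
        ≤ (d * 2 ^ (s:ℝ)) * ((2:ℝ) ^ (-κ)) ^ t := by
      intro i _
      simp only [Finset.sum_const, nsmul_eq_mul]
      have hcard : (((Y t i).sigma (fun P => rts P)).card : ℝ) ≤ d * H ^ (s * (i * κ) - κ) := by
        rw [Finset.card_sigma]
        have h3 : ∀ P ∈ Y t i, (rts P).card ≤ d := by
          intro P hP
          obtain ⟨_, x, _, hx⟩ := (hYmem t i P).1 hP
          rw [← hx.2.1]
          refine (Multiset.toFinset_card_le _).trans ((card_roots' _).trans natDegree_map_le)
        have h4 := Finset.sum_le_card_nsmul (Y t i) _ _ h3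
        have h5 : ((∑ P ∈ Y t i, (rts P).card : ℕ) : ℝ) ≤ (Y t i).card * d := by exact_mod_cast h4
        refine h5.trans ?_
        rw [mul_comm]
        have := (hYc t ht i).1
        rw [← hH] at this
        exact mul_le_mul_of_nonneg_left this (by positivity)
      have hk : ((2:ℝ) ^ (-κ)) ^ t = H ^ (-κ) := by
        rw [hH, ← Real.rpow_natCast, ← Real.rpow_natCast, ← Real.rpow_mul (by norm_num), ← Real.rpow_mul (by norm_num), mul_comm]
      rw [hk]
      refine (mul_le_mul_of_nonneg_right hcard (by positivity)).trans (le_of_eq ?_)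
      have : H ^ (-κ) = H ^ (s * (i * κ) - κ) * H ^ (-(s * (i * κ))) := by
        rw [← Real.rpow_add h0]; congr 1; ring
      rw [this]; ring
    refine (Finset.sum_le_sum hi).trans (le_of_eq ?_)
    simp; ring
  · rintro x ⟨hG, hinf⟩ n
    set n' := max n T with hn'
    obtain ⟨P, hP, hPn⟩ := hinf.exists_notMem_finite (finite_ht d (2 ^ n'))
    obtain ⟨hirr, hPd, hv⟩ := hP
    have hbig : (2:ℝ) ^ n' < ht P := by
      by_contra h
      exact hPn ⟨hPd.le, not_lt.1 h⟩
    obtain ⟨t, ht1, ht2⟩ := exists_nat_pow_near (one_le_ht hirr.ne_zero) (by norm_num : (1:ℝ) < 2)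
    have htn : n' ≤ t := by
      by_contra h
      push Not at h
      have : (2:ℝ) ^ (t + 1) ≤ 2 ^ n' := pow_le_pow_right₀ (by norm_num) h
      linarith
    obtain ⟨i, hi1, hi2, hS, α, hα, hxα⟩ := (hT t ((le_max_right _ _).trans htn)).2.1 P x hG.1 (hG.2.1 P hirr.ne_zero) hirr hPd
      ht1 (by rw [pow_succ] at ht2; linarith) hv (by linarith)
    refine ⟨t, (le_max_left _ _).trans htn, ⟨i, P, α⟩, ?_, hxα⟩
    rw [hBmem]
    refine ⟨hi1, (hYmem t i P).2 ⟨hi2, x, hG, hS⟩, ?_⟩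
    simpa [hrts] using hα

end Bern

namespace Bern
open Polynomial Filter

/-- points very well approximated by polynomial values of degree at most `d` -/
def Bad (d : ℕ) (W M : ℝ) : Set ℝ :=
  {x | |x| ≤ M ∧ {R : ℤ[X] | R ≠ 0 ∧ R.natDegree ≤ d ∧ |tc R x 0| ≤ ht R ^ (1 - W)}.Infinite}

lemma ht_C (a : ℤ) : ht (C a) = |(a:ℝ)| := by
  rw [ht, map_C, mahlerMeasure_const]
  simp

lemma bound_fin (F : Set ℤ[X]) (hF : F.Finite) (f : ℤ[X] → ℝ) : ∃ K : ℝ, 1 ≤ K ∧ ∀ R ∈ F, f R ≤ K := by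
  obtain ⟨K, hK⟩ := (hF.image f).bddAbove
  exact ⟨max K 1, le_max_right _ _, fun R hR => (hK ⟨R, hR, rfl⟩).trans (le_max_left _ _)⟩

lemma alg_countable : {x : ℝ | ∃ R : ℤ[X], R ≠ 0 ∧ tc R x 0 = 0}.Countable := by
  refine Set.Countable.mono ?_ (Algebraic.countable ℤ ℝ)
  rintro x ⟨R, hR, hx⟩
  refine ⟨R, hR, ?_⟩
  rw [tc_zero, rp, eval_map] at hx
  rw [aeval_def]
  exact hx

lemma exists_c (d : ℕ) (σ σ' M x : ℝ) (hσ : 0 < σ) (hσ1 : σ < 1) (hσ' : σ < σ') (hx : |x| ≤ M) (htr : ∀ R : ℤ[X], R ≠ 0 → tc R x 0 ≠ 0)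
    (hB : ∀ g < d, x ∉ Bad g ((g + 1) / σ') M) : ∃ j : ℕ, Gen d σ (1 / (j + 1)) M x := by
  have hfin : {R : ℤ[X] | R ≠ 0 ∧ R.natDegree < d ∧ |tc R x 0| ≤ ht R ^ (1 - ((R.natDegree : ℝ) + 1) / σ')}.Finite := by
    have : {R : ℤ[X] | R ≠ 0 ∧ R.natDegree < d ∧ |tc R x 0| ≤ ht R ^ (1 - ((R.natDegree : ℝ) + 1) / σ')} ⊆
        ⋃ g ∈ Finset.range d, {R : ℤ[X] | R ≠ 0 ∧ R.natDegree ≤ g ∧ |tc R x 0| ≤ ht R ^ (1 - ((g : ℝ) + 1) / σ')} := by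
      rintro R ⟨h1, h2, h3⟩
      simp only [Set.mem_iUnion]
      exact ⟨R.natDegree, Finset.mem_range.2 h2, h1, le_rfl, h3⟩
    refine Set.Finite.subset (Set.Finite.biUnion (Finset.finite_toSet _) ?_) this
    intro g hg
    have := hB g (by simpa using hg)
    by_contra hinf
    exact this ⟨hx, hinf⟩
  obtain ⟨K, hK1, hK⟩ := bound_fin _ hfin (fun R => |tc R x 0|⁻¹)
  obtain ⟨j, hj⟩ := exists_nat_ge K
  refine ⟨j, hx, htr, ?_⟩
  intro R hR hRd
  have hht := one_le_ht hR
  have hg0 : (0:ℝ) ≤ R.natDegree := by positivity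
  have hexp : 1 - ((R.natDegree : ℝ) + 1) / σ ≤ 0 := by
    rw [sub_nonpos, le_div_iff₀ hσ]; linarith
  have hpos : 0 < |tc R x 0| := abs_pos.2 (htr R hR)
  have hj1 : 1 / ((j:ℝ) + 1) ≤ 1 := by
    rw [div_le_one (by positivity)]; linarith [(Nat.cast_nonneg j : (0:ℝ) ≤ j)]
  by_cases hRF : |tc R x 0| ≤ ht R ^ (1 - ((R.natDegree : ℝ) + 1) / σ')
  · have h1 := hK R ⟨hR, hRd, hRF⟩
    have h2 : ht R ^ (1 - ((R.natDegree : ℝ) + 1) / σ) ≤ 1 := Real.rpow_le_one_of_one_le_of_nonpos hht hexp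
    have h3 : 1 / ((j:ℝ) + 1) ≤ |tc R x 0| := by
      rw [one_div, inv_le_comm₀ (by positivity) hpos]; linarith
    calc _ ≤ 1 / ((j:ℝ) + 1) * 1 := mul_le_mul_of_nonneg_left h2 (by positivity)
      _ ≤ _ := by rw [mul_one]; exact h3
  · push Not at hRF
    have h2 : ht R ^ (1 - ((R.natDegree : ℝ) + 1) / σ) ≤ ht R ^ (1 - ((R.natDegree : ℝ) + 1) / σ') := by
      apply Real.rpow_le_rpow_of_exponent_le hht
      have : ((R.natDegree : ℝ) + 1) / σ' ≤ ((R.natDegree : ℝ) + 1) / σ := by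
        apply div_le_div_of_nonneg_left <;> linarith
      linarith
    have h3 := ht_nonneg R
    calc _ ≤ 1 * ht R ^ (1 - ((R.natDegree : ℝ) + 1) / σ) := mul_le_mul_of_nonneg_right hj1 (by positivity)
      _ ≤ _ := by rw [one_mul]; exact h2.trans hRF.le

lemma gen_prod {d : ℕ} {σ c M x : ℝ} (hσ : 0 < σ) (hc : 0 < c) (hG : Gen d σ c M x) {R A B : ℤ[X]} (hR : R ≠ 0) (hAB : R = A * B)
    (hA : A.natDegree < d) (hB : B.natDegree < d) : c ^ 2 * ht R ^ (1 - ((d:ℝ) + 1) / σ) ≤ |tc R x 0| := by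
  have hA0 : A ≠ 0 := by rintro rfl; simp at hAB; exact hR hAB
  have hB0 : B ≠ 0 := by rintro rfl; simp at hAB; exact hR hAB
  have key : ∀ A : ℤ[X], A ≠ 0 → A.natDegree < d → c * ht A ^ (1 - ((d:ℝ) + 1) / σ) ≤ |tc A x 0| := by
    intro A hA0 hA
    refine le_trans ?_ (hG.2.2 A hA0 hA)
    apply mul_le_mul_of_nonneg_left _ hc.le
    apply Real.rpow_le_rpow_of_exponent_le (one_le_ht hA0)
    have : (A.natDegree : ℝ) ≤ d := by exact_mod_cast hA.le
    have : ((A.natDegree : ℝ) + 1) / σ ≤ (d + 1) / σ := by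
      apply div_le_div_of_nonneg_right _ hσ.le; linarith
    linarith
  rw [hAB, ht_mul, tc_mul_zero, abs_mul, Real.mul_rpow (ht_nonneg _) (ht_nonneg _)]
  have h1 := key A hA0 hA
  have h2 := key B hB0 hB
  calc _ = (c * ht A ^ (1 - ((d:ℝ) + 1) / σ)) * (c * ht B ^ (1 - ((d:ℝ) + 1) / σ)) := by ring
    _ ≤ _ := mul_le_mul h1 h2 (by have := ht_nonneg B; positivity) (abs_nonneg _)

lemma irr_of_large {d : ℕ} (hd : 1 ≤ d) {R : ℤ[X]} (hR : R ≠ 0) (hRd : R.natDegree ≤ d)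
    (h : ∀ A B : ℤ[X], R = A * B → ¬ (A.natDegree < d ∧ B.natDegree < d)) :
    ∃ (a : ℤ) (P : ℤ[X]), a ≠ 0 ∧ R = C a * P ∧ Irreducible P ∧ P.natDegree = d := by
  have hRdeg : R.natDegree = d := by
    by_contra hne
    exact h R 1 (by simp) ⟨by omega, by simp; omega⟩
  have hc : R.content ≠ 0 := by rwa [Ne, content_eq_zero_iff]
  have hprim := R.isPrimitive_primPart
  have hPd : R.primPart.natDegree = d := by rw [natDegree_primPart, hRdeg]
  refine ⟨R.content, R.primPart, hc, R.eq_C_content_mul_primPart, ?_, hPd⟩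
  have unit : ∀ U V : ℤ[X], R.primPart = U * V → U.natDegree = 0 → IsUnit U := by
    intro U V hUV hU
    rw [eq_C_of_natDegree_eq_zero hU]
    apply IsUnit.map
    apply hprim
    rw [← eq_C_of_natDegree_eq_zero hU]
    exact ⟨V, hUV⟩
  refine ⟨?_, ?_⟩
  · intro hu
    have := natDegree_eq_zero_of_isUnit hu
    omega
  · intro U V hUV
    have h0 : R.primPart ≠ 0 := hprim.ne_zero
    have hU0 : U ≠ 0 := by rintro rfl; simp at hUV; exact h0 hUV
    have hV0 : V ≠ 0 := by rintro rfl; simp at hUV; exact h0 hUV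
    have hdeg : U.natDegree + V.natDegree = d := by rw [← natDegree_mul hU0 hV0, ← hUV, hPd]
    have := h (C R.content * U) V (by rw [mul_assoc, ← hUV]; exact R.eq_C_content_mul_primPart)
    rw [natDegree_C_mul hc] at this
    by_cases hV : V.natDegree = 0
    · right; exact unit V U (by rw [hUV, mul_comm]) hV
    · left; apply unit U V hUV; omega

lemma gen_inf {d : ℕ} {σ c M W x : ℝ} (hσ : 0 < σ) (hσ1 : σ < 1) (hc : 0 < c) (hd : 1 ≤ d) (hW : d + 1 < W * σ) (hG : Gen d σ c M x)
    (hx : x ∈ Bad d W M) :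
    {P : ℤ[X] | Irreducible P ∧ P.natDegree = d ∧ |tc P x 0| ≤ ht P ^ (1 - W)}.Infinite := by
  intro hfin
  have hd' : (1:ℝ) ≤ d := by exact_mod_cast hd
  have hW1 : 1 < W := by nlinarith
  obtain ⟨K2, hK21, hK2⟩ := bound_fin _ hfin (fun P => ht P / |tc P x 0|)
  have hε : 0 < W - (d + 1) / σ := by
    rw [sub_pos, div_lt_iff₀ hσ]; exact hW
  obtain ⟨K, hK⟩ := eventually_atTop.1 (ev_const (2 * (c ^ 2)⁻¹) _ hε)
  apply hx.2
  refine (finite_ht d (max K K2)).subset ?_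
  rintro R ⟨hR, hRd, hv⟩
  refine ⟨hRd, ?_⟩
  by_contra hlt
  push Not at hlt
  have h1 := hK (ht R) ((le_max_left _ _).trans hlt.le)
  have hpos : 0 < ht R := by linarith [one_le_ht hR]
  have hirr := irr_of_large hd hR hRd (by
    rintro A B hAB ⟨hA, hB⟩
    have h2 := (gen_prod hσ hc hG hR hAB hA hB).trans hv
    have h3 : ht R ^ (1 - W) * ht R ^ (W - (d + 1) / σ) = ht R ^ (1 - ((d:ℝ) + 1) / σ) := by
      rw [← Real.rpow_add hpos]; congr 1; ring
    have h4 : 0 < ht R ^ (1 - W) := by positivity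
    rw [← h3] at h2
    have h5 : c ^ 2 * ht R ^ (W - (d + 1) / σ) * ht R ^ (1 - W) ≤ 1 * ht R ^ (1 - W) := by linarith
    have h6 := le_of_mul_le_mul_right h5 h4
    have h7 := mul_le_mul_of_nonneg_left h1.2 (by positivity : 0 ≤ c ^ 2)
    have h8 : c ^ 2 * (2 * (c ^ 2)⁻¹) = 2 := by field_simp
    linarith)
  obtain ⟨a, P, ha, hRP, hPi, hPd⟩ := hirr
  have ha1 : (1:ℝ) ≤ |(a:ℝ)| := by exact_mod_cast Int.one_le_abs ha
  have hhtR : ht R = |(a:ℝ)| * ht P := by rw [hRP, ht_mul, ht_C]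
  have htcR : |tc R x 0| = |(a:ℝ)| * |tc P x 0| := by rw [hRP, tc_C_mul, abs_mul]
  have hP1 := one_le_ht hPi.ne_zero
  have hPpos : 0 < |tc P x 0| := abs_pos.2 (hG.2.1 P hPi.ne_zero)
  have hPv : |tc P x 0| ≤ ht P ^ (1 - W) := by
    calc |tc P x 0| ≤ |(a:ℝ)| * |tc P x 0| := by nlinarith
      _ ≤ ht R ^ (1 - W) := by rw [← htcR]; exact hv
      _ ≤ _ := by
        apply Real.rpow_le_rpow_of_nonpos (by linarith) _ (by linarith)
        rw [hhtR]; nlinarith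
  have h9 := hK2 P ⟨hPi, hPd, hPv⟩
  have h10 : |tc R x 0| ≤ 1 := hv.trans (Real.rpow_le_one_of_one_le_of_nonpos (one_le_ht hR) (by linarith))
  have h11 : ht R ≤ ht P / |tc P x 0| := by
    rw [le_div_iff₀ hPpos, hhtR]
    rw [htcR] at h10
    nlinarith
  have := (le_max_right K K2)
  linarith

theorem dimH_Bad (s : NNReal) (hs : (1:ℝ) / 2 < s) (hs1 : (s:ℝ) < 1) : ∀ (d : ℕ) (W M : ℝ), d + 1 < W * s → 0 ≤ M → dimH (Bad d W M) ≤ s := by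
  intro d
  induction d using Nat.strong_induction_on with
  | _ d ih =>
  intro W M hW hM
  have hd0 : (0:ℝ) ≤ d := by positivity
  have hW1 : 1 < W := by nlinarith
  rcases Nat.eq_zero_or_pos d with rfl | hd
  · have : Bad 0 W M = ∅ := by
      rw [Set.eq_empty_iff_forall_notMem]
      rintro x ⟨_, hx⟩
      apply hx
      refine (finite_ht 0 1).subset ?_
      rintro R ⟨hR, hRd, hv⟩
      refine ⟨hRd, ?_⟩
      have h1 : |tc R x 0| ≤ 1 := hv.trans (Real.rpow_le_one_of_one_le_of_nonpos (one_le_ht hR) (by linarith))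
      rw [tc_natDegree R x 0 hRd] at h1
      rw [eq_C_of_natDegree_le_zero hRd, ht_C]
      exact h1
    rw [this]; simp
  · obtain ⟨σ, hσa, hσs⟩ : ∃ σ : ℝ, max (1 / 2) ((d + 1) / W) < σ ∧ σ < s := exists_between (by
      apply max_lt hs
      rw [div_lt_iff₀ (by linarith)]; linarith)
    have hσ : 1 / 2 < σ := (le_max_left _ _).trans_lt hσa
    have hσW : d + 1 < W * σ := by
      have := (le_max_right _ _).trans_lt hσa
      rw [div_lt_iff₀ (by linarith)] at this; linarith
    obtain ⟨σ', h1, h2⟩ := exists_between hσs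
    have hsub : Bad d W M ⊆ {x : ℝ | ∃ R : ℤ[X], R ≠ 0 ∧ tc R x 0 = 0} ∪ ((⋃ g : Fin d, Bad g ((g + 1) / σ') M) ∪
        ⋃ j : ℕ, {x : ℝ | Gen d σ (1 / (j + 1)) M x ∧ {P : ℤ[X] | Irreducible P ∧ P.natDegree = d ∧ |tc P x 0| ≤ ht P ^ (1 - W)}.Infinite}) := by
      intro x hx
      by_cases hA : ∃ R : ℤ[X], R ≠ 0 ∧ tc R x 0 = 0
      · exact Or.inl hA
      push Not at hA
      right
      by_cases hB : ∃ g : Fin d, x ∈ Bad g ((g + 1) / σ') M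
      · left; exact Set.mem_iUnion.2 hB
      push Not at hB
      right
      obtain ⟨j, hj⟩ := exists_c d σ σ' M x (by linarith) (by linarith) h1 hx.1 hA (fun g hg => hB ⟨g, hg⟩)
      refine Set.mem_iUnion.2 ⟨j, hj, gen_inf (by linarith) (by linarith) (by positivity) hd hσW hj hx⟩
    refine (dimH_mono hsub).trans ?_
    rw [dimH_union, dimH_union, dimH_iUnion, dimH_iUnion]
    refine max_le ?_ (max_le ?_ ?_)
    · rw [alg_countable.dimH_zero]; simp
    · refine iSup_le fun g => ih g g.2 _ _ ?_ hM
      rw [div_mul_eq_mul_div, lt_div_iff₀ (by linarith)]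
      have : (0:ℝ) ≤ (g:ℕ) := by positivity
      nlinarith
    · refine iSup_le fun j => dimH_E d σ _ M W s hσ (by linarith) hσs hd hσW (by positivity) hM

end Bern

namespace Bern
open Polynomial Filter

lemma card_quot {m : ℕ} (A : Matrix (Fin m) (Fin m) ℤ) (hA : A.det ≠ 0) :
    Nat.card ((Fin m → ℤ) ⧸ LinearMap.range A.mulVecLin) = A.det.natAbs := by
  have hinj : Function.Injective A.mulVecLin := by
    rw [← LinearMap.ker_eq_bot, LinearMap.ker_eq_bot']
    intro v hv
    exact Matrix.eq_zero_of_mulVec_eq_zero hA hv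
  rw [← Submodule.natAbs_det_equiv (LinearMap.range A.mulVecLin) (LinearEquiv.ofInjective A.mulVecLin hinj)]
  congr 1
  rw [← LinearMap.det_toLin' A]
  rfl

lemma kernel_small {m N : ℕ} (A : Matrix (Fin m) (Fin N) ℤ) (hrank : ∃ I : Fin m → Fin N, (A.submatrix id I).det ≠ 0)
    (D T : ℕ) (hD : ∀ I : Fin m → Fin N, (A.submatrix id I).det.natAbs ≤ D) (hT : D < (T + 1) ^ (N - m)) :
    ∃ a : Fin N → ℤ, a ≠ 0 ∧ A.mulVec a = 0 ∧ ∀ l, |a l| ≤ N * T := by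
  classical
  obtain ⟨I0, hI0⟩ := hrank
  have : Nonempty (Fin m → Fin N) := ⟨I0⟩
  obtain ⟨I, hI⟩ := Finite.exists_max (fun I : Fin m → Fin N => (A.submatrix id I).det.natAbs)
  set B := A.submatrix id I with hB
  have hdet : B.det ≠ 0 := by
    intro h
    have := hI I0
    rw [h] at this
    simp at this
    exact hI0 this
  have hinj : Function.Injective I := by
    intro i j hij
    by_contra hne
    apply hdet
    apply Matrix.det_zero_of_column_eq hne
    intro k
    simp [hB, hij]
  let Fr := {l : Fin N // l ∉ Set.range I}
  have hcardF : Fintype.card Fr = N - m := by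
    have h1 : Fintype.card {l : Fin N // l ∈ Set.range I} = m := by
      rw [Fintype.card_congr (Equiv.ofInjective I hinj).symm]; simp
    have := Fintype.card_subtype_compl (fun l : Fin N => l ∈ Set.range I)
    rw [h1, Fintype.card_fin] at this
    convert this using 1
  let ext : (Fr → Fin (T + 1)) → Fin N → ℤ := fun b l => if h : l ∈ Set.range I then 0 else ((b ⟨l, h⟩ : ℕ) : ℤ)
  have hextI : ∀ b i, ext b (I i) = 0 := fun b i => by simp [ext]
  let f : (Fr → Fin (T + 1)) → (Fin m → ℤ) ⧸ LinearMap.range B.mulVecLin := fun b => Submodule.Quotient.mk (A.mulVec (ext b))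
  have hcq := card_quot B hdet
  have hdpos : 0 < B.det.natAbs := Int.natAbs_pos.2 hdet
  have : Finite ((Fin m → ℤ) ⧸ LinearMap.range B.mulVecLin) := Nat.finite_of_card_ne_zero (by omega)
  have := Fintype.ofFinite ((Fin m → ℤ) ⧸ LinearMap.range B.mulVecLin)
  obtain ⟨b, b', hne, hf⟩ := Fintype.exists_ne_map_eq_of_card_lt f (by
    rw [← Nat.card_eq_fintype_card, hcq, Fintype.card_fun, hcardF, Fintype.card_fin]
    exact (hD I).trans_lt hT)
  rw [Submodule.Quotient.eq, ← Matrix.mulVec_sub] at hf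
  obtain ⟨w, hw⟩ := hf
  rw [Matrix.mulVecLin_apply] at hw
  set e := ext b - ext b' with he
  have heI : ∀ i, e (I i) = 0 := fun i => by simp [he, hextI]
  have heT : ∀ l, |e l| ≤ T := by
    intro l
    by_cases h : l ∈ Set.range I
    · obtain ⟨i, rfl⟩ := h
      rw [heI]; simp
    · have : e l = ((b ⟨l, h⟩ : ℕ) : ℤ) - ((b' ⟨l, h⟩ : ℕ) : ℤ) := by
        simp only [he, Pi.sub_apply, ext, dif_neg h]
      rw [this, abs_le]
      have := (b ⟨l, h⟩).2
      have := (b' ⟨l, h⟩).2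
      constructor <;> omega
  set w' : Fin N → ℤ := ∑ i, w i • Pi.single (I i) 1 with hw'
  have hw'I : ∀ i, w' (I i) = w i := by
    intro i
    simp only [hw', Finset.sum_apply, Pi.smul_apply, smul_eq_mul]
    rw [Finset.sum_eq_single i]
    · simp
    · intro j _ hj
      rw [Pi.single_eq_of_ne (fun h => hj (hinj h).symm)]; simp
    · simp
  have hw'F : ∀ l, l ∉ Set.range I → w' l = 0 := by
    intro l hl
    simp only [hw', Finset.sum_apply, Pi.smul_apply, smul_eq_mul]
    apply Finset.sum_eq_zero
    intro i _
    rw [Pi.single_eq_of_ne (fun h => hl ⟨i, h.symm⟩)]; simp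
  have hAw : A.mulVec w' = B.mulVec w := by
    rw [hw', Matrix.mulVec_sum]
    simp only [Matrix.mulVec_smul, Matrix.mulVec_single_one]
    ext k
    simp [Matrix.mulVec, dotProduct, hB, mul_comm]
  have hwb : ∀ i, |w i| ≤ N * T := by
    intro i
    have h1 : B.det • w = Matrix.cramer B (A.mulVec e) := by
      rw [← hw, Matrix.cramer_eq_adjugate_mulVec, Matrix.mulVec_mulVec, Matrix.adjugate_mul, Matrix.smul_mulVec, Matrix.one_mulVec]
    have h2 : A.mulVec e = ∑ l, e l • A.col l := by
      ext k
      simp [Matrix.mulVec, dotProduct, mul_comm]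
    have h3 : B.det * w i = ∑ l, e l * (A.submatrix id (Function.update I i l)).det := by
      have := congrFun h1 i
      rw [h2, map_sum] at this
      simp only [map_smul, Finset.sum_apply, Pi.smul_apply, smul_eq_mul] at this
      rw [this]
      refine Finset.sum_congr rfl fun l _ => ?_
      rw [Matrix.cramer_apply]
      congr 2
      ext k c
      by_cases hc : c = i
      · subst hc; simp
      · simp [hc, hB]
    have h4 : |B.det| * |w i| ≤ |B.det| * (N * T) := by
      rw [← abs_mul, h3]
      refine (Finset.abs_sum_le_sum_abs _ _).trans ?_
      have : ∀ l ∈ Finset.univ, |e l * (A.submatrix id (Function.update I i l)).det| ≤ T * |B.det| := by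
        intro l _
        rw [abs_mul]
        refine mul_le_mul (heT l) ?_ (abs_nonneg _) (by positivity)
        have := hI (Function.update I i l)
        rw [Int.abs_eq_natAbs, Int.abs_eq_natAbs]
        exact_mod_cast this
      refine (Finset.sum_le_card_nsmul _ _ _ this).trans (le_of_eq ?_)
      simp; ring
    exact le_of_mul_le_mul_left h4 (abs_pos.2 hdet)
  refine ⟨e - w', ?_, ?_, ?_⟩
  · intro h0
    apply hne
    funext ⟨l, hl⟩
    have := congrFun h0 l
    rw [Pi.sub_apply, hw'F l hl, sub_zero] at this
    have h5 : e l = ((b ⟨l, hl⟩ : ℕ) : ℤ) - ((b' ⟨l, hl⟩ : ℕ) : ℤ) := by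
      simp only [he, Pi.sub_apply, ext, dif_neg hl]
    rw [h5] at this
    apply Fin.ext
    have h6 : (0 : Fin N → ℤ) l = 0 := rfl
    omega
  · rw [Matrix.mulVec_sub, hAw, hw, sub_self]
  · intro l
    by_cases h : l ∈ Set.range I
    · obtain ⟨i, rfl⟩ := h
      rw [Pi.sub_apply, heI, hw'I, zero_sub, abs_neg]
      exact hwb i
    · rw [Pi.sub_apply, hw'F l h, sub_zero]
      refine (heT l).trans ?_
      have : 0 < N := l.pos
      have : (1:ℤ) ≤ N := by exact_mod_cast this
      nlinarith [(Int.natCast_nonneg T)]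

lemma span_cols {m N : ℕ} (col : Fin N → Fin m → ℚ) (h : ∀ b : Fin m → ℚ, (∀ l, ∑ i, b i * col l i = 0) → b = 0) :
    Submodule.span ℚ (Set.range col) = ⊤ := by
  by_contra hne
  obtain ⟨f, hf0, hf⟩ := Submodule.exists_le_ker_of_lt_top _ (lt_top_iff_ne_top.2 hne)
  apply hf0
  have key : ∀ v : Fin m → ℚ, f v = ∑ i, f (Pi.single i 1) * v i := by
    intro v
    rw [LinearMap.pi_apply_eq_sum_univ f v]
    refine Finset.sum_congr rfl fun i _ => ?_
    rw [smul_eq_mul, mul_comm]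
    congr 2
    ext j
    simp [Pi.single_apply, eq_comm]
  have h0 := h (fun i => f (Pi.single i 1)) (by
    intro l
    rw [← key]
    exact hf (Submodule.subset_span ⟨l, rfl⟩))
  ext i
  simpa using congrFun h0 i

lemma exists_minor {m N : ℕ} (A : Matrix (Fin m) (Fin N) ℤ)
    (h : ∀ b : Fin m → ℚ, (∀ l, ∑ i, b i * (A i l : ℚ) = 0) → b = 0) :
    ∃ I : Fin m → Fin N, (A.submatrix id I).det ≠ 0 := by
  have hs := span_cols (fun l i => (A i l : ℚ)) h
  obtain ⟨f, hf1, hf2, hf3⟩ := Submodule.exists_fun_fin_finrank_span_eq ℚ (Set.range (fun l i => (A i l : ℚ) : Fin N → Fin m → ℚ))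
  have hr : Module.finrank ℚ (Submodule.span ℚ (Set.range (fun l i => (A i l : ℚ) : Fin N → Fin m → ℚ))) = m := by
    rw [hs]; simp
  have hex : ∃ g : Fin m → Fin m → ℚ, (∀ i, g i ∈ Set.range (fun l i => (A i l : ℚ) : Fin N → Fin m → ℚ)) ∧ LinearIndependent ℚ g := by
    refine ⟨fun i => f (Fin.cast hr.symm i), fun i => hf1 _, ?_⟩
    exact hf3.comp _ (Fin.cast_injective _)
  obtain ⟨g, hg1, hg2⟩ := hex
  choose I hI using hg1
  refine ⟨I, ?_⟩
  intro h0
  have h1 : (Matrix.of g).det = 0 := by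
    have h2 : ((A.submatrix id I).map (Int.castRingHom ℚ)).det = 0 := by
      have := RingHom.map_det (Int.castRingHom ℚ) (A.submatrix id I)
      rw [h0] at this
      simpa using this.symm
    rw [← Matrix.det_transpose, ← h2]
    congr 1
    ext i j
    have := congrFun (hI j) i
    simp [← this]
  have h3 : IsUnit (Matrix.of g) := Matrix.linearIndependent_rows_iff_isUnit.1 hg2
  rw [Matrix.isUnit_iff_isUnit_det, h1] at h3
  simp at h3

end Bern

namespace Bern
open Polynomial Filter

/-- Hankel matrix. -/
def hank (p : ℕ → ℤ) (j N : ℕ) : Matrix (Fin (j + 1)) (Fin N) ℤ := Matrix.of fun i l => p (i + l)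

lemma minor_bound (n j : ℕ) (hj : 2 * j < n) (p : ℕ → ℤ) (x q δ M : ℝ) (hx : |x| ≤ M) (hM : 1 ≤ M) (hδ : 0 ≤ δ) (hδ1 : δ ≤ 1)
    (hq : 1 ≤ q) (hp : ∀ i ≤ n, |p i - q * x ^ i| ≤ δ) (I : Fin (j + 1) → Fin (n - j + 1)) :
    |((((hank p j (n - j + 1)).submatrix id I).det : ℤ) : ℝ)| ≤ (j + 1).factorial * (2 * q * M ^ n * ((1 + M) * δ) ^ j) := by
  set A : Matrix (Fin (j + 1)) (Fin (j + 1)) ℝ := Matrix.of fun i c => (p (i + I c) : ℝ) with hA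
  have hdet : ((((hank p j (n - j + 1)).submatrix id I).det : ℤ) : ℝ) = A.det := by
    have := RingHom.map_det (Int.castRingHom ℝ) ((hank p j (n - j + 1)).submatrix id I)
    rw [eq_intCast] at this
    rw [this]
    congr 1
  set B : Matrix (Fin (j + 1)) (Fin (j + 1)) ℝ := Matrix.of (Fin.cons (A 0) fun i => fun c => A i.succ c - x * A i.castSucc c) with hB
  have hAB : A.det = B.det := by
    apply Matrix.det_eq_of_forall_row_eq_smul_add_pred (fun _ => x)
    · intro c; simp [hB]
    · intro i c; simp [hB]
  rw [hdet, hAB]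
  have hb := det_bound B (Fin.cons (2 * q * M ^ n) fun _ => (1 + M) * δ) (fun _ => 1) (by
    intro i c
    rw [mul_one]
    have hc := (I c).2
    refine Fin.cases ?_ (fun i => ?_) i
    · simp only [hB, Matrix.of_apply, Fin.cons_zero, hA]
      have h1 := hp (I c) (by omega)
      have h2 : |q * x ^ (I c : ℕ)| ≤ q * M ^ n := by
        rw [abs_mul, abs_pow, abs_of_nonneg (by linarith : 0 ≤ q)]
        apply mul_le_mul_of_nonneg_left _ (by linarith)
        exact (pow_le_pow_left₀ (abs_nonneg _) hx _).trans (pow_le_pow_right₀ hM (by omega))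
      have h3 : 1 ≤ q * M ^ n := by
        have := one_le_pow₀ hM (n := n)
        nlinarith
      have h4 := abs_sub_abs_le_abs_sub (p (I c) : ℝ) (q * x ^ (I c : ℕ))
      simp only [Fin.val_zero, zero_add]
      linarith
    · simp only [hB, Matrix.of_apply, Fin.cons_succ, hA, Fin.val_succ, Fin.val_castSucc]
      have hi := i.2
      have h1 := hp (i + 1 + I c) (by omega)
      have h2 := hp (i + I c) (by omega)
      have h3 : (p (i + 1 + I c) : ℝ) - x * p (i + I c) = (p (i + 1 + I c) - q * x ^ ((i:ℕ) + 1 + I c)) - x * (p (i + I c) - q * x ^ ((i:ℕ) + I c)) := by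
        ring
      rw [h3]
      refine (abs_sub _ _).trans ?_
      rw [abs_mul]
      have := mul_le_mul hx h2 (abs_nonneg _) (by linarith)
      linarith)
  refine hb.trans (le_of_eq ?_)
  rw [Fin.prod_univ_succ]
  simp

/-- The linear functional attached to the sequence `p`. -/
noncomputable def phi (n : ℕ) (p : ℕ → ℤ) : ℚ[X] →ₗ[ℚ] ℚ := ∑ i ∈ Finset.range (n + 1), (p i : ℚ) • lcoeff ℚ i

lemma phi_apply (n : ℕ) (p : ℕ → ℤ) (P : ℚ[X]) : phi n p P = ∑ i ∈ Finset.range (n + 1), (p i : ℚ) * P.coeff i := by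
  simp [phi]

lemma phi_X (n : ℕ) (p : ℕ → ℤ) (l : ℕ) (hl : l ≤ n) : phi n p (X ^ l) = p l := by
  rw [phi_apply, Finset.sum_eq_single l]
  · simp
  · intro i _ hi; simp [coeff_X_pow, hi]
  · intro h; exact absurd (Finset.mem_range.2 (by omega)) h

/-- degeneracy at level `r` -/
def Dg (n : ℕ) (p : ℕ → ℤ) (r : ℕ) : Prop :=
  ∃ B : ℚ[X], B ≠ 0 ∧ B.natDegree ≤ r ∧ ∀ i, i + r ≤ n → phi n p (B * X ^ i) = 0

lemma not_Dg {n : ℕ} {p : ℕ → ℤ} {j : ℕ} (hj : 2 * j < n) (h : ¬ Dg n p j) (b : Fin (j + 1) → ℚ)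
    (hb : ∀ l : Fin (n - j + 1), ∑ i, b i * (hank p j (n - j + 1) i l : ℚ) = 0) : b = 0 := by
  by_contra hne
  apply h
  have hcoeff : ∀ i : Fin (j + 1), (∑ i, C (b i) * X ^ (i:ℕ)).coeff i = b i := by
    intro i
    rw [finset_sum_coeff, Finset.sum_eq_single i]
    · simp
    · intro k _ hk
      rw [coeff_C_mul_X_pow, if_neg (fun h => hk (Fin.ext h.symm))]
    · simp
  refine ⟨∑ i, C (b i) * X ^ (i:ℕ), ?_, ?_, ?_⟩
  · intro h0
    apply hne
    ext i
    rw [← hcoeff i, h0]; simp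
  · apply natDegree_sum_le_of_forall_le
    intro i _
    refine (natDegree_C_mul_X_pow_le _ _).trans ?_
    have := i.2
    omega
  · intro l hl
    have := hb ⟨l, by omega⟩
    rw [Finset.sum_mul, map_sum, ← this]
    refine Finset.sum_congr rfl fun i _ => ?_
    have hi := i.2
    rw [mul_assoc, ← pow_add, ← smul_eq_C_mul, map_smul, phi_X _ _ _ (by omega), smul_eq_mul]
    rfl

lemma div_of_Dg {n : ℕ} {p : ℕ → ℤ} {j : ℕ} (hj : 2 * j < n) (h : ¬ Dg n p j) (A P : ℚ[X]) (hA0 : A ≠ 0) (hA : A.natDegree ≤ j + 1)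
    (hAφ : ∀ i, i + (j + 1) ≤ n → phi n p (A * X ^ i) = 0) (hP : P.natDegree ≤ n - j)
    (hPφ : ∀ i ≤ j, phi n p (P * X ^ i) = 0) : A ∣ P := by
  set N := n - j + 1 with hN
  set Ψ : degreeLT ℚ N →ₗ[ℚ] (Fin (j + 1) → ℚ) := LinearMap.pi fun i => 
    (phi n p) ∘ₗ (LinearMap.mulRight ℚ (X ^ (i:ℕ))) ∘ₗ (degreeLT ℚ N).subtype with hΨ
  have hΨa : ∀ Q i, Ψ Q i = phi n p (Q.1 * X ^ (i:ℕ)) := fun Q i => rfl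
  have hsurj : LinearMap.range Ψ = ⊤ := by
    rw [← top_le_iff, ← span_cols (fun (l : Fin N) i => (hank p j N i l : ℚ)) (not_Dg hj h), Submodule.span_le]
    rintro _ ⟨l, rfl⟩
    have hl := l.2
    refine ⟨⟨X ^ (l:ℕ), ?_⟩, ?_⟩
    · rw [mem_degreeLT, degree_X_pow]; exact_mod_cast hl
    · ext i
      have hi := i.2
      rw [hΨa]
      simp only
      rw [← pow_add, phi_X _ _ _ (by omega)]
      simp [hank, add_comm]
  have hfr : ∀ N, Module.finrank ℚ (degreeLT ℚ N) = N := by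
    intro N
    rw [(degreeLTEquiv ℚ N).finrank_eq]; simp
  haveI : ∀ N, FiniteDimensional ℚ (degreeLT ℚ N) := fun N => Module.Finite.equiv (degreeLTEquiv ℚ N).symm
  have hker : Module.finrank ℚ (LinearMap.ker Ψ) = n - 2 * j := by
    have := LinearMap.finrank_range_add_finrank_ker Ψ
    rw [hsurj, finrank_top, hfr, Module.finrank_fin_fun] at this
    omega
  have hV : ∀ V : ℚ[X], V.natDegree < n - j → phi n p (A * V) = 0 := by
    intro V hV
    rw [V.as_sum_range' (n - j) hV, Finset.mul_sum, map_sum]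
    apply Finset.sum_eq_zero
    intro i hi
    rw [Finset.mem_range] at hi
    rw [← C_mul_X_pow_eq_monomial, mul_left_comm, ← smul_eq_C_mul, map_smul, hAφ i (by omega), smul_zero]
  have hUdeg : ∀ U ∈ degreeLT ℚ (n - 2 * j), U.natDegree < n - 2 * j := by
    intro U hU
    rw [mem_degreeLT] at hU
    by_cases h0 : U = 0
    · rw [h0]; simp; omega
    · exact (natDegree_lt_iff_degree_lt h0).2 hU
  have hmem : ∀ U ∈ degreeLT ℚ (n - 2 * j), A * U ∈ degreeLT ℚ N := by
    intro U hU
    rw [mem_degreeLT]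
    have h1 : (A * U).natDegree < N := by
      have := natDegree_mul_le (p := A) (q := U)
      have := hUdeg U hU
      omega
    exact lt_of_le_of_lt degree_le_natDegree (by exact_mod_cast h1)
  let G0 : degreeLT ℚ (n - 2 * j) →ₗ[ℚ] degreeLT ℚ N :=
    LinearMap.codRestrict _ ((LinearMap.mulLeft ℚ A) ∘ₗ (degreeLT ℚ (n - 2 * j)).subtype) (fun U => hmem U.1 U.2)
  have hG0 : ∀ U, (G0 U).1 = A * U.1 := fun U => rfl
  let G : degreeLT ℚ (n - 2 * j) →ₗ[ℚ] LinearMap.ker Ψ := LinearMap.codRestrict _ G0 (by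
    intro U
    rw [LinearMap.mem_ker]
    ext i
    rw [hΨa, hG0, mul_assoc]
    apply hV
    have := natDegree_mul_le (p := U.1) (q := X ^ (i:ℕ))
    rw [natDegree_X_pow] at this
    have := hUdeg U.1 U.2
    have := i.2
    omega)
  have hG : ∀ U, (G U).1.1 = A * U.1 := fun U => rfl
  have hGinj : Function.Injective G := by
    intro U V hUV
    apply Subtype.ext
    have : (G U).1.1 = (G V).1.1 := by rw [hUV]
    rw [hG, hG] at this
    exact mul_left_cancel₀ hA0 this
  have hfe : Module.finrank ℚ (degreeLT ℚ (n - 2 * j)) = Module.finrank ℚ (LinearMap.ker Ψ) := by rw [hfr, hker]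
  have hfk : FiniteDimensional ℚ (LinearMap.ker Ψ) := inferInstance
  have hGiff := @LinearMap.injective_iff_surjective_of_finrank_eq_finrank ℚ (degreeLT ℚ (n - 2 * j)) _ _ _
    (LinearMap.ker Ψ) _ _ _ _ hfe G
  have hGs : Function.Surjective G := hGiff.1 hGinj
  have hPm : P ∈ degreeLT ℚ N := by
    rw [mem_degreeLT]
    exact lt_of_le_of_lt degree_le_natDegree (by exact_mod_cast (by omega : P.natDegree < N))
  obtain ⟨U, hU⟩ := hGs ⟨⟨P, hPm⟩, by
    rw [LinearMap.mem_ker]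
    ext i
    have := i.2
    rw [hΨa]
    exact hPφ i (by omega)⟩
  have : (G U).1.1 = P := by rw [hU]
  exact ⟨U.1, by rw [← this, hG]⟩

lemma val_bound (n : ℕ) (p : ℕ → ℤ) (x q δ : ℝ) (hq : 0 ≤ q) (hp : ∀ i ≤ n, |p i - q * x ^ i| ≤ δ) (P : ℤ[X]) (hP : P.natDegree ≤ n)
    (hφ : phi n p (P.map (Int.castRingHom ℚ)) = 0) : q * |tc P x 0| ≤ (n + 1) * 2 ^ n * ht P * δ := by
  have h1 : ∑ i ∈ Finset.range (n + 1), (p i : ℝ) * P.coeff i = 0 := by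
    rw [phi_apply] at hφ
    simp only [coeff_map, eq_intCast] at hφ
    exact_mod_cast hφ
  have h2 : tc P x 0 = ∑ i ∈ Finset.range (n + 1), (P.coeff i : ℝ) * x ^ i := by
    rw [tc_zero, eval_eq_sum_range' (n := n + 1) (by rw [rp_natDegree]; omega)]
    simp [rp]
  have h3 : q * tc P x 0 = ∑ i ∈ Finset.range (n + 1), -((p i - q * x ^ i) * P.coeff i) := by
    rw [h2, ← sub_zero (q * _), ← h1, Finset.mul_sum, ← Finset.sum_sub_distrib]
    refine Finset.sum_congr rfl fun i _ => by ring
  rw [← abs_of_nonneg hq, ← abs_mul, h3]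
  refine (Finset.abs_sum_le_sum_abs _ _).trans ?_
  have h4 : ∀ i ∈ Finset.range (n + 1), |-((p i - q * x ^ i) * (P.coeff i : ℝ))| ≤ δ * (2 ^ n * ht P) := by
    intro i hi
    rw [Finset.mem_range] at hi
    rw [abs_neg, abs_mul]
    have h5 := hp i (by omega)
    exact mul_le_mul h5 (abs_coeff_le P n hP i) (abs_nonneg _) ((abs_nonneg _).trans h5)
  refine (Finset.sum_le_card_nsmul _ _ _ h4).trans (le_of_eq ?_)
  simp; ring

lemma kern_poly (n j : ℕ) (hj : 2 * j < n) (p : ℕ → ℤ) (h : ¬ Dg n p j) (D : ℝ) (hD0 : 0 ≤ D)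
    (hD : ∀ I : Fin (j + 1) → Fin (n - j + 1), |((((hank p j (n - j + 1)).submatrix id I).det : ℤ) : ℝ)| ≤ D) :
    ∃ P : ℤ[X], P ≠ 0 ∧ P.natDegree ≤ n - j ∧ (∀ i ≤ j, phi n p (P.map (Int.castRingHom ℚ) * X ^ i) = 0) ∧
      ht P ≤ (n + 1) ^ 2 * D ^ (1 / ((n:ℝ) - 2 * j)) := by
  set N := n - j + 1 with hN
  have he : ((n - 2 * j : ℕ) : ℝ) = (n:ℝ) - 2 * j := by
    rw [Nat.cast_sub hj.le]; push_cast; ring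
  have hepos : (0:ℝ) < (n:ℝ) - 2 * j := by rw [← he]; exact_mod_cast (by omega : 0 < n - 2 * j)
  set T := ⌊D ^ (1 / ((n:ℝ) - 2 * j))⌋₊ with hT
  have hTle : (T:ℝ) ≤ D ^ (1 / ((n:ℝ) - 2 * j)) := Nat.floor_le (by positivity)
  obtain ⟨a, ha0, haK, hab⟩ := kernel_small (hank p j N) (exists_minor _ (not_Dg hj h)) ⌊D⌋₊ T (by
    intro I
    apply Nat.le_floor
    have := hD I
    rw [Nat.cast_natAbs, Int.cast_abs]
    exact this) (by
    have h1 : D < ((T:ℝ) + 1) ^ (n - 2 * j) := by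
      have h2 : D ^ (1 / ((n:ℝ) - 2 * j)) < T + 1 := Nat.lt_floor_add_one _
      have h3 := pow_lt_pow_left₀ h2 (by positivity) (by omega : n - 2 * j ≠ 0)
      rwa [← Real.rpow_natCast, ← Real.rpow_mul hD0, he, one_div_mul_cancel hepos.ne', Real.rpow_one] at h3
    have h4 : N - (j + 1) = n - 2 * j := by omega
    rw [h4, Nat.floor_lt hD0]
    exact_mod_cast h1)
  have hcoeff : ∀ l : Fin N, (∑ l, C (a l) * X ^ (l:ℕ)).coeff l = a l := by
    intro i
    rw [finset_sum_coeff, Finset.sum_eq_single i]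
    · simp
    · intro k _ hk
      rw [coeff_C_mul_X_pow, if_neg (fun h => hk (Fin.ext h.symm))]
    · simp
  have hdeg : (∑ l, C (a l) * X ^ (l:ℕ)).natDegree ≤ n - j := by
    apply natDegree_sum_le_of_forall_le
    intro i _
    refine (natDegree_C_mul_X_pow_le _ _).trans ?_
    have := i.2
    omega
  refine ⟨∑ l, C (a l) * X ^ (l:ℕ), ?_, hdeg, ?_, ?_⟩
  · intro h0
    apply ha0
    ext l
    rw [← hcoeff l, h0]; simp
  · intro i hi
    have := congrFun haK ⟨i, by omega⟩
    simp only [Matrix.mulVec, dotProduct, hank, Matrix.of_apply, Pi.zero_apply] at this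
    rw [Polynomial.map_sum, Finset.sum_mul, map_sum]
    have h5 : ∀ l : Fin N, phi n p (map (Int.castRingHom ℚ) (C (a l) * X ^ (l:ℕ)) * X ^ i) = ((p (i + l) * a l : ℤ) : ℚ) := by
      intro l
      have hl := l.2
      rw [Polynomial.map_mul, map_C, Polynomial.map_pow, map_X, mul_assoc, ← pow_add, ← smul_eq_C_mul, map_smul,
        phi_X _ _ _ (by omega), smul_eq_mul]
      push_cast
      rw [add_comm (l:ℕ) i, mul_comm]; simp
    rw [Finset.sum_congr rfl fun l _ => h5 l]
    exact_mod_cast this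
  · have hB : ∀ i, |((∑ l, C (a l) * X ^ (l:ℕ)).coeff i : ℝ)| ≤ (n + 1) * D ^ (1 / ((n:ℝ) - 2 * j)) := by
      intro i
      by_cases hi : i < N
      · have h1 := hcoeff ⟨i, hi⟩
        simp only at h1
        rw [h1]
        have h2 := hab ⟨i, hi⟩
        have h3 : |(a ⟨i, hi⟩ : ℝ)| ≤ N * T := by exact_mod_cast h2
        refine h3.trans (mul_le_mul ?_ hTle (by positivity) (by positivity))
        exact_mod_cast (by omega : N ≤ n + 1)
      · rw [coeff_eq_zero_of_natDegree_lt (by omega)]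
        simp; positivity
    refine (ht_le_of_coeff _ n (by omega) _ hB).trans (le_of_eq ?_)
    ring

end Bern

namespace Bern
open Polynomial Filter

lemma Dg_prim {n : ℕ} {p : ℕ → ℤ} {r : ℕ} (h : Dg n p r) : ∃ A : ℤ[X], A.IsPrimitive ∧ A.natDegree ≤ r ∧
    ∀ i, i + r ≤ n → phi n p (A.map (Int.castRingHom ℚ) * X ^ i) = 0 := by
  obtain ⟨B, hB0, hBd, hB⟩ := h
  obtain ⟨b, hb, hbe⟩ := IsLocalization.integerNormalization_spec (nonZeroDivisors ℤ) B
  set Q := IsLocalization.integerNormalization (nonZeroDivisors ℤ) B with hQ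
  have hb0 : b ≠ 0 := nonZeroDivisors.ne_zero hb
  have hbe' : Q.map (Int.castRingHom ℚ) = (b:ℚ) • B := by
    have : (algebraMap ℤ ℚ) = Int.castRingHom ℚ := rfl
    rw [← this, hbe, Int.cast_smul_eq_zsmul]
  have hQ0 : Q ≠ 0 := by
    intro h0
    rw [h0, Polynomial.map_zero] at hbe'
    have : (b:ℚ) ≠ 0 := by exact_mod_cast hb0
    exact (smul_ne_zero this hB0) hbe'.symm
  refine ⟨Q.primPart, Q.isPrimitive_primPart, ?_, ?_⟩
  · rw [natDegree_primPart]
    have h1 : (Q.map (Int.castRingHom ℚ)).natDegree = Q.natDegree :=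
      natDegree_map_eq_of_injective (RingHom.injective_int _) _
    rw [← h1, hbe']
    exact (natDegree_smul_le _ _).trans hBd
  · intro i hi
    have hc : (Q.content : ℚ) ≠ 0 := by
      have : Q.content ≠ 0 := by rwa [Ne, content_eq_zero_iff]
      exact_mod_cast this
    have h2 : Q.map (Int.castRingHom ℚ) = (Q.content : ℚ) • Q.primPart.map (Int.castRingHom ℚ) := by
      conv_lhs => rw [Q.eq_C_content_mul_primPart]
      rw [Polynomial.map_mul, map_C, smul_eq_C_mul]; rfl
    have h3 : (Q.content : ℚ) • (Q.primPart.map (Int.castRingHom ℚ) * X ^ i) = (b:ℚ) • (B * X ^ i) := by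
      rw [← smul_mul_assoc, ← h2, hbe', smul_mul_assoc]
    have h4 : (Q.content : ℚ) * phi n p (Q.primPart.map (Int.castRingHom ℚ) * X ^ i) = 0 := by
      rw [← smul_eq_mul, ← map_smul, h3, map_smul, hB i hi, smul_zero]
    exact (mul_eq_zero.1 h4).resolve_left hc

lemma not_Dg_zero {n : ℕ} {p : ℕ → ℤ} (h : p 0 ≠ 0) : ¬ Dg n p 0 := by
  rintro ⟨B, hB0, hBd, hB⟩
  have h1 := hB 0 (by omega)
  rw [eq_C_of_natDegree_le_zero hBd, ← smul_eq_C_mul, map_smul, phi_X _ _ _ (by omega), smul_eq_mul] at h1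
  rcases mul_eq_zero.1 h1 with h2 | h2
  · apply hB0
    rw [eq_C_of_natDegree_le_zero hBd, h2, C_0]
  · exact h (by exact_mod_cast h2)

lemma D_bound (n j k : ℕ) (hjk : j ≤ k) (hk : 2 * k < n) (lam M q : ℝ) (hl : 0 ≤ lam) (hl2 : lam * n ≤ 2) (hM : 1 ≤ M) (hq : 1 ≤ q) :
    ((j + 1).factorial * (2 * q * M ^ n * ((1 + M) * q ^ (-lam)) ^ j) : ℝ) ^ (1 / ((n:ℝ) - 2 * j)) ≤
      ((n + 1).factorial * (2 * M ^ n * (1 + M) ^ n)) * q ^ ((1 - k * lam) / ((n:ℝ) - 2 * k)) := by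
  have hq0 : 0 < q := by linarith
  obtain ⟨K, hK⟩ : ∃ K : ℝ, K = (n + 1).factorial * (2 * M ^ n * (1 + M) ^ n) := ⟨_, rfl⟩
  have hjn : (j:ℝ) ≤ k := by exact_mod_cast hjk
  have hkn : 2 * (k:ℝ) + 1 ≤ n := by exact_mod_cast hk
  have hfac : (1:ℝ) ≤ (n + 1).factorial := by exact_mod_cast Nat.one_le_iff_ne_zero.2 (Nat.factorial_ne_zero _)
  have hMn : 1 ≤ M ^ n := one_le_pow₀ hM
  have hMn' : 1 ≤ (1 + M) ^ n := one_le_pow₀ (by linarith)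
  have hK1 : 1 ≤ K := by
    rw [hK]
    have h1 : 1 ≤ 2 * M ^ n * (1 + M) ^ n := by nlinarith
    nlinarith
  have hD : ((j + 1).factorial * (2 * q * M ^ n * ((1 + M) * q ^ (-lam)) ^ j) : ℝ) ≤ K * q ^ (1 - j * lam) := by
    have h1 : q ^ (1 - j * lam) = q * (q ^ (-lam)) ^ j := by
      rw [← Real.rpow_natCast, ← Real.rpow_mul hq0.le, sub_eq_add_neg, Real.rpow_add hq0, Real.rpow_one]
      congr 2; ring
    rw [h1, mul_pow, hK]
    have h2 : ((j + 1).factorial : ℝ) ≤ (n + 1).factorial := by exact_mod_cast Nat.factorial_le (by omega)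
    have h3 : (1 + M) ^ j ≤ (1 + M) ^ n := pow_le_pow_right₀ (by linarith) (by omega)
    have h4 : 0 ≤ q * (q ^ (-lam)) ^ j := by positivity
    calc ((j + 1).factorial * (2 * q * M ^ n * ((1 + M) ^ j * (q ^ (-lam)) ^ j)) : ℝ)
        = ((j + 1).factorial * (2 * M ^ n * (1 + M) ^ j)) * (q * (q ^ (-lam)) ^ j) := by ring
      _ ≤ _ := by
        apply mul_le_mul_of_nonneg_right _ h4
        apply mul_le_mul h2 _ (by positivity) (by positivity)
        apply mul_le_mul_of_nonneg_left h3 (by positivity)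
  have hd : 1 ≤ (n:ℝ) - 2 * j := by linarith
  have he0 : 0 ≤ 1 / ((n:ℝ) - 2 * j) := by positivity
  have he1 : 1 / ((n:ℝ) - 2 * j) ≤ 1 := by rw [div_le_one (by linarith)]; exact hd
  rw [← hK]
  refine (Real.rpow_le_rpow (by positivity) hD he0).trans ?_
  rw [Real.mul_rpow (by linarith) (by positivity), ← Real.rpow_mul hq0.le]
  apply mul_le_mul _ _ (by positivity) (by linarith)
  · calc K ^ (1 / ((n:ℝ) - 2 * j)) ≤ K ^ (1:ℝ) := Real.rpow_le_rpow_of_exponent_le hK1 he1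
      _ = K := Real.rpow_one K
  · apply Real.rpow_le_rpow_of_exponent_le hq
    rw [mul_one_div, div_le_div_iff₀ (by linarith) (by linarith)]
    nlinarith [mul_nonneg (sub_nonneg.2 hjn) (sub_nonneg.2 hl2)]

lemma exists_poly (n k : ℕ) (hk : 2 * k < n) (lam M : ℝ) (hl : 0 ≤ lam) (hl2 : lam * n ≤ 2) (hM : 1 ≤ M) :
    ∃ C : ℝ, 1 ≤ C ∧ ∀ (x q : ℝ) (p : ℕ → ℤ), |x| ≤ M → 1 ≤ q → (p 0 : ℝ) = q → (∀ i ≤ n, |p i - q * x ^ i| ≤ q ^ (-lam)) →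
      ∃ P : ℤ[X], P ≠ 0 ∧ P.natDegree ≤ n - k ∧ ht P ≤ C * q ^ ((1 - k * lam) / ((n:ℝ) - 2 * k)) ∧
        q * |tc P x 0| ≤ C * ht P * q ^ (-lam) := by
  classical
  obtain ⟨K, hK⟩ : ∃ K : ℝ, K = (n + 1).factorial * (2 * M ^ n * (1 + M) ^ n) := ⟨_, rfl⟩
  have hK0 : 0 ≤ K := by rw [hK]; positivity
  have hn0 : (0:ℝ) ≤ n := by positivity
  have h2n : (1:ℝ) ≤ 2 ^ n := one_le_pow₀ (by norm_num)
  have hc1 : 1 ≤ ((n:ℝ) + 1) * 2 ^ n := by nlinarith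
  refine ⟨max ((n + 1) * 2 ^ n) ((n + 1) ^ 2 * K), le_max_of_le_left hc1, ?_⟩
  intro x q p hx hq hp0 hp
  have hq0 : 0 < q := by linarith
  have hδ : 0 < q ^ (-lam) := Real.rpow_pos_of_pos hq0 _
  have hδ1 : q ^ (-lam) ≤ 1 := Real.rpow_le_one_of_one_le_of_nonpos hq (by linarith)
  have hval : ∀ P : ℤ[X], P.natDegree ≤ n → phi n p (P.map (Int.castRingHom ℚ) * X ^ 0) = 0 →
      q * |tc P x 0| ≤ max ((n + 1) * 2 ^ n : ℝ) ((n + 1) ^ 2 * K) * ht P * q ^ (-lam) := by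
    intro P hP h0
    rw [pow_zero, mul_one] at h0
    refine (val_bound n p x q _ hq0.le hp P hP h0).trans ?_
    gcongr
    · exact ht_nonneg P
    · exact le_max_left _ _
  have hkern : ∀ j ≤ k, ¬ Dg n p j → ∃ P : ℤ[X], P ≠ 0 ∧ P.natDegree ≤ n - j ∧ (∀ i ≤ j, phi n p (P.map (Int.castRingHom ℚ) * X ^ i) = 0) ∧
      ht P ≤ max ((n + 1) * 2 ^ n : ℝ) ((n + 1) ^ 2 * K) * q ^ ((1 - k * lam) / ((n:ℝ) - 2 * k)) := by
    intro j hj hD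
    obtain ⟨P, h1, h2, h3, h4⟩ := kern_poly n j (by omega) p hD _ (by positivity)
      (fun I => minor_bound n j (by omega) p x q _ M hx hM hδ.le hδ1 hq hp I)
    refine ⟨P, h1, h2, h3, h4.trans ?_⟩
    have h5 := D_bound n j k hj hk lam M q hl hl2 hM hq
    rw [← hK] at h5
    calc _ ≤ ((n:ℝ) + 1) ^ 2 * (K * q ^ ((1 - k * lam) / ((n:ℝ) - 2 * k))) :=
          mul_le_mul_of_nonneg_left h5 (by positivity)
      _ = ((n:ℝ) + 1) ^ 2 * K * q ^ ((1 - k * lam) / ((n:ℝ) - 2 * k)) := by ring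
      _ ≤ _ := mul_le_mul_of_nonneg_right (le_max_right _ _) (by positivity)
  by_cases hD : Dg n p k
  · have hex : ∃ r, Dg n p r := ⟨k, hD⟩
    obtain ⟨r, hr⟩ : ∃ r, r = Nat.find hex := ⟨_, rfl⟩
    have hrD : Dg n p r := hr ▸ Nat.find_spec hex
    have hrk : r ≤ k := hr ▸ Nat.find_min' hex hD
    have hr0 : r ≠ 0 := by
      intro h0
      rw [h0] at hrD
      refine not_Dg_zero ?_ hrD
      intro h1
      rw [h1] at hp0
      simp at hp0; linarith
    obtain ⟨j, rfl⟩ := Nat.exists_eq_succ_of_ne_zero hr0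
    have hj : ¬ Dg n p j := Nat.find_min hex (by omega)
    obtain ⟨P, h1, h2, h3, h4⟩ := hkern j (by omega) hj
    obtain ⟨A, hA1, hA2, hA3⟩ := Dg_prim hrD
    have hA0 : A ≠ 0 := hA1.ne_zero
    have hdvd : A ∣ P := by
      rw [IsPrimitive.Int.dvd_iff_map_cast_dvd_map_cast _ _ hA1]
      apply div_of_Dg (by omega) hj
      · rwa [Ne, Polynomial.map_eq_zero_iff (RingHom.injective_int _)]
      · exact natDegree_map_le.trans hA2
      · exact hA3
      · exact natDegree_map_le.trans h2
      · exact h3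
    refine ⟨A, hA0, by omega, ?_, hval A (by omega) (hA3 0 (by omega))⟩
    refine le_trans ?_ h4
    obtain ⟨B, rfl⟩ := hdvd
    rw [ht_mul]
    have := one_le_ht (right_ne_zero_of_mul h1)
    nlinarith [ht_nonneg A]
  · obtain ⟨P, h1, h2, h3, h4⟩ := hkern k le_rfl hD
    exact ⟨P, h1, h2, h4, hval P (by omega) (h3 0 (by omega))⟩

end Bern

namespace Bern
open Polynomial Filter

lemma mem_Bad (n k : ℕ) (hk : 2 * k < n) (lam M W x : ℝ) (hl : 0 < lam) (hl2 : lam * n ≤ 2) (hM : 1 ≤ M) (hx : |x| ≤ M)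
    (htr : ∀ R : ℤ[X], R ≠ 0 → tc R x 0 ≠ 0) (hW0 : 0 < W) (hW : W * ((1 - k * lam) / ((n:ℝ) - 2 * k)) < 1 + lam)
    (hinf : {q : ℕ | 0 < q ∧ ∀ i ∈ Finset.Icc 1 n, |(q:ℝ) * x ^ i - round ((q:ℝ) * x ^ i)| ≤ (q:ℝ) ^ (-lam)}.Infinite) :
    x ∈ Bad (n - k) W M := by
  refine ⟨hx, ?_⟩
  intro hfin
  obtain ⟨K, hK1, hK⟩ := bound_fin _ hfin (fun R => 1 / |tc R x 0|)
  obtain ⟨K', hK1', hK'⟩ := bound_fin _ hfin ht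
  obtain ⟨C, hC1, hC⟩ := exists_poly n k hk lam M hl.le hl2 hM
  have hev := (ev_const (C * C ^ W) (1 + lam - W * ((1 - k * lam) / ((n:ℝ) - 2 * k))) (by linarith)).and
    (eventually_gt_atTop (C * K' * K))
  obtain ⟨B, hB⟩ := eventually_atTop.1 hev
  obtain ⟨q, ⟨hq0, hqi⟩, hqB⟩ := hinf.exists_gt ⌈B⌉₊
  have hqB' : B ≤ (q:ℝ) := (Nat.le_ceil B).trans (by exact_mod_cast hqB.le)
  obtain ⟨⟨hq1, hqC⟩, hqK⟩ := hB q hqB'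
  have hqpos : (0:ℝ) < q := by linarith
  obtain ⟨P, hP0, hPd, hPh, hPx⟩ := hC x q (fun i => round ((q:ℝ) * x ^ i)) hx hq1.le (by simp) (by
    intro i hi
    rcases Nat.eq_zero_or_pos i with rfl | h
    · simp; positivity
    · rw [abs_sub_comm]
      exact hqi i (Finset.mem_Icc.2 ⟨h, hi⟩))
  have hh1 := one_le_ht hP0
  have hhpos : 0 < ht P := by linarith
  have hmem : P ∈ {R : ℤ[X] | R ≠ 0 ∧ R.natDegree ≤ n - k ∧ |tc R x 0| ≤ ht R ^ (1 - W)} := by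
    refine ⟨hP0, hPd, ?_⟩
    obtain ⟨η, hη⟩ : ∃ η, η = (1 - k * lam) / ((n:ℝ) - 2 * k) := ⟨_, rfl⟩
    rw [← hη] at hPh hqC
    have h1 : ht P ^ W ≤ C ^ W * (q:ℝ) ^ (W * η) := by
      refine (Real.rpow_le_rpow hhpos.le hPh hW0.le).trans (le_of_eq ?_)
      rw [Real.mul_rpow (by linarith) (by positivity), ← Real.rpow_mul hqpos.le, mul_comm η]
    have hCW : 0 < C ^ W := Real.rpow_pos_of_pos (by linarith) _
    have hhW : 0 < ht P ^ W := Real.rpow_pos_of_pos hhpos _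
    have h2 : C * (C ^ W * (q:ℝ) ^ (W * η)) ≤ q * (q:ℝ) ^ lam := by
      have h3 : (q:ℝ) * (q:ℝ) ^ lam = (q:ℝ) ^ (1 + lam - W * η) * (q:ℝ) ^ (W * η) := by
        rw [← Real.rpow_add hqpos, sub_add_cancel, Real.rpow_add hqpos, Real.rpow_one]
      rw [h3, ← mul_assoc]
      exact mul_le_mul_of_nonneg_right hqC (by positivity)
    have hql : 0 < (q:ℝ) ^ lam := Real.rpow_pos_of_pos hqpos _
    have h4 : C * ht P ^ W ≤ q * (q:ℝ) ^ lam := (mul_le_mul_of_nonneg_left h1 (by linarith)).trans h2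
    rw [Real.rpow_sub hhpos, Real.rpow_one, le_div_iff₀ hhW]
    rw [Real.rpow_neg hqpos.le, ← div_eq_mul_inv, le_div_iff₀ hql] at hPx
    have h5 : |tc P x 0| * (C * ht P ^ W) ≤ C * ht P := by
      calc _ ≤ |tc P x 0| * (q * (q:ℝ) ^ lam) := mul_le_mul_of_nonneg_left h4 (abs_nonneg _)
        _ = q * |tc P x 0| * (q:ℝ) ^ lam := by ring
        _ ≤ _ := hPx
    have h6 : C * (|tc P x 0| * ht P ^ W) ≤ C * ht P := by linarith
    exact le_of_mul_le_mul_left h6 (by linarith)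
  have h1 := hK P hmem
  have h2 := hK' P hmem
  have h3 : 0 < |tc P x 0| := abs_pos.2 (htr P hP0)
  rw [div_le_iff₀ h3] at h1
  have h4 : (q:ℝ) ^ (-lam) ≤ 1 := Real.rpow_le_one_of_one_le_of_nonpos hq1.le (by linarith)
  have h5 : q * |tc P x 0| ≤ C * K' := by
    refine hPx.trans ?_
    calc C * ht P * (q:ℝ) ^ (-lam) ≤ C * ht P * 1 := mul_le_mul_of_nonneg_left h4 (by positivity)
      _ ≤ C * K' := by rw [mul_one]; exact mul_le_mul_of_nonneg_left h2 (by linarith)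
  have h6 : (q:ℝ) ≤ C * K' * K := by
    calc (q:ℝ) ≤ q * (K * |tc P x 0|) := by nlinarith
      _ = q * |tc P x 0| * K := by ring
      _ ≤ _ := mul_le_mul_of_nonneg_right h5 (by linarith)
  linarith

end Bern

theorem inf_of_mem {n : ℕ} {I : Set ℝ} {lam x : ℝ} (hlam : 0 < lam) (hx : x ∈ SimSet n I lam) :
    {q : ℕ | 0 < q ∧ ∀ i ∈ Finset.Icc 1 n, |(q:ℝ) * x ^ i - round ((q:ℝ) * x ^ i)| ≤ (q:ℝ) ^ (-lam)}.Infinite := by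
  obtain ⟨_, hx2⟩ := hx
  obtain ⟨_, ⟨l, ⟨hl0, hl⟩, rfl⟩, hlt⟩ := lt_sSup_iff.1 hx2
  have hlt' : lam < l := (ENNReal.ofReal_lt_ofReal_iff hl0).1 hlt
  refine hl.mono ?_
  rintro q ⟨hq, hqi⟩
  refine ⟨hq, fun i hi => (hqi i hi).trans ?_⟩
  exact Real.rpow_le_rpow_of_exponent_le (by exact_mod_cast hq) (by linarith)

theorem dim_aux (n k : ℕ) (hk : 2 * k < n) (lam : ℝ) (hl : 0 < lam) (hl2 : lam * n ≤ 2) (I : Set ℝ)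
    (s : NNReal) (hs : (1:ℝ) / 2 < s) (hs1 : (s:ℝ) < 1)
    (hs0 : ((n : ℝ) - k + 1) * (1 - k * lam) / (((n : ℝ) - 2 * k) * (1 + lam)) < s) :
    dimH (SimSet n I lam) ≤ s := by
  have hkn : 2 * (k:ℝ) + 1 ≤ n := by exact_mod_cast hk
  have hcast : ((n - k : ℕ) : ℝ) = n - k := by rw [Nat.cast_sub (by omega)]
  have hk0 : (0:ℝ) ≤ k := by positivity
  have hklam : 0 < 1 - k * lam := by
    have : (k * lam) * n ≤ 2 * k := by nlinarith
    by_contra h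
    nlinarith
  obtain ⟨η, hη⟩ : ∃ η, η = (1 - k * lam) / ((n:ℝ) - 2 * k) := ⟨_, rfl⟩
  have hη0 : 0 < η := by rw [hη]; exact div_pos hklam (by linarith)
  have hs00 : (0:ℝ) < s := by linarith
  have hlt : ((n:ℝ) - k + 1) / s < (1 + lam) / η := by
    rw [div_lt_div_iff₀ hs00 hη0, hη, ← mul_div_assoc, div_lt_iff₀ (by linarith)]
    rw [div_lt_iff₀ (mul_pos (by linarith) (by linarith))] at hs0
    linarith
  obtain ⟨W, hW1, hW2⟩ := exists_between hlt
  have hW0 : 0 < W := lt_trans (div_pos (by linarith) hs00) hW1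
  rw [div_lt_iff₀ hs00] at hW1
  rw [lt_div_iff₀ hη0, hη] at hW2
  have hsub : SimSet n I lam ⊆ {x : ℝ | ∃ R : Polynomial ℤ, R ≠ 0 ∧ Bern.tc R x 0 = 0} ∪ ⋃ N : ℕ, Bern.Bad (n - k) W (N + 1) := by
    intro x hx
    by_cases hR : ∃ R : Polynomial ℤ, R ≠ 0 ∧ Bern.tc R x 0 = 0
    · exact Or.inl hR
    · right
      push Not at hR
      rw [Set.mem_iUnion]
      obtain ⟨N, hN⟩ := exists_nat_ge |x|
      exact ⟨N, Bern.mem_Bad n k hk lam _ W x hl hl2 (by simp) (by linarith) hR hW0 hW2 (inf_of_mem hl hx)⟩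
  refine (dimH_mono hsub).trans ?_
  rw [dimH_union, dimH_countable Bern.alg_countable, dimH_iUnion]
  refine max_le (by simp) (iSup_le fun N => ?_)
  exact Bern.dimH_Bad s hs hs1 _ _ _ (by rw [hcast]; linarith) (by positivity)

/-- For `n ≥ 2`, `m = ⌊(n-1)/2⌋`, any integer `0 ≤ k ≤ m` and any `1/n ≤ λ ≤ 2/n`,
the Hausdorff dimension of `S_n(I, λ)` is at most
`(n-k+1)(1-kλ) / ((n-2k)(1+λ))` for every interval `I ⊆ ℝ`. -/
theorem stmt0 (n k : ℕ) (hn : 2 ≤ n) (hk : k ≤ (n - 1) / 2)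
    (lam : ℝ) (hlam1 : 1 / (n : ℝ) ≤ lam) (hlam2 : lam ≤ 2 / (n : ℝ))
    (I : Set ℝ) (hI : I.OrdConnected) :
    dimH (SimSet n I lam) ≤
      ENNReal.ofReal (((n : ℝ) - k + 1) * (1 - k * lam) / (((n : ℝ) - 2 * k) * (1 + lam))) := by
  have hn2 : (2:ℝ) ≤ n := by exact_mod_cast hn
  have hn0 : (0:ℝ) < n := by linarith
  have hl : 0 < lam := lt_of_lt_of_le (by positivity) hlam1
  have hl2 : lam * n ≤ 2 := by rwa [le_div_iff₀ hn0] at hlam2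
  have hk2 : 2 * k < n := by omega
  have hkn : 2 * (k:ℝ) + 1 ≤ n := by exact_mod_cast hk2
  have hk0 : (0:ℝ) ≤ k := by positivity
  obtain ⟨s0, hs0⟩ : ∃ s0, s0 = ((n : ℝ) - k + 1) * (1 - k * lam) / (((n : ℝ) - 2 * k) * (1 + lam)) := ⟨_, rfl⟩
  rw [← hs0]
  have hhalf : 1 / 2 ≤ s0 := by
    rw [hs0, div_le_div_iff₀ (by norm_num) (mul_pos (by linarith) (by linarith)), one_mul]
    have h1 : (n:ℝ) - 2 * k ≤ n * (1 - k * lam) := by nlinarith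
    have h2 : n * (1 + lam) ≤ 2 * ((n:ℝ) - k + 1) := by linarith
    have h3 : ((n:ℝ) - 2 * k) * (n * (1 + lam)) ≤ (n * (1 - k * lam)) * (2 * ((n:ℝ) - k + 1)) :=
      mul_le_mul h1 h2 (by positivity) (by linarith)
    have h4 : n * (((n:ℝ) - 2 * k) * (1 + lam)) ≤ n * (((n:ℝ) - k + 1) * (1 - k * lam) * 2) := by linarith
    exact le_of_mul_le_mul_left h4 hn0
  rcases le_or_gt 1 s0 with h1 | h1
  · refine (dimH_mono (Set.subset_univ _)).trans ?_
    rw [Real.dimH_univ]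
    simpa using h1
  · have hlt1 : ENNReal.ofReal s0 < 1 := by rw [← ENNReal.ofReal_one]; exact (ENNReal.ofReal_lt_ofReal_iff one_pos).2 h1
    refine le_of_forall_gt_imp_ge_of_dense fun b hb => ?_
    obtain ⟨s, hs1, hs2⟩ := ENNReal.lt_iff_exists_nnreal_btwn.1 (lt_min hb hlt1)
    have hss : s0 < s := by
      rw [ENNReal.ofReal_lt_iff_lt_toReal (by linarith) (by simp)] at hs1
      simpa using hs1
    refine (dim_aux n k hk2 lam hl hl2 I s (by linarith) ?_ (hs0 ▸ hss)).trans (hs2.le.trans (min_le_left _ _))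
    have := hs2.trans_le (min_le_right _ _)
    exact_mod_cast this
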